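/- Let (V, 𝒮) be a simplicial fan supported on ℝⁿ_{≥0} (encoding a geometric triangulation of the (n−1)-dimensional simplex). Let E ∈ 𝒮 and let C ∈ lk(E) be a face that admits a full partition. If the local h-polynomial ℓ(𝒮, E; t) is the zero polynomial, then C is a U-pyramid. (Theorem 1.8 of the paper.) -/

import Mathlib

open scoped Classical

noncomputable section

/-- The conical hull (set of nonnegative linear combinations) of a finite set of
vectors in `ℝⁿ`. -/
def coneOf {n : ℕ} (F : Finset (Fin n → ℝ)) : Set (Fin n → ℝ) :=
  {x | ∃ lam : (Fin n → ℝ) → ℝ, (∀ v ∈ F, 0 ≤ lam v) ∧ x = ∑ v ∈ F, lam v • v}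

/-- A simplicial fan supported on `ℝⁿ_{≥0}`, encoding a geometric triangulation of
the `(n-1)`-dimensional simplex: a finite vertex set `V ⊆ ℝⁿ_{≥0} ∖ {0}` together
with a downward-closed collection of linearly independent finite subsets of `V`
(the faces, including `∅`) whose cones cover the nonnegative orthant and intersect
along common faces. -/
structure SimplicialFan (n : ℕ) where
  verts : Finset (Fin n → ℝ)
  faces : Finset (Finset (Fin n → ℝ))
  verts_nonneg : ∀ v ∈ verts, ∀ i, 0 ≤ v i
  verts_ne_zero : ∀ v ∈ verts, v ≠ 0
  faces_subset_verts : ∀ F ∈ faces, F ⊆ verts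
  empty_mem : ∅ ∈ faces
  indep : ∀ F ∈ faces, LinearIndependent ℝ (fun v : {x // x ∈ F} => (v : Fin n → ℝ))
  down_closed : ∀ F ∈ faces, ∀ F' ⊆ F, F' ∈ faces
  covers : (⋃ F ∈ faces, coneOf F) = {x : Fin n → ℝ | ∀ i, 0 ≤ x i}
  inter_cone : ∀ F ∈ faces, ∀ F' ∈ faces, coneOf F ∩ coneOf F' = coneOf (F ∩ F')

/-- `σ(F)`: the set of coordinates `ℓ` such that some `v ∈ F` has `v_ℓ ≠ 0`. -/
def suppSet {n : ℕ} (F : Finset (Fin n → ℝ)) : Finset (Fin n) :=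
  Finset.univ.filter fun ℓ => ∃ v ∈ F, v ℓ ≠ 0

/-- A face is interior if its support is all of `{1,…,n}`. -/
def IsInteriorFace {n : ℕ} (F : Finset (Fin n → ℝ)) : Prop :=
  suppSet F = Finset.univ

/-- The excess `e(F) = |σ(F)| − |F|`. -/
def excess {n : ℕ} (F : Finset (Fin n → ℝ)) : ℕ :=
  (suppSet F).card - F.card

/-- The link of a face `E`: faces `F` with `F ∩ E = ∅` and `F ∪ E ∈ 𝒮`. -/
def link {n : ℕ} (S : SimplicialFan n) (E : Finset (Fin n → ℝ)) :
    Finset (Finset (Fin n → ℝ)) :=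
  S.faces.filter fun F => F ∩ E = ∅ ∧ F ∪ E ∈ S.faces

/-- `F ∈ lk(E)` is a pyramid with apex `A ∈ F` if `F ∪ E` is interior but
`(F ∪ E) ∖ {A}` is not. -/
def IsPyramidApex {n : ℕ} (E F : Finset (Fin n → ℝ)) (A : Fin n → ℝ) : Prop :=
  A ∈ F ∧ IsInteriorFace (F ∪ E) ∧ ¬ IsInteriorFace ((F ∪ E).erase A)

/-- `𝒜_F`: the set of apices of `F` (relative to `E`). -/
def apices {n : ℕ} (E F : Finset (Fin n → ℝ)) : Finset (Fin n → ℝ) :=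
  F.filter fun A => IsPyramidApex E F A

/-- `V_A = {1,…,n} ∖ σ((F ∪ E) ∖ {A})`. -/
def baseDirs {n : ℕ} (E F : Finset (Fin n → ℝ)) (A : Fin n → ℝ) : Finset (Fin n) :=
  Finset.univ \ suppSet ((F ∪ E).erase A)

/-- `F` is a U-pyramid if `|V_A| = 1` for some apex `A` of `F`. -/
def IsUPyramid {n : ℕ} (E F : Finset (Fin n → ℝ)) : Prop :=
  ∃ A ∈ apices E F, (baseDirs E F A).card = 1

/-- A full partition of `F ∈ lk(E)`: a decomposition `F = F₁ ⊔ F₂ ⊔ 𝒜_F` with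
`F₁ ∪ 𝒜_F ∪ E` interior and `σ(F₂ ∪ E) = {1,…,n} ∖ ⋃_{A ∈ 𝒜_F} V_A`. -/
def IsFullPartition {n : ℕ} (E F F₁ F₂ : Finset (Fin n → ℝ)) : Prop :=
  F = F₁ ∪ F₂ ∪ apices E F ∧
  Disjoint F₁ F₂ ∧ Disjoint F₁ (apices E F) ∧ Disjoint F₂ (apices E F) ∧
  IsInteriorFace (F₁ ∪ apices E F ∪ E) ∧
  suppSet (F₂ ∪ E) = Finset.univ \ (apices E F).biUnion (baseDirs E F)

/-- The local `h`-polynomial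
`ℓ(𝒮, E; t) = Σ_{F ∈ 𝒮, E ⊆ F} (−1)^{n−|F|} t^{(n−|E|)−e(F)} (t−1)^{e(F)}`. -/
def localH {n : ℕ} (S : SimplicialFan n) (E : Finset (Fin n → ℝ)) : Polynomial ℤ :=
  ∑ F ∈ S.faces.filter (fun F => E ⊆ F),
    Polynomial.C ((-1 : ℤ) ^ (n - F.card)) *
      Polynomial.X ^ ((n - E.card) - excess F) * (Polynomial.X - 1) ^ (excess F)

/-- A finite simplicial complex on the vertex set `X` all of whose faces have at most `N`
elements. -/
structure BoundedComplex (V : Type*) where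
  X : Finset V
  N : ℕ
  faces : Set (Finset V)
  down : ∀ F ∈ faces, ∀ G ⊆ F, G ∈ faces
  sub : ∀ F ∈ faces, F ⊆ X
  card_le : ∀ F ∈ faces, F.card ≤ N

namespace BoundedComplex

variable {V : Type*} (K : BoundedComplex V) {k : Type*} [Field k]

/-- The indicator function of the faces of maximal possible cardinality. -/
def top (k : Type*) [Field k] (F : Finset V) : k := if F ∈ K.faces ∧ F.card = K.N then 1 else 0

/-- A chain is a function vanishing off the faces. -/
def IsChain (z : Finset V → k) : Prop := ∀ F, F ∉ K.faces → z F = 0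

variable {K}

theorem isChain_top : K.IsChain (K.top k) := fun F hF => by simp [top, hF]

theorem IsChain.add {y z : Finset V → k} (hy : K.IsChain y) (hz : K.IsChain z) :
    K.IsChain (fun F => y F + z F) := fun F hF => by simp [hy F hF, hz F hF]

theorem IsChain.sub {y z : Finset V → k} (hy : K.IsChain y) (hz : K.IsChain z) :
    K.IsChain (fun F => y F - z F) := fun F hF => by simp [hy F hF, hz F hF]

theorem IsChain.mul (c : k) {z : Finset V → k} (hz : K.IsChain z) :
    K.IsChain (fun F => c * z F) := fun F hF => by simp [hz F hF]

theorem IsChain.ite (p : Finset V → Prop) [DecidablePred p] {y z : Finset V → k} (hy : K.IsChain y)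
    (hz : K.IsChain z) : K.IsChain (fun F => if p F then y F else z F) := fun F hF => by
  simp [hy F hF, hz F hF]

variable [DecidableEq V] (K)

/-- The (augmented, cochain-indexed) boundary of a chain with coefficients of characteristic two. -/
def bdry (z : Finset V → k) (F : Finset V) : k := ∑ v ∈ K.X \ F, z (insert v F)

/-- An up-closed set of faces. -/
def UpClosed (W : Set (Finset V)) : Prop :=
  W ⊆ K.faces ∧ ∀ F ∈ W, ∀ G ∈ K.faces, F ⊆ G → G ∈ W

/-- The relative homology on `W` is concentrated in top degree and generated there by the
fundamental cycle. -/
def Acyc (k : Type*) [Field k] (W : Set (Finset V)) : Prop :=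
  (∃ G ∈ W, G.card = K.N) ∧ (∀ F ∈ W, K.bdry (K.top k) F = 0) ∧
    ∀ z : Finset V → k, K.IsChain z → (∀ F ∈ W, K.bdry z F = 0) →
      ∃ (y : Finset V → k) (c : k), K.IsChain y ∧ ∀ F ∈ W, z F = K.bdry y F + c * K.top k F

/-- Any two cycles on `W` are linearly dependent modulo boundaries and the fundamental cycle. -/
def DepCycles (k : Type*) [Field k] (W : Set (Finset V)) : Prop :=
  ∀ z₁ z₂ : Finset V → k, K.IsChain z₁ → K.IsChain z₂ → (∀ F ∈ W, K.bdry z₁ F = 0) →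
    (∀ F ∈ W, K.bdry z₂ F = 0) → ∃ (a b : k) (y : Finset V → k) (c : k), (a ≠ 0 ∨ b ≠ 0) ∧
      K.IsChain y ∧ ∀ F ∈ W, a * z₁ F + b * z₂ F = K.bdry y F + c * K.top k F

variable {K}

theorem bdry_add (y z : Finset V → k) (F : Finset V) :
    K.bdry (fun G => y G + z G) F = K.bdry y F + K.bdry z F := Finset.sum_add_distrib

theorem bdry_sub (y z : Finset V → k) (F : Finset V) :
    K.bdry (fun G => y G - z G) F = K.bdry y F - K.bdry z F := Finset.sum_sub_distrib _ _

theorem bdry_mul (c : k) (z : Finset V → k) (F : Finset V) :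
    K.bdry (fun G => c * z G) F = c * K.bdry z F := (Finset.mul_sum _ _ _).symm

theorem bdry_bdry [CharP k 2] (z : Finset V → k) (F : Finset V) :
    K.bdry (K.bdry z) F = 0 := by
  unfold bdry
  rw [Finset.sum_sigma']
  refine Finset.sum_involution (fun p _ => ⟨p.2, p.1⟩) ?_ ?_ ?_ ?_
  · rintro ⟨u, v⟩ _
    rw [Finset.insert_comm]
    exact CharTwo.add_self_eq_zero _
  · rintro ⟨u, v⟩ h _ h2
    simp only [Finset.mem_sigma, Finset.mem_sdiff, Finset.mem_insert, not_or, Sigma.mk.injEq] at h h2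
    exact h.2.2.1 h2.1
  · rintro ⟨u, v⟩ h
    simp only [Finset.mem_sigma, Finset.mem_sdiff, Finset.mem_insert, not_or] at h ⊢
    refine ⟨⟨h.2.1, h.2.2.2⟩, h.1.1, fun e => h.2.2.1 e.symm, h.1.2⟩
  · rintro ⟨u, v⟩ _
    rfl

theorem IsChain.bdry {z : Finset V → k} (hz : K.IsChain z) : K.IsChain (K.bdry z) := fun _ hF =>
  Finset.sum_eq_zero fun _ _ => hz _ fun h => hF (K.down _ h _ (Finset.subset_insert _ _))

theorem bdry_eq_zero_of_card {z : Finset V → k} (hz : K.IsChain z) {G : Finset V}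
    (hG : G.card = K.N) : K.bdry z G = 0 := by
  refine Finset.sum_eq_zero fun v hv => hz _ fun h => ?_
  have := K.card_le _ h
  rw [Finset.card_insert_of_notMem (Finset.mem_sdiff.1 hv).2] at this
  omega

/-- The boundary at a face of an up-closed set only depends on values on the set. -/
theorem bdry_congr {W : Set (Finset V)} (hW : K.UpClosed W) {y z : Finset V → k}
    (hy : K.IsChain y) (hz : K.IsChain z) (h : ∀ F ∈ W, y F = z F) {F : Finset V} (hF : F ∈ W) :
    K.bdry y F = K.bdry z F := by
  refine Finset.sum_congr rfl fun v _ => ?_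
  by_cases hv : insert v F ∈ K.faces
  · exact h _ (hW.2 _ hF _ hv (Finset.subset_insert _ _))
  · rw [hy _ hv, hz _ hv]

/-- Mayer–Vietoris gluing. -/
theorem glue [CharP k 2] {W₁ W₂ : Set (Finset V)} (h₁ : K.UpClosed W₁) (h₂ : K.UpClosed W₂)
    {y₁ y₂ w : Finset V → k} {c : k} (hy₁ : K.IsChain y₁) (hy₂ : K.IsChain y₂) (hw : K.IsChain w)
    (htop : ∀ F ∈ W₂, K.bdry (K.top k) F = 0)
    (h : ∀ F ∈ W₁ ∩ W₂, y₁ F - y₂ F = K.bdry w F + c * K.top k F) :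
    ∃ y, K.IsChain y ∧ (∀ F ∈ W₁, K.bdry y F = K.bdry y₁ F) ∧
      ∀ F ∈ W₂, K.bdry y F = K.bdry y₂ F := by
  have hy₂' : K.IsChain (fun F => y₂ F + (K.bdry w F + c * K.top k F)) :=
    hy₂.add (hw.bdry.add (isChain_top.mul c))
  have hy := IsChain.ite (· ∈ W₁) hy₁ hy₂'
  refine ⟨_, hy, fun F hF => bdry_congr h₁ hy hy₁ (fun G hG => by simp [hG]) hF, fun F hF => ?_⟩
  rw [bdry_congr h₂ hy hy₂' (fun G hG => ?_) hF, bdry_add, bdry_add, bdry_mul, bdry_bdry,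
    htop F hF]
  · simp
  · by_cases hG1 : G ∈ W₁
    · simp [hG1, ← h G ⟨hG1, hG⟩]
    · simp [hG1]

theorem Acyc.union [CharP k 2] {W₁ W₂ : Set (Finset V)} (h₁ : K.UpClosed W₁) (h₂ : K.UpClosed W₂)
    (a₁ : K.Acyc k W₁) (a₂ : K.Acyc k W₂) (a₀ : K.Acyc k (W₁ ∩ W₂)) : K.Acyc k (W₁ ∪ W₂) := by
  obtain ⟨⟨G₀, hG₀, hcard⟩, -, ex₀⟩ := a₀
  obtain ⟨-, t₁, ex₁⟩ := a₁
  obtain ⟨-, t₂, ex₂⟩ := a₂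
  refine ⟨⟨G₀, Or.inl hG₀.1, hcard⟩, fun F hF => hF.elim (t₁ F) (t₂ F), fun z hz hcyc => ?_⟩
  obtain ⟨y₁, c₁, hy₁, e₁⟩ := ex₁ z hz fun F hF => hcyc F (Or.inl hF)
  obtain ⟨y₂, c₂, hy₂, e₂⟩ := ex₂ z hz fun F hF => hcyc F (Or.inr hF)
  have htop : K.top k G₀ = 1 := by simp [top, hcard, h₁.1 hG₀.1]
  have hc : c₁ = c₂ := by
    have e1 := e₁ G₀ hG₀.1
    have e2 := e₂ G₀ hG₀.2
    rw [bdry_eq_zero_of_card hy₁ hcard, htop] at e1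
    rw [bdry_eq_zero_of_card hy₂ hcard, htop] at e2
    linear_combination e2 - e1
  subst hc
  obtain ⟨w, c, hw, e⟩ := ex₀ (fun F => y₁ F - y₂ F) (hy₁.sub hy₂) fun F hF => by
    rw [bdry_sub]
    linear_combination e₂ F hF.2 - e₁ F hF.1
  obtain ⟨y, hy, b₁, b₂⟩ := glue h₁ h₂ hy₁ hy₂ hw t₂ e
  refine ⟨y, c₁, hy, fun F hF => ?_⟩
  rcases hF with hF | hF
  · rw [b₁ F hF, e₁ F hF]
  · rw [b₂ F hF, e₂ F hF]

theorem DepCycles.union [CharP k 2] {W₁ W₂ : Set (Finset V)} (h₁ : K.UpClosed W₁)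
    (h₂ : K.UpClosed W₂) (a₁ : K.Acyc k W₁) (a₂ : K.Acyc k W₂)
    (a₀ : W₁ ∩ W₂ = ∅ ∨ (∃ G ∈ W₁ ∩ W₂, G.card = K.N) ∧ K.DepCycles k (W₁ ∩ W₂)) :
    K.DepCycles k (W₁ ∪ W₂) := by
  obtain ⟨-, t₁, ex₁⟩ := a₁
  obtain ⟨-, t₂, ex₂⟩ := a₂
  intro z z' hz hz' hcyc hcyc'
  obtain ⟨y₁, c₁, hy₁, e₁⟩ := ex₁ z hz fun F hF => hcyc F (Or.inl hF)
  obtain ⟨y₂, c₂, hy₂, e₂⟩ := ex₂ z hz fun F hF => hcyc F (Or.inr hF)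
  obtain ⟨y₁', c₁', hy₁', e₁'⟩ := ex₁ z' hz' fun F hF => hcyc' F (Or.inl hF)
  obtain ⟨y₂', c₂', hy₂', e₂'⟩ := ex₂ z' hz' fun F hF => hcyc' F (Or.inr hF)
  rcases a₀ with a₀ | ⟨⟨G₀, hG₀, hcard⟩, ex₀⟩
  · obtain ⟨a, b, hab, hc⟩ : ∃ a b : k, (a ≠ 0 ∨ b ≠ 0) ∧
        a * c₁ + b * c₁' = a * c₂ + b * c₂' := by
      by_cases h : c₁ - c₂ = 0
      · exact ⟨1, 0, Or.inl one_ne_zero, by linear_combination h⟩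
      · exact ⟨c₁' - c₂', -(c₁ - c₂), Or.inr (neg_ne_zero.2 h), by ring⟩
    obtain ⟨y, hy, b₁, b₂⟩ := glue (c := 0) (w := fun _ => 0) h₁ h₂ ((hy₁.mul a).add (hy₁'.mul b))
      ((hy₂.mul a).add (hy₂'.mul b)) (fun _ _ => rfl) t₂ fun F hF => by simp [a₀] at hF
    refine ⟨a, b, y, a * c₁ + b * c₁', hab, hy, fun F hF => ?_⟩
    rcases hF with hF | hF
    · rw [b₁ F hF, bdry_add, bdry_mul, bdry_mul, e₁ F hF, e₁' F hF]; ring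
    · rw [hc, b₂ F hF, bdry_add, bdry_mul, bdry_mul, e₂ F hF, e₂' F hF]; ring
  · have htop : K.top k G₀ = 1 := by simp [top, hcard, h₁.1 hG₀.1]
    have hc : c₁ = c₂ := by
      have e1 := e₁ G₀ hG₀.1
      have e2 := e₂ G₀ hG₀.2
      rw [bdry_eq_zero_of_card hy₁ hcard, htop] at e1
      rw [bdry_eq_zero_of_card hy₂ hcard, htop] at e2
      linear_combination e2 - e1
    have hc' : c₁' = c₂' := by
      have e1 := e₁' G₀ hG₀.1
      have e2 := e₂' G₀ hG₀.2
      rw [bdry_eq_zero_of_card hy₁' hcard, htop] at e1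
      rw [bdry_eq_zero_of_card hy₂' hcard, htop] at e2
      linear_combination e2 - e1
    subst hc hc'
    obtain ⟨a, b, w, c, hab, hw, e⟩ := ex₀ (fun F => y₁ F - y₂ F) (fun F => y₁' F - y₂' F)
      (hy₁.sub hy₂) (hy₁'.sub hy₂') (fun F hF => by
        rw [bdry_sub]; linear_combination e₂ F hF.2 - e₁ F hF.1) (fun F hF => by
        rw [bdry_sub]; linear_combination e₂' F hF.2 - e₁' F hF.1)
    obtain ⟨y, hy, b₁, b₂⟩ := glue (c := c) h₁ h₂ ((hy₁.mul a).add (hy₁'.mul b))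
      ((hy₂.mul a).add (hy₂'.mul b)) hw t₂ fun F hF => by
        linear_combination e F hF
    refine ⟨a, b, y, a * c₁ + b * c₁', hab, hy, fun F hF => ?_⟩
    rcases hF with hF | hF
    · rw [b₁ F hF, bdry_add, bdry_mul, bdry_mul, e₁ F hF, e₁' F hF]; ring
    · rw [b₂ F hF, bdry_add, bdry_mul, bdry_mul, e₂ F hF, e₂' F hF]; ring

/-- The set of faces containing `F₀`. -/
def star (K : BoundedComplex V) (F₀ : Finset V) : Set (Finset V) := {F | F ∈ K.faces ∧ F₀ ⊆ F}

theorem acyc_star_of_depCycles [CharP k 2] {F₀ : Finset V}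
    (hdep : K.DepCycles k (K.star F₀ \ {F₀})) {v₀ : V} (hv₀ : v₀ ∉ F₀)
    (hins : insert v₀ F₀ ∈ K.faces) (hex : ∃ G ∈ K.star F₀, G.card = K.N)
    (htop : ∀ F ∈ K.star F₀, K.bdry (K.top k) F = 0) : K.Acyc k (K.star F₀) := by
  refine ⟨hex, htop, fun z hz hcyc => ?_⟩
  have hF₀ : F₀ ∈ K.faces := K.down _ hins _ (Finset.subset_insert _ _)
  set ζ : Finset V → k := fun F => if F = insert v₀ F₀ then 1 else 0 with hζdef
  have hζ : K.IsChain ζ := fun F hF => by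
    simp only [hζdef]
    rw [if_neg]
    rintro rfl
    exact hF hins
  have hζ0 : K.bdry ζ F₀ = 1 := by
    unfold bdry
    rw [Finset.sum_eq_single v₀]
    · simp [hζdef]
    · intro v hv hne
      simp only [hζdef]
      rw [if_neg]
      intro h
      have : v ∈ insert v₀ F₀ := h ▸ Finset.mem_insert_self _ _
      rcases Finset.mem_insert.1 this with h' | h'
      · exact hne h'
      · exact (Finset.mem_sdiff.1 hv).2 h'
    · intro h
      exact absurd (Finset.mem_sdiff.2 ⟨K.sub _ hins (Finset.mem_insert_self _ _), hv₀⟩) h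
  have hζF : ∀ F ∈ K.star F₀ \ {F₀}, K.bdry ζ F = 0 := by
    intro F hF
    refine Finset.sum_eq_zero fun v hv => ?_
    simp only [hζdef]
    rw [if_neg]
    intro h
    have hlt : F₀ ⊂ F := lt_of_le_of_ne hF.1.2 (fun e => hF.2 e.symm)
    have h1 := Finset.card_lt_card hlt
    have h2 := congrArg Finset.card h
    rw [Finset.card_insert_of_notMem (Finset.mem_sdiff.1 hv).2,
      Finset.card_insert_of_notMem hv₀] at h2
    omega
  obtain ⟨a, b, y, c, hab, hy, e⟩ := hdep z ζ hz hζ (fun F hF => hcyc F hF.1) hζF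
  -- the identity away from `F₀`, seen at `F₀` after taking boundaries
  have hins' : ∀ v ∈ K.X \ F₀, insert v F₀ ∈ K.faces → insert v F₀ ∈ K.star F₀ \ {F₀} :=
    fun v hv h => ⟨⟨h, Finset.subset_insert _ _⟩, fun h' => (Finset.mem_sdiff.1 hv).2
      (Finset.insert_eq_self.1 h')⟩
  have key : K.bdry (fun F => a * z F + b * ζ F) F₀ =
      K.bdry (fun F => K.bdry y F + c * K.top k F) F₀ := by
    refine Finset.sum_congr rfl fun v hv => ?_
    by_cases h : insert v F₀ ∈ K.faces
    · exact e _ (hins' v hv h)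
    · rw [((hz.mul a).add (hζ.mul b)) _ h, (hy.bdry.add (isChain_top.mul c)) _ h]
  have hself : F₀ ∈ K.star F₀ := ⟨hF₀, subset_rfl⟩
  rw [bdry_add, bdry_add, bdry_mul, bdry_mul, bdry_mul, bdry_bdry, htop F₀ hself, hcyc F₀ hself,
    hζ0] at key
  have hb : b = 0 := by linear_combination key
  subst hb
  have ha : a ≠ 0 := by simpa using hab
  have hN : F₀.card ≠ K.N := fun h => by
    have := K.card_le _ hins
    rw [Finset.card_insert_of_notMem hv₀] at this
    omega
  set d := z F₀ - a⁻¹ * K.bdry y F₀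
  refine ⟨fun F => a⁻¹ * y F + d * ζ F, a⁻¹ * c, (hy.mul _).add (hζ.mul _), fun F hF => ?_⟩
  rw [bdry_add, bdry_mul, bdry_mul]
  by_cases h : F = F₀
  · subst h
    rw [hζ0]
    simp [top, hN, d]
  · have := e F ⟨hF, h⟩
    rw [hζF F ⟨hF, h⟩]
    field_simp
    linear_combination this

/-- Removing the faces joinable with `v` from an acyclic set keeps it acyclic. -/
theorem Acyc.deletion [CharP k 2] {W : Set (Finset V)} (hW : K.UpClosed W) (hacyc : K.Acyc k W)
    {v : V} (herase : ∀ H ∈ W, H.erase v ∈ W) (hv : ∃ G ∈ W, v ∈ G ∧ G.card = K.N) :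
    K.Acyc k {H | H ∈ W ∧ insert v H ∉ K.faces} := by
  set W' : Set (Finset V) := {H | H ∈ W ∧ insert v H ∉ K.faces} with hW'def
  have hW' : K.UpClosed W' := ⟨fun F hF => hW.1 hF.1, fun F hF G hG hFG =>
    ⟨hW.2 F hF.1 G hG hFG, fun h => hF.2 (K.down _ h _ (Finset.insert_subset_insert _ hFG))⟩⟩
  obtain ⟨-, htop, hex⟩ := hacyc
  refine ⟨?_, fun F hF => htop F hF.1, fun z hz hcyc => ?_⟩
  · obtain ⟨G, hG, hvG, hcard⟩ := hv
    have h0 := htop _ (herase G hG)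
    by_contra hcon
    push Not at hcon
    have : K.bdry (K.top k) (G.erase v) = 1 := by
      unfold bdry
      rw [Finset.sum_eq_single v]
      · rw [Finset.insert_erase hvG]
        simp [top, hcard, hW.1 hG]
      · intro u hu huv
        rw [Finset.mem_sdiff] at hu
        unfold top
        rw [if_neg]
        rintro ⟨hf, hc⟩
        refine hcon _ ⟨hW.2 _ (herase G hG) _ hf (Finset.subset_insert _ _), fun hf' => ?_⟩ hc
        have := K.card_le _ hf'
        rw [Finset.card_insert_of_notMem (by simp [Ne.symm huv])] at this
        omega
      · intro h
        exact absurd (Finset.mem_sdiff.2 ⟨K.sub _ (hW.1 hG) hvG, Finset.notMem_erase _ _⟩) h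
    exact one_ne_zero (this.symm.trans h0)
  · set z₀ : Finset V → k := fun F => if F ∈ W' then z F else 0 with hz₀def
    have hz₀ : K.IsChain z₀ := IsChain.ite (· ∈ W') hz fun _ _ => rfl
    have hz₀W' : ∀ F ∈ W', K.bdry z₀ F = 0 := fun F hF => by
      rw [bdry_congr hW' hz₀ hz (fun G hG => by simp [hz₀def, hG]) hF, hcyc F hF]
    set w : Finset V → k := fun F => if F ∈ W ∧ insert v F ∈ K.faces then K.bdry z₀ F else 0
      with hwdef
    have hw : K.IsChain w := IsChain.ite _ hz₀.bdry fun _ _ => rfl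
    have hbw : ∀ F ∈ W, K.bdry w F = 0 := fun F hF => by
      rw [bdry_congr hW hw hz₀.bdry (fun G hG => ?_) hF, bdry_bdry]
      by_cases h : insert v G ∈ K.faces
      · simp [hwdef, hG, h]
      · simp [hwdef, h, hz₀W' G ⟨hG, h⟩]
    set u : Finset V → k := fun F => if v ∈ F then w (F.erase v) else 0 with hudef
    have hu : K.IsChain u := fun F hF => by
      simp only [hudef, hwdef]
      split_ifs with h1 h2
      · rw [Finset.insert_erase h1] at h2
        exact absurd h2.2 hF
      all_goals rfl
    have huW' : ∀ F ∈ W', u F = 0 := fun F hF => by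
      simp only [hudef]
      rw [if_neg]
      intro h
      exact hF.2 (by rw [Finset.insert_eq_self.2 h]; exact hW.1 hF.1)
    have hbu : ∀ F ∈ W, insert v F ∈ K.faces → K.bdry u F = w F := by
      intro F hF hvF
      by_cases h : v ∈ F
      · have e : K.bdry w (F.erase v) = w F + K.bdry u F := by
          unfold bdry
          have : K.X \ F.erase v = insert v (K.X \ F) := by
            ext x
            have := K.sub _ (hW.1 hF)
            by_cases hx : x = v
            · subst hx; simp [this h]
            · simp [hx]
          rw [this, Finset.sum_insert (by simp [h]), Finset.insert_erase h]
          congr 1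
          refine Finset.sum_congr rfl fun x hx => ?_
          have hxv : x ≠ v := fun e => (Finset.mem_sdiff.1 hx).2 (e ▸ h)
          simp only [hudef]
          rw [if_pos (Finset.mem_insert_of_mem h), Finset.erase_insert_of_ne hxv]
        rw [hbw _ (herase F hF)] at e
        exact (CharTwo.add_eq_zero.1 e.symm).symm
      · unfold bdry
        rw [Finset.sum_eq_single v]
        · simp [hudef, Finset.erase_insert h]
        · intro x _ hxv
          simp [hudef, h, Ne.symm hxv]
        · intro h'
          exact absurd (Finset.mem_sdiff.2 ⟨K.sub _ hvF (Finset.mem_insert_self _ _), h⟩) h'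
    obtain ⟨y, c, hy, e⟩ := hex (fun F => z₀ F + u F) (hz₀.add hu) fun F hF => by
      rw [bdry_add]
      by_cases h : insert v F ∈ K.faces
      · rw [hbu F hF h]
        simp only [hwdef]
        rw [if_pos ⟨hF, h⟩]
        exact CharTwo.add_self_eq_zero _
      · rw [hz₀W' F ⟨hF, h⟩, bdry_congr hW' hu (z := fun _ => 0) (fun _ _ => rfl)
          (fun G hG => huW' G hG) ⟨hF, h⟩]
        simp [bdry]
    refine ⟨y, c, hy, fun F hF => ?_⟩
    rw [← e F hF.1, huW' F hF]
    simp [hz₀def, hF]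

end BoundedComplex

theorem linearIndepOn_Iio {K M : Type*} [Field K] [AddCommGroup M] [Module K M] (f : ℕ → M)
    (d : ℕ) (h : ∀ j < d, f j ∉ Submodule.span K (f '' Set.Iio j)) :
    LinearIndepOn K f (Set.Iio d) := by
  induction d with
  | zero => simp
  | succ d ih =>
    have : Set.Iio (d + 1) = insert d (Set.Iio d) := by
      ext x; simp
    rw [this]
    exact (ih fun j hj => h j (by omega)).insert (h d (by omega))

/-- Generic sequences: if evaluation of `W` on each finite set of the family is onto, then there is
a sequence in `W` whose first `|A|` terms give an invertible square matrix of values on each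
member `A` of the family. -/
theorem exists_generic_sequence {K V W : Type*} [Field K] [Infinite K] [AddCommGroup W]
    [Module K W] (r : W →ₗ[K] V → K) (T : Finset (Finset V))
    (hr : ∀ A ∈ T, ∀ b : V → K, ∃ w, ∀ v ∈ A, r w v = b v) :
    ∃ y : ℕ → W, ∀ A ∈ T,
      (∀ lam : V → K, (∀ j < A.card, ∑ v ∈ A, lam v * r (y j) v = 0) → ∀ v ∈ A, lam v = 0) ∧
      ∀ b : ℕ → K, ∃ lam : V → K, ∀ j < A.card, ∑ v ∈ A, lam v * r (y j) v = b j := by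
  let R (A : Finset V) : W →ₗ[K] (A → K) := (LinearMap.funLeft K K (Subtype.val : A → V)) ∘ₗ r
  have hR : ∀ A ∈ T, Function.Surjective (R A) := by
    intro A hA b
    obtain ⟨w, hw⟩ := hr A hA fun v => if h : v ∈ A then b ⟨v, h⟩ else 0
    refine ⟨w, funext fun v => ?_⟩
    simpa [R, LinearMap.funLeft] using hw v v.2
  have step : ∀ k : ℕ, ∃ y : ℕ → W, ∀ A ∈ T, ∀ j < k, j < A.card →
      R A (y j) ∉ Submodule.span K ((fun l => R A (y l)) '' Set.Iio j) := by
    intro k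
    induction k with
    | zero => exact ⟨fun _ => 0, fun _ _ _ h => by omega⟩
    | succ k ih =>
      obtain ⟨y, hy⟩ := ih
      let P (A : Finset V) : Submodule K W :=
        (Submodule.span K ((fun l => R A (y l)) '' Set.Iio k)).comap (R A)
      have hP : ∀ A ∈ T, k < A.card → P A ≠ ⊤ := by
        intro A hA hk htop
        replace htop : ⊤ ≤ Submodule.span K ((fun l => R A (y l)) '' Set.Iio k) := by
          rw [← LinearMap.range_eq_top.2 (hR A hA), LinearMap.range_le_iff_comap]
          exact htop
        have h1 := finrank_span_finset_le_card (R := K)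
          ((Finset.range k).image fun l => R A (y l))
        have h2 : (((Finset.range k).image fun l => R A (y l) : Finset (A → K)) : Set (A → K)) =
            (fun l => R A (y l)) '' Set.Iio k := by
          ext; simp
        rw [Set.finrank, h2, top_le_iff.1 htop, finrank_top, Module.finrank_fintype_fun_eq_card,
          Fintype.card_coe] at h1
        have h3 := Finset.card_image_le (s := Finset.range k) (f := fun l => R A (y l))
        rw [Finset.card_range] at h3
        omega
      have hcov := Subspace.biUnion_ne_univ_of_top_notMem (k := K) (E := W)
        (s := (T.filter fun A => k < A.card).image P) (by
          simp only [Finset.mem_image, Finset.mem_filter, not_exists, not_and]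
          exact fun A hA => hP A hA.1 hA.2)
      obtain ⟨w, hw⟩ := (Set.ne_univ_iff_exists_notMem _).1 hcov
      simp only [Finset.mem_image, Finset.mem_filter, Set.mem_iUnion, not_exists] at hw
      refine ⟨Function.update y k w, fun A hA j hj hjA => ?_⟩
      have himg : (fun l => R A (Function.update y k w l)) '' Set.Iio j =
          (fun l => R A (y l)) '' Set.Iio j := by
        refine Set.image_congr fun l hl => ?_
        have : l ≠ k := by simp only [Set.mem_Iio] at hl; omega
        simp [Function.update_of_ne this]
      rw [himg]
      rcases Nat.lt_succ_iff_lt_or_eq.1 hj with hj | rfl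
      · rw [Function.update_of_ne (by omega)]
        exact hy A hA j hj hjA
      · rw [Function.update_self]
        exact fun h => hw _ ⟨A, ⟨hA, hjA⟩, rfl⟩ h
  obtain ⟨y, hy⟩ := step (T.sup Finset.card)
  refine ⟨y, fun A hA => ?_⟩
  have hle : A.card ≤ T.sup Finset.card := Finset.le_sup (f := Finset.card) hA
  have hli := linearIndepOn_Iio (K := K) (fun l => R A (y l)) A.card fun j hj =>
    hy A hA j (by omega) hj
  let e : Fin A.card ≃ A := A.equivFin.symm
  let M : Matrix (Fin A.card) (Fin A.card) K := fun j v => r (y j) (e v)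
  have hM : IsUnit M := by
    rw [← Matrix.linearIndependent_rows_iff_isUnit]
    have h1 : LinearIndependent K (fun j : Fin A.card => R A (y j)) :=
      LinearIndependent.comp hli (fun j : Fin A.card => (⟨j, j.2⟩ : Set.Iio A.card))
        fun a b h => Fin.ext (congrArg Subtype.val h)
    exact h1.map' (LinearEquiv.funCongrLeft K K e).toLinearMap (LinearEquiv.ker _)
  have hsum : ∀ (lam : V → K) (j : Fin A.card),
      ∑ v ∈ A, lam v * r (y j) v = (M.mulVec fun i => lam (e i)) j := by
    intro lam j
    rw [← Finset.sum_coe_sort A]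
    simp only [Matrix.mulVec, dotProduct, M]
    rw [← e.sum_comp]
    exact Finset.sum_congr rfl fun i _ => mul_comm _ _
  refine ⟨fun lam h v hv => ?_, fun b => ?_⟩
  · have h0 : M.mulVec (fun i => lam (e i)) = 0 := funext fun j => by
      rw [← hsum]; exact h j j.2
    have := Matrix.mulVec_injective_of_isUnit hM (h0.trans (Matrix.mulVec_zero M).symm)
    have := congrFun this (e.symm ⟨v, hv⟩)
    simpa using this
  · obtain ⟨x, hx⟩ := (Matrix.mulVec_surjective_iff_isUnit.2 hM) fun j => b j
    refine ⟨fun v => if h : v ∈ A then x (e.symm ⟨v, h⟩) else 0, fun j hj => ?_⟩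
    rw [hsum _ ⟨j, hj⟩, ← congrFun hx ⟨j, hj⟩]
    congr 2
    funext i
    simp

section suppSet
variable {n : ℕ}

theorem mem_suppSet {F : Finset (Fin n → ℝ)} {i : Fin n} :
    i ∈ suppSet F ↔ ∃ v ∈ F, v i ≠ 0 := by simp [suppSet]

theorem suppSet_mono {F G : Finset (Fin n → ℝ)} (h : F ⊆ G) : suppSet F ⊆ suppSet G := fun i hi => by
  rw [mem_suppSet] at *
  obtain ⟨v, hv, h'⟩ := hi
  exact ⟨v, h hv, h'⟩

theorem suppSet_union (F G : Finset (Fin n → ℝ)) : suppSet (F ∪ G) = suppSet F ∪ suppSet G := by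
  ext i
  simp only [mem_suppSet, Finset.mem_union, or_and_right, exists_or]

theorem suppSet_insert (v : Fin n → ℝ) (F : Finset (Fin n → ℝ)) :
    suppSet (insert v F) = suppSet {v} ∪ suppSet F := by
  rw [Finset.insert_eq, suppSet_union]

end suppSet

/-- The vectors supported on `U`. -/
def suppSubmodule {n : ℕ} (K : Type*) [Field K] (U : Finset (Fin n)) : Submodule K (Fin n → K) where
  carrier := {x | ∀ i ∉ U, x i = 0}
  add_mem' {x y} hx hy := fun i hi => by simp [hx i hi, hy i hi]
  zero_mem' := fun _ _ => rfl
  smul_mem' c x hx := fun i hi => by simp [hx i hi]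

/-- Vectors supported on `U` are functions on `U`. -/
def suppSubmoduleEquiv {n : ℕ} (K : Type*) [Field K] (U : Finset (Fin n)) :
    suppSubmodule K U ≃ₗ[K] (U → K) where
  toFun x i := x.1 i
  map_add' _ _ := rfl
  map_smul' _ _ := rfl
  invFun y := ⟨fun i => if h : i ∈ U then y ⟨i, h⟩ else 0, fun i hi => by simp [hi]⟩
  left_inv x := by
    ext i
    by_cases h : i ∈ U
    · simp [h]
    · simp [h, x.2 i h]
  right_inv y := by
    ext i
    simp

theorem finrank_suppSubmodule {n : ℕ} (K : Type*) [Field K] (U : Finset (Fin n)) :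
    Module.finrank K (suppSubmodule K U) = U.card := by
  rw [(suppSubmoduleEquiv K U).finrank_eq, Module.finrank_fintype_fun_eq_card, Fintype.card_coe]

/-- Coordinate functionals on a linearly independent finite set. -/
theorem exists_dual_family {K M : Type*} [Field K] [AddCommGroup M] [Module K M] [DecidableEq M]
    {F : Finset M}
    (h : LinearIndependent K (fun v : {x // x ∈ F} => (v : M))) :
    ∃ c : M → M →ₗ[K] K, ∀ v ∈ F, ∀ w ∈ F, c v w = if w = v then 1 else 0 := by
  obtain ⟨g, hg⟩ := LinearMap.exists_extend (Module.Basis.span h).repr.toLinearMap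
  refine ⟨fun v => if hv : v ∈ F then (Finsupp.lapply ⟨v, hv⟩) ∘ₗ g else 0, fun v hv w hw => ?_⟩
  have h1 : g w = Finsupp.single ⟨w, hw⟩ 1 := by
    have h2 := LinearMap.congr_fun hg (Module.Basis.span h ⟨w, hw⟩)
    simp only [LinearMap.comp_apply, Submodule.subtype_apply, LinearEquiv.coe_coe,
      Module.Basis.repr_self] at h2
    rw [← h2, Module.Basis.span_apply]
  simp [hv, h1, Finsupp.single_apply]

namespace SimplicialFan

variable {n : ℕ} (S : SimplicialFan n)

theorem card_le_of_suppSet_subset {F : Finset (Fin n → ℝ)} (hF : F ∈ S.faces) {U : Finset (Fin n)}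
    (hU : suppSet F ⊆ U) : F.card ≤ U.card := by
  have hmem : ∀ v ∈ F, v ∈ suppSubmodule ℝ U := fun v hv i hi => by
    by_contra h
    exact hi (hU (mem_suppSet.2 ⟨v, hv, h⟩))
  have : LinearIndependent ℝ (fun v : {x // x ∈ F} => (⟨v, hmem v v.2⟩ : suppSubmodule ℝ U)) :=
    LinearIndependent.of_comp (suppSubmodule ℝ U).subtype (S.indep F hF)
  have h := this.fintype_card_le_finrank
  rwa [finrank_suppSubmodule, Fintype.card_coe] at h

/-- The subcomplex of faces supported on `U`. -/
def restrict (U : Finset (Fin n)) : BoundedComplex (Fin n → ℝ) where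
  X := S.verts
  N := U.card
  faces := {F | F ∈ S.faces ∧ suppSet F ⊆ U}
  down _ hF _ hG := ⟨S.down_closed _ hF.1 _ hG, (suppSet_mono hG).trans hF.2⟩
  sub F hF := S.faces_subset_verts F hF.1
  card_le _ hF := S.card_le_of_suppSet_subset hF.1 hF.2

/-- Coordinate functionals of a face. -/
def coord (F : Finset (Fin n → ℝ)) : (Fin n → ℝ) → (Fin n → ℝ) →ₗ[ℝ] ℝ :=
  if h : F ∈ S.faces then (exists_dual_family (S.indep F h)).choose else 0

variable {S}

theorem coord_apply {F : Finset (Fin n → ℝ)} (hF : F ∈ S.faces) {v w : Fin n → ℝ} (hv : v ∈ F)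
    (hw : w ∈ F) : S.coord F v w = if w = v then 1 else 0 := by
  unfold coord
  rw [dif_pos hF]
  exact (exists_dual_family (S.indep F hF)).choose_spec v hv w hw

theorem coord_sum {F G : Finset (Fin n → ℝ)} (hF : F ∈ S.faces) (hG : G ⊆ F)
    (lam : (Fin n → ℝ) → ℝ) {v : Fin n → ℝ} (hv : v ∈ F) :
    S.coord F v (∑ w ∈ G, lam w • w) = if v ∈ G then lam v else 0 := by
  rw [map_sum, ← Finset.sum_ite_eq' G v lam]
  refine Finset.sum_congr rfl fun w hw => ?_
  rw [map_smul, coord_apply hF hv (hG hw)]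
  split_ifs <;> simp

variable (S) in
/-- The cone of `F` with the directions of `F₀` made invertible. -/
def relCone (F₀ F : Finset (Fin n → ℝ)) : Set (Fin n → ℝ) :=
  {x | (∀ v ∈ F \ F₀, 0 ≤ S.coord F v x) ∧ ∑ v ∈ F, S.coord F v x • v = x}

variable (S) in
/-- The minimal subface of `F` containing `F₀` whose relative cone contains `x`. -/
def carrier (F₀ F : Finset (Fin n → ℝ)) (x : Fin n → ℝ) : Finset (Fin n → ℝ) :=
  F₀ ∪ F.filter fun v => 0 < S.coord F v x ∧ v ∉ F₀

theorem mem_relCone_sum {F₀ F G : Finset (Fin n → ℝ)} (hF : F ∈ S.faces) (hG : G ⊆ F)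
    {lam : (Fin n → ℝ) → ℝ} (h : ∀ v ∈ G \ F₀, 0 ≤ lam v) :
    ∑ v ∈ G, lam v • v ∈ S.relCone F₀ F := by
  constructor
  · intro v hv
    rw [Finset.mem_sdiff] at hv
    rw [coord_sum hF hG _ hv.1]
    split_ifs with h'
    · exact h v (Finset.mem_sdiff.2 ⟨h', hv.2⟩)
    · exact le_rfl
  · rw [← Finset.sum_subset hG]
    · exact Finset.sum_congr rfl fun v hv => by rw [coord_sum hF hG _ (hG hv), if_pos hv]
    · intro v hv hv'
      rw [coord_sum hF hG _ hv, if_neg hv', zero_smul]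

theorem carrier_subset {F₀ F : Finset (Fin n → ℝ)} (h : F₀ ⊆ F) (x : Fin n → ℝ) :
    S.carrier F₀ F x ⊆ F := Finset.union_subset h (Finset.filter_subset _ _)

theorem subset_carrier (F₀ F : Finset (Fin n → ℝ)) (x : Fin n → ℝ) : F₀ ⊆ S.carrier F₀ F x :=
  Finset.subset_union_left

theorem mem_carrier_iff {F₀ F : Finset (Fin n → ℝ)} {x v : Fin n → ℝ} (hv : v ∉ F₀) :
    v ∈ S.carrier F₀ F x ↔ v ∈ F ∧ 0 < S.coord F v x := by
  simp [carrier, hv]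

theorem eq_sum_carrier {F₀ F : Finset (Fin n → ℝ)} (h : F₀ ⊆ F) {x : Fin n → ℝ}
    (hx : x ∈ S.relCone F₀ F) : x = ∑ v ∈ S.carrier F₀ F x, S.coord F v x • v := by
  conv_lhs => rw [← hx.2]
  symm
  refine Finset.sum_subset (carrier_subset h x) fun v hv hv' => ?_
  have hv0 : v ∉ F₀ := fun h => hv' (subset_carrier _ _ _ h)
  rw [mem_carrier_iff hv0] at hv'
  have := hx.1 v (Finset.mem_sdiff.2 ⟨hv, hv0⟩)
  have : S.coord F v x = 0 := le_antisymm (not_lt.1 fun h => hv' ⟨hv, h⟩) this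
  rw [this, zero_smul]

/-- Relative cones containing a point are exactly those of faces containing its carrier. -/
theorem mem_relCone_of_carrier_subset {F₀ F G : Finset (Fin n → ℝ)} (h : F₀ ⊆ F) (hG : G ∈ S.faces)
    {x : Fin n → ℝ} (hx : x ∈ S.relCone F₀ F) (hFG : S.carrier F₀ F x ⊆ G) :
    x ∈ S.relCone F₀ G := by
  rw [eq_sum_carrier h hx]
  refine mem_relCone_sum hG hFG fun v hv => ?_
  rw [Finset.mem_sdiff] at hv
  exact hx.1 v (Finset.mem_sdiff.2 ⟨carrier_subset h x hv.1, hv.2⟩)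

theorem relCone_mono {F₀ F G : Finset (Fin n → ℝ)} (h : F₀ ⊆ F) (hG : G ∈ S.faces) (hFG : F ⊆ G) :
    S.relCone F₀ F ⊆ S.relCone F₀ G := fun _ hx =>
  mem_relCone_of_carrier_subset h hG hx ((carrier_subset h _).trans hFG)

theorem carrier_subset_of_mem_relCone {F₀ F G : Finset (Fin n → ℝ)} (hF : F ∈ S.faces)
    (hG : G ∈ S.faces) (hF₀ : F₀ ⊆ F) (hG₀ : F₀ ⊆ G) {x : Fin n → ℝ} (hx : x ∈ S.relCone F₀ F)
    (hx' : x ∈ S.relCone F₀ G) : S.carrier F₀ F x ⊆ G := by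
  obtain ⟨M, hM⟩ : ∃ M : ℝ, ∀ v ∈ F ∪ G, -S.coord F v x ≤ M ∧ -S.coord G v x ≤ M := by
    refine ⟨∑ v ∈ F ∪ G, (|S.coord F v x| + |S.coord G v x|), fun v hv => ?_⟩
    have := Finset.single_le_sum (f := fun v => |S.coord F v x| + |S.coord G v x|)
      (fun w _ => add_nonneg (abs_nonneg _) (abs_nonneg _)) hv
    have h1 := neg_le_abs (S.coord F v x)
    have h2 := neg_le_abs (S.coord G v x)
    have h3 := abs_nonneg (S.coord F v x)
    have h4 := abs_nonneg (S.coord G v x)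
    constructor <;> linarith
  have key : ∀ H : Finset (Fin n → ℝ), F₀ ⊆ H → x ∈ S.relCone F₀ H →
      (∀ v ∈ H, -S.coord H v x ≤ M) → x + ∑ v ∈ F₀, M • v ∈ coneOf H := by
    intro H h0 hxH hMH
    refine ⟨fun v => S.coord H v x + if v ∈ F₀ then M else 0, fun v hv => ?_, ?_⟩
    · dsimp only
      split_ifs with h
      · linarith [hMH v hv]
      · simpa using hxH.1 v (Finset.mem_sdiff.2 ⟨hv, h⟩)
    · conv_lhs => rw [← hxH.2]
      simp only [add_smul, Finset.sum_add_distrib, ite_smul, zero_smul]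
      congr 1
      rw [← Finset.sum_filter]
      congr 1
      ext v
      simpa using fun h => h0 h
  have hmem : x + ∑ v ∈ F₀, M • v ∈ coneOf F ∩ coneOf G :=
    ⟨key F hF₀ hx fun v hv => (hM v (Finset.mem_union_left _ hv)).1,
      key G hG₀ hx' fun v hv => (hM v (Finset.mem_union_right _ hv)).2⟩
  rw [S.inter_cone F hF G hG] at hmem
  obtain ⟨mu, -, hmu⟩ := hmem
  intro v hv
  by_cases hv0 : v ∈ F₀
  · exact hG₀ hv0
  rw [mem_carrier_iff hv0] at hv
  have := congrArg (S.coord F v) hmu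
  rw [map_add, coord_sum hF hF₀ (fun _ => M) hv.1, if_neg hv0,
    coord_sum hF Finset.inter_subset_left _ hv.1] at this
  by_contra hvG
  rw [if_neg (by simp [hvG])] at this
  linarith [hv.2]

theorem convex_relCone (F₀ F : Finset (Fin n → ℝ)) : Convex ℝ (S.relCone F₀ F) := by
  intro x hx y hy a b ha hb _
  constructor
  · intro v hv
    rw [map_add, map_smul, map_smul]
    exact add_nonneg (mul_nonneg ha (hx.1 v hv)) (mul_nonneg hb (hy.1 v hv))
  · simp only [map_add, map_smul, add_smul, Finset.sum_add_distrib, smul_eq_mul, mul_smul]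
    rw [← Finset.smul_sum, ← Finset.smul_sum, hx.2, hy.2]

end SimplicialFan

section cubic
open Filter Topology

theorem frequently_cubic_nonneg_reduce {a b c d : ℝ}
    (h : ∃ᶠ ε in 𝓝[>] (0 : ℝ), 0 ≤ a + ε * b + ε ^ 2 * c + ε ^ 3 * d) :
    0 ≤ a ∧ (a = 0 → ∃ᶠ ε in 𝓝[>] (0 : ℝ), 0 ≤ b + ε * c + ε ^ 2 * d + ε ^ 3 * 0) := by
  constructor
  · have ht : Tendsto (fun ε : ℝ => a + ε * b + ε ^ 2 * c + ε ^ 3 * d) (𝓝[>] 0) (𝓝 a) := by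
      have : ContinuousAt (fun ε : ℝ => a + ε * b + ε ^ 2 * c + ε ^ 3 * d) 0 := by fun_prop
      have h2 := this.tendsto
      simp only [zero_mul, add_zero, ne_eq, OfNat.ofNat_ne_zero, not_false_eq_true,
        zero_pow] at h2
      exact h2.mono_left nhdsWithin_le_nhds
    by_contra hlt
    push Not at hlt
    exact h ((ht.eventually_lt_const hlt).mono fun ε hε => not_le.2 hε)
  · rintro rfl
    refine (h.and_eventually self_mem_nhdsWithin).mono fun ε hε => ?_
    have hpos : (0 : ℝ) < ε := hε.2
    have : (0 : ℝ) ≤ ε * (b + ε * c + ε ^ 2 * d + ε ^ 3 * 0) := by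
      have := hε.1
      nlinarith
    exact nonneg_of_mul_nonneg_right this hpos

theorem frequently_cubic_nonneg {a b c d : ℝ}
    (h : ∃ᶠ ε in 𝓝[>] (0 : ℝ), 0 ≤ a + ε * b + ε ^ 2 * c + ε ^ 3 * d) :
    0 ≤ a ∧ (a = 0 → 0 ≤ b ∧ (b = 0 → 0 ≤ c ∧ (c = 0 → 0 ≤ d))) := by
  obtain ⟨h1, h2⟩ := frequently_cubic_nonneg_reduce h
  refine ⟨h1, fun ha => ?_⟩
  obtain ⟨h3, h4⟩ := frequently_cubic_nonneg_reduce (h2 ha)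
  refine ⟨h3, fun hb => ?_⟩
  obtain ⟨h5, h6⟩ := frequently_cubic_nonneg_reduce (h4 hb)
  exact ⟨h5, fun hc => (frequently_cubic_nonneg_reduce (h6 hc)).1⟩

end cubic

namespace SimplicialFan
open Filter Topology

variable {n : ℕ} {S : SimplicialFan n}

theorem mem_coneOf_iff {F : Finset (Fin n → ℝ)} (hF : F ∈ S.faces) {x : Fin n → ℝ} :
    x ∈ coneOf F ↔ (∀ v ∈ F, 0 ≤ S.coord F v x) ∧ ∑ v ∈ F, S.coord F v x • v = x := by
  constructor
  · rintro ⟨lam, h, rfl⟩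
    have h1 := mem_relCone_sum (F₀ := ∅) hF subset_rfl (lam := lam) (by simpa using h)
    simpa [relCone] using h1
  · rintro ⟨h1, h2⟩
    exact ⟨_, h1, h2.symm⟩

theorem mem_suppSubmodule_of_mem {U : Finset (Fin n)} {F : Finset (Fin n → ℝ)}
    (hU : suppSet F ⊆ U) {v : Fin n → ℝ} (hv : v ∈ F) : v ∈ suppSubmodule ℝ U := fun i hi => by
  by_contra h
  exact hi (hU (mem_suppSet.2 ⟨v, hv, h⟩))

theorem exists_notMem_span (U : Finset (Fin n)) : ∃ y ∈ suppSubmodule ℝ U,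
    ∀ F ∈ (S.restrict U).faces, F.card < U.card → y ∉ Submodule.span ℝ (F : Set (Fin n → ℝ)) := by
  have hcov := Subspace.biUnion_ne_univ_of_top_notMem (k := ℝ) (E := suppSubmodule ℝ U)
    (s := (S.faces.filter fun F => F.card < U.card).image fun F : Finset (Fin n → ℝ) =>
      (Submodule.span ℝ (F : Set (Fin n → ℝ))).comap (suppSubmodule ℝ U).subtype) (by
      simp only [Finset.mem_image, Finset.mem_filter, not_exists, not_and, and_imp]
      intro F _ hF htop
      have hle : suppSubmodule ℝ U ≤ Submodule.span ℝ (F : Set (Fin n → ℝ)) := fun x hx => by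
        have : (⟨x, hx⟩ : suppSubmodule ℝ U) ∈ (⊤ : Submodule ℝ (suppSubmodule ℝ U)) := trivial
        rw [← htop] at this
        exact this
      have h1 := Submodule.finrank_mono hle
      have h2 := finrank_span_finset_le_card (R := ℝ) F
      rw [finrank_suppSubmodule] at h1
      rw [Set.finrank] at h2
      omega)
  obtain ⟨y, hy⟩ := (Set.ne_univ_iff_exists_notMem _).1 hcov
  simp only [Finset.mem_image, Finset.mem_filter, Set.mem_iUnion, not_exists] at hy
  exact ⟨y, y.2, fun F hF hc h => hy _ ⟨F, ⟨hF.1, hc⟩, rfl⟩ h⟩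

theorem span_eq_suppSubmodule {U : Finset (Fin n)} {G : Finset (Fin n → ℝ)}
    (hG : G ∈ (S.restrict U).faces) (hcard : G.card = U.card) {x : Fin n → ℝ}
    (hx : x ∈ suppSubmodule ℝ U) : ∑ v ∈ G, S.coord G v x • v = x := by
  have hspan : Submodule.span ℝ (G : Set (Fin n → ℝ)) = suppSubmodule ℝ U := by
    refine Submodule.eq_of_le_of_finrank_eq
      (Submodule.span_le.2 fun v hv => mem_suppSubmodule_of_mem hG.2 hv) ?_
    rw [finrank_suppSubmodule, ← hcard]
    exact finrank_span_finset_eq_card (S.indep G hG.1)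
  rw [← hspan] at hx
  obtain ⟨lam, -, rfl⟩ := Submodule.mem_span_finset.1 hx
  exact Finset.sum_congr rfl fun v hv => by rw [coord_sum hG.1 subset_rfl _ hv, if_pos hv]

/-- Relative cones of the top-dimensional faces of the star of `F₀` cover the points which are
nonnegative off the support of `F₀`. -/
theorem exists_mem_relCone {U : Finset (Fin n)} {F₀ : Finset (Fin n → ℝ)}
    (h₀ : F₀ ∈ (S.restrict U).faces) {x : Fin n → ℝ} (hx : x ∈ suppSubmodule ℝ U)
    (hpos : ∀ i ∈ U \ suppSet F₀, 0 ≤ x i) :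
    ∃ G ∈ (S.restrict U).faces, F₀ ⊆ G ∧ G.card = U.card ∧ x ∈ S.relCone F₀ G := by
  obtain ⟨y, hy, hyspan⟩ := exists_notMem_span (S := S) U
  set p : Fin n → ℝ := ∑ v ∈ F₀, v with hp
  set o : Fin n → ℝ := fun i => if i ∈ U then 1 else 0
  let q : ℝ → Fin n → ℝ := fun ε => p + ε • x + ε ^ 2 • o + ε ^ 3 • y
  have hpU : p ∈ suppSubmodule ℝ U :=
    Submodule.sum_mem _ fun v hv => mem_suppSubmodule_of_mem h₀.2 hv
  have hnn : ∀ F ∈ S.faces, ∀ v ∈ F, ∀ i, 0 ≤ v i := fun F hF v hv =>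
    S.verts_nonneg v (S.faces_subset_verts F hF hv)
  have hq0 : ∀ ε, ∀ i ∉ U, q ε i = 0 := fun ε i hi => by
    simp [q, o, hi, hx i hi, hy i hi, hpU i hi]
  have hqlin : ∀ (f : (Fin n → ℝ) →ₗ[ℝ] ℝ) ε,
      f (q ε) = f p + ε * f x + ε ^ 2 * f o + ε ^ 3 * f y := fun f ε => by simp [q]
  have hpi : ∀ i, 0 ≤ p i := fun i => by
    rw [hp, Finset.sum_apply]
    exact Finset.sum_nonneg fun v hv => hnn _ h₀.1 v hv i
  have hqpos : ∀ i ∈ U, ∀ᶠ ε in 𝓝[>] (0 : ℝ), 0 < q ε i := by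
    intro i hi
    by_contra hcon
    have h1 : ∃ᶠ ε in 𝓝[>] (0 : ℝ), 0 ≤ -p i + ε * (-x i) + ε ^ 2 * (-1) + ε ^ 3 * (-y i) := by
      refine (not_eventually.1 hcon).mono fun ε hε => ?_
      have : q ε i = p i + ε * x i + ε ^ 2 * 1 + ε ^ 3 * y i := by simp [q, o, hi]
      rw [this] at hε
      linarith
    obtain ⟨h2, h3⟩ := frequently_cubic_nonneg h1
    by_cases hiF : i ∈ suppSet F₀
    · obtain ⟨v, hv, hvi⟩ := mem_suppSet.1 hiF
      have : 0 < p i := by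
        rw [hp, Finset.sum_apply]
        exact Finset.sum_pos' (fun v hv => hnn _ h₀.1 v hv i)
          ⟨v, hv, lt_of_le_of_ne (hnn _ h₀.1 v hv i) (Ne.symm hvi)⟩
      linarith
    · obtain ⟨h4, h5⟩ := h3 (by linarith [hpi i])
      have := hpos i (Finset.mem_sdiff.2 ⟨hi, hiF⟩)
      linarith [(h5 (by linarith)).1]
  have hev : ∀ᶠ ε in 𝓝[>] (0 : ℝ), ∃ F ∈ S.faces, suppSet F ⊆ U ∧ q ε ∈ coneOf F := by
    filter_upwards [(Finset.eventually_all U).2 hqpos] with ε hε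
    have hqnn : q ε ∈ {x : Fin n → ℝ | ∀ i, 0 ≤ x i} := fun i => by
      by_cases hi : i ∈ U
      · exact (hε i hi).le
      · exact (hq0 ε i hi).ge
    rw [← S.covers] at hqnn
    simp only [Set.mem_iUnion] at hqnn
    obtain ⟨F, hF, lam, hlam, hq⟩ := hqnn
    refine ⟨F.filter fun v => lam v ≠ 0, S.down_closed F hF _ (Finset.filter_subset _ _), ?_, lam,
      fun v hv => hlam v (Finset.mem_of_mem_filter v hv), ?_⟩
    · intro i hi
      by_contra hiU
      obtain ⟨v, hv, hvi⟩ := mem_suppSet.1 hi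
      rw [Finset.mem_filter] at hv
      have h1 := hq0 ε i hiU
      rw [hq, Finset.sum_apply, Finset.sum_eq_zero_iff_of_nonneg] at h1
      · have h2 := h1 v hv.1
        simp only [Pi.smul_apply, smul_eq_mul, mul_eq_zero] at h2
        exact h2.elim hv.2 hvi
      · exact fun w hw => mul_nonneg (hlam w hw) (hnn F hF w hw i)
    · rw [hq]
      symm
      refine Finset.sum_subset (Finset.filter_subset _ _) fun v hv hv' => ?_
      simp only [Finset.mem_filter, not_and, not_not] at hv'
      rw [hv' hv, zero_smul]
  obtain ⟨F, hF, hFU, hfreq⟩ : ∃ F ∈ S.faces, suppSet F ⊆ U ∧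
      ∃ᶠ ε in 𝓝[>] (0 : ℝ), q ε ∈ coneOf F := by
    by_contra hcon
    push Not at hcon
    have h1 : ∀ᶠ ε in 𝓝[>] (0 : ℝ), ∀ F ∈ S.faces, suppSet F ⊆ U → q ε ∉ coneOf F := by
      rw [Finset.eventually_all]
      intro F hF
      by_cases hU : suppSet F ⊆ U
      · exact (hcon F hF hU).mono fun ε h _ => h
      · exact Eventually.of_forall fun ε h => absurd h hU
    obtain ⟨ε, ⟨F, hF, hU, hq⟩, h2⟩ := (hev.and h1).exists
    exact h2 F hF hU hq
  have hzero : ∀ f : (Fin n → ℝ) →ₗ[ℝ] ℝ, (∀ z ∈ coneOf F, f z = 0) →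
      f p = 0 ∧ f x = 0 ∧ f y = 0 := by
    intro f hf
    have hz : ∃ᶠ ε in 𝓝[>] (0 : ℝ), f (q ε) = 0 := hfreq.mono fun ε h => hf _ h
    have e1 := frequently_cubic_nonneg (hz.mono fun ε h => by rw [← hqlin f, h])
    have e2 := frequently_cubic_nonneg (a := -f p) (b := -f x) (c := -f o) (d := -f y)
      (hz.mono fun ε h => by rw [hqlin f] at h; linarith)
    have hp0 : f p = 0 := le_antisymm (by linarith [e2.1]) e1.1
    have e1 := e1.2 hp0
    have e2 := e2.2 (by linarith)
    have hx0 : f x = 0 := le_antisymm (by linarith [e2.1]) e1.1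
    have e1 := e1.2 hx0
    have e2 := e2.2 (by linarith)
    have ho0 : f o = 0 := le_antisymm (by linarith [e2.1]) e1.1
    exact ⟨hp0, hx0, le_antisymm (by linarith [e2.2 (by linarith)]) (e1.2 ho0)⟩
  have hcoord : ∀ v ∈ F, 0 ≤ S.coord F v p ∧ (S.coord F v p = 0 → 0 ≤ S.coord F v x) := by
    intro v hv
    have := frequently_cubic_nonneg (hfreq.mono fun ε h => by
      rw [← hqlin (S.coord F v)]; exact ((mem_coneOf_iff hF).1 h).1 v hv)
    exact ⟨this.1, fun h => (this.2 h).1⟩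
  have hproj : ∀ i, p i = (∑ v ∈ F, S.coord F v p • v) i ∧ x i = (∑ v ∈ F, S.coord F v x • v) i ∧
      y i = (∑ v ∈ F, S.coord F v y • v) i := by
    intro i
    have := hzero (LinearMap.proj i ∘ₗ
      (LinearMap.id - ∑ v ∈ F, (S.coord F v).smulRight v)) fun z hz => by
        have := ((mem_coneOf_iff hF).1 hz).2
        simp only [LinearMap.comp_apply, LinearMap.sub_apply, LinearMap.id_apply,
          LinearMap.sum_apply, LinearMap.smulRight_apply, this, sub_self, map_zero]
    simpa only [LinearMap.comp_apply, LinearMap.sub_apply, LinearMap.id_apply,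
          LinearMap.sum_apply, LinearMap.smulRight_apply, LinearMap.proj_apply, Pi.sub_apply,
          sub_eq_zero] using this
  have hpF : p ∈ coneOf F := (mem_coneOf_iff hF).2
    ⟨fun v hv => (hcoord v hv).1, funext fun i => ((hproj i).1).symm⟩
  have hpF₀ : p ∈ coneOf F₀ := ⟨fun _ => 1, fun _ _ => zero_le_one, by simp [hp]⟩
  have hp1 : p = ∑ v ∈ F₀, (fun _ => (1 : ℝ)) v • v := by simp [hp]
  have hF₀F : F₀ ⊆ F := by
    have hmem : p ∈ coneOf F₀ ∩ coneOf F := ⟨hpF₀, hpF⟩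
    rw [S.inter_cone _ h₀.1 _ hF] at hmem
    obtain ⟨mu, -, hmu⟩ := hmem
    intro v hv
    by_contra hvF
    have h1 := coord_sum (G := F₀ ∩ F) h₀.1 Finset.inter_subset_left mu hv
    rw [← hmu, if_neg (by simp [hvF]), hp1, coord_sum h₀.1 subset_rfl _ hv, if_pos hv] at h1
    exact one_ne_zero h1
  refine ⟨F, ⟨hF, hFU⟩, hF₀F, ?_, fun v hv => ?_, funext fun i => (hproj i).2.1.symm⟩
  · refine le_antisymm (S.card_le_of_suppSet_subset hF hFU) (not_lt.1 fun hlt => ?_)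
    refine hyspan F ⟨hF, hFU⟩ hlt ?_
    rw [show y = ∑ v ∈ F, S.coord F v y • v from funext fun i => (hproj i).2.2]
    exact Submodule.sum_mem _ fun v hv => Submodule.smul_mem _ _ (Submodule.subset_span hv)
  · rw [Finset.mem_sdiff] at hv
    refine (hcoord v hv.1).2 ?_
    rw [hp1, coord_sum hF hF₀F _ hv.1, if_neg hv.2]

end SimplicialFan

namespace SimplicialFan
open BoundedComplex

variable {n : ℕ} {S : SimplicialFan n}

variable (S) in
/-- The faces in the star of `F₀` whose relative cone meets `Q`. -/
def meeting (U : Finset (Fin n)) (F₀ : Finset (Fin n → ℝ)) (Q : Set (Fin n → ℝ)) :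
    Set (Finset (Fin n → ℝ)) :=
  {F | F ∈ (S.restrict U).faces ∧ F₀ ⊆ F ∧ ∃ x ∈ Q, x ∈ S.relCone F₀ F}

theorem upClosed_meeting (U : Finset (Fin n)) (F₀ : Finset (Fin n → ℝ)) (Q : Set (Fin n → ℝ)) :
    (S.restrict U).UpClosed (S.meeting U F₀ Q) :=
  ⟨fun _ hF => hF.1, fun _ hF _ hG hFG => ⟨hG, hF.2.1.trans hFG, by
    obtain ⟨x, hx, h⟩ := hF.2.2
    exact ⟨x, hx, relCone_mono hF.2.1 hG.1 hFG h⟩⟩⟩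

/-- `f` has constant weak sign on `Q`. -/
def WeakSign {n : ℕ} (Q : Set (Fin n → ℝ)) (f : (Fin n → ℝ) →ₗ[ℝ] ℝ) : Prop :=
  (∀ x ∈ Q, 0 ≤ f x) ∨ ∀ x ∈ Q, f x ≤ 0

theorem WeakSign.mono {Q Q' : Set (Fin n → ℝ)} {f : (Fin n → ℝ) →ₗ[ℝ] ℝ} (h : WeakSign Q f)
    (hQ : Q' ⊆ Q) : WeakSign Q' f :=
  h.imp (fun h x hx => h x (hQ hx)) fun h x hx => h x (hQ hx)

theorem exists_point_of_weakSign {Q : Set (Fin n → ℝ)} (hne : Q.Nonempty) (hQ : Convex ℝ Q)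
    (Φ : Finset ((Fin n → ℝ) →ₗ[ℝ] ℝ)) (hΦ : ∀ f ∈ Φ, WeakSign Q f) :
    ∃ y ∈ Q, ∀ f ∈ Φ, (∃ x ∈ Q, f x ≠ 0) → f y ≠ 0 := by
  induction Φ using Finset.induction_on with
  | empty =>
    obtain ⟨y, hy⟩ := hne
    exact ⟨y, hy, by simp⟩
  | insert f Φ _ ih =>
    obtain ⟨y, hy, h⟩ := ih fun g hg => hΦ g (Finset.mem_insert_of_mem hg)
    by_cases hf : (∃ x ∈ Q, f x ≠ 0) ∧ f y = 0
    · obtain ⟨⟨x, hx, hfx⟩, hfy⟩ := hf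
      refine ⟨(1 / 2 : ℝ) • y + (1 / 2 : ℝ) • x, hQ hy hx (by norm_num) (by norm_num) (by norm_num),
        fun g hg hex => ?_⟩
      rw [map_add, map_smul, map_smul]
      rcases Finset.mem_insert.1 hg with rfl | hg'
      · simp [hfy, hfx]
      · have hgy := h g hg' hex
        simp only [smul_eq_mul]
        rcases hΦ g hg with hs | hs
        · have h1 := lt_of_le_of_ne (hs y hy) (Ne.symm hgy)
          have h2 := hs x hx
          positivity
        · have h1 := lt_of_le_of_ne (hs y hy) hgy
          have h2 := hs x hx
          intro h3
          linarith
    · refine ⟨y, hy, fun g hg hex => ?_⟩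
      rcases Finset.mem_insert.1 hg with rfl | hg'
      · exact fun h0 => hf ⟨hex, h0⟩
      · exact h g hg' hex

/-- A convex set avoiding the lineality space, on which all coordinate comparisons are decided, has
a unique minimal carrier. -/
theorem exists_meeting_eq_star {U : Finset (Fin n)} {F₀ : Finset (Fin n → ℝ)}
    {Q : Set (Fin n → ℝ)} (hne : Q.Nonempty) (hconv : Convex ℝ Q) (hQU : ∀ x ∈ Q, x ∈ suppSubmodule ℝ U)
    (hcov : ∀ x ∈ Q, ∃ G ∈ (S.restrict U).faces, F₀ ⊆ G ∧ G.card = U.card ∧ x ∈ S.relCone F₀ G)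
    (hno : ∀ x ∈ Q, x ∉ S.relCone F₀ F₀)
    (hcoord : ∀ G ∈ (S.restrict U).faces, ∀ v ∈ G, WeakSign Q (S.coord G v))
    (hcomp : ∀ G ∈ (S.restrict U).faces, ∀ u ∈ G, ∀ v ∈ G,
      WeakSign Q (S.coord G u - S.coord G v)) :
    ∃ F₁ ∈ (S.restrict U).faces, F₀ ⊂ F₁ ∧ (∃ x ∈ Q, x ∈ S.relCone F₀ F₁) ∧
      S.meeting U F₀ Q = (S.restrict U).star F₁ := by
  obtain ⟨y, hy, hgen⟩ := exists_point_of_weakSign hne hconv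
    ((S.faces.filter fun G => suppSet G ⊆ U).biUnion fun G => G.image (S.coord G)) (by
      simp only [Finset.mem_biUnion, Finset.mem_filter, Finset.mem_image]
      rintro f ⟨G, hG, v, hv, rfl⟩
      exact hcoord G hG v hv)
  obtain ⟨G, hG, hF₀G, hcard, hyG⟩ := hcov y hy
  have hQG : ∀ x ∈ Q, x ∈ S.relCone F₀ G := by
    intro x hx
    refine ⟨fun v hv => ?_, span_eq_suppSubmodule hG hcard (hQU x hx)⟩
    have h1 := hyG.1 v hv
    have hvG := (Finset.mem_sdiff.1 hv).1
    by_cases h0 : S.coord G v x = 0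
    · exact h0.ge
    · have h2 := hgen (S.coord G v) (Finset.mem_biUnion.2
        ⟨G, Finset.mem_filter.2 hG, Finset.mem_image_of_mem _ hvG⟩) ⟨x, hx, h0⟩
      rcases hcoord G hG v hvG with h3 | h3
      · exact h3 x hx
      · exact absurd (le_antisymm (h3 y hy) h1) h2
  obtain ⟨x, hx, hmin⟩ : ∃ x ∈ Q, ∀ z ∈ Q, (S.carrier F₀ G x).card ≤ (S.carrier F₀ G z).card := by
    obtain ⟨m, ⟨⟨x, hx, rfl⟩, hm⟩⟩ :=
      WellFounded.has_min (wellFounded_lt (α := ℕ)) ((fun z => (S.carrier F₀ G z).card) '' Q)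
        (hne.image _)
    exact ⟨x, hx, fun z hz => not_lt.1 (hm _ ⟨z, hz, rfl⟩)⟩
  have hsub : ∀ z ∈ Q, S.carrier F₀ G x ⊆ S.carrier F₀ G z := by
    intro z hz
    by_contra hcon
    obtain ⟨u, hu, huz⟩ := Finset.not_subset.1 hcon
    have hu0 : u ∉ F₀ := fun h => huz (subset_carrier _ _ _ h)
    rw [mem_carrier_iff hu0] at hu huz
    have hu2 : S.coord G u z = 0 := le_antisymm (not_lt.1 fun h => huz ⟨hu.1, h⟩)
      ((hQG z hz).1 u (Finset.mem_sdiff.2 ⟨hu.1, hu0⟩))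
    have hss : S.carrier F₀ G z ⊂ S.carrier F₀ G x := by
      refine (Finset.ssubset_iff_of_subset fun v hv => ?_).2
        ⟨u, (mem_carrier_iff hu0).2 hu, fun h => huz ((mem_carrier_iff hu0).1 h)⟩
      by_cases hv0 : v ∈ F₀
      · exact subset_carrier _ _ _ hv0
      · rw [mem_carrier_iff hv0] at hv ⊢
        refine ⟨hv.1, ?_⟩
        rcases hcomp G hG u hu.1 v hv.1 with h1 | h1
        · have := h1 z hz
          simp only [LinearMap.sub_apply] at this
          linarith [hv.2]
        · have := h1 x hx
          simp only [LinearMap.sub_apply] at this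
          linarith [hu.2]
    exact absurd (Finset.card_lt_card hss) (not_lt.2 (hmin z hz))
  have hF₁ : S.carrier F₀ G x ∈ (S.restrict U).faces :=
    (S.restrict U).down _ hG _ (carrier_subset hF₀G x)
  have hxF₁ : x ∈ S.relCone F₀ (S.carrier F₀ G x) :=
    mem_relCone_of_carrier_subset hF₀G hF₁.1 (hQG x hx) subset_rfl
  refine ⟨S.carrier F₀ G x, hF₁, ?_, ⟨x, hx, hxF₁⟩, ?_⟩
  · refine lt_of_le_of_ne (subset_carrier _ _ _) fun h => hno x hx ?_
    rw [← h] at hxF₁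
    exact hxF₁
  · ext F
    constructor
    · rintro ⟨hF, h0, z, hz, hzF⟩
      exact ⟨hF, (hsub z hz).trans
        (carrier_subset_of_mem_relCone hG.1 hF.1 hF₀G h0 (hQG z hz) hzF)⟩
    · rintro ⟨hF, hsubF⟩
      exact ⟨hF, (subset_carrier _ _ _).trans hsubF, x, hx,
        relCone_mono (subset_carrier _ _ _) hF.1 hsubF hxF₁⟩

variable {k : Type*} [Field k] [CharP k 2]

theorem acyc_meeting_of_convex_decided {U : Finset (Fin n)} {F₀ : Finset (Fin n → ℝ)}
    (ih : ∀ F₁ ∈ (S.restrict U).faces, F₀ ⊂ F₁ → suppSet F₁ = U →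
      (S.restrict U).Acyc k ((S.restrict U).star F₁))
    (Φ : Finset ((Fin n → ℝ) →ₗ[ℝ] ℝ)) :
    ∀ Q : Set (Fin n → ℝ), Q.Nonempty → Convex ℝ Q → (∀ x ∈ Q, x ∈ suppSubmodule ℝ U) →
    (∀ x ∈ Q, ∃ G ∈ (S.restrict U).faces, F₀ ⊆ G ∧ G.card = U.card ∧ x ∈ S.relCone F₀ G) →
    (∀ x ∈ Q, x ∉ S.relCone F₀ F₀) →
    (∀ x ∈ Q, ∀ F ∈ (S.restrict U).faces, F₀ ⊆ F → x ∈ S.relCone F₀ F → suppSet F = U) →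
    (∀ G ∈ (S.restrict U).faces, ∀ v ∈ G, S.coord G v ∈ Φ ∨ WeakSign Q (S.coord G v)) →
    (∀ G ∈ (S.restrict U).faces, ∀ u ∈ G, ∀ v ∈ G, S.coord G u - S.coord G v ∈ Φ ∨
      WeakSign Q (S.coord G u - S.coord G v)) →
    (S.restrict U).Acyc k (S.meeting U F₀ Q) := by
  induction Φ using Finset.induction_on with
  | empty =>
    intro Q hne hconv hQU hcov hno hint hcoord hcomp
    obtain ⟨F₁, hF₁, hlt, ⟨x, hx, hxF⟩, heq⟩ := exists_meeting_eq_star hne hconv hQU hcov hno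
      (fun G hG v hv => by simpa using hcoord G hG v hv)
      (fun G hG u hu v hv => by simpa using hcomp G hG u hu v hv)
    rw [heq]
    exact ih F₁ hF₁ hlt (hint x hx F₁ hF₁ hlt.1 hxF)
  | insert f Φ _ ihΦ =>
    intro Q hne hconv hQU hcov hno hint hcoord hcomp
    have apply_ih : ∀ Q' ⊆ Q, Q'.Nonempty → Convex ℝ Q' → WeakSign Q' f →
        (S.restrict U).Acyc k (S.meeting U F₀ Q') := by
      intro Q' hsub hne' hconv' hf
      refine ihΦ Q' hne' hconv' (fun x hx => hQU x (hsub hx)) (fun x hx => hcov x (hsub hx))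
        (fun x hx => hno x (hsub hx)) (fun x hx => hint x (hsub hx)) (fun G hG v hv => ?_)
        (fun G hG u hu v hv => ?_)
      · rcases hcoord G hG v hv with h | h
        · rcases Finset.mem_insert.1 h with h | h
          · exact Or.inr (h ▸ hf)
          · exact Or.inl h
        · exact Or.inr (h.mono hsub)
      · rcases hcomp G hG u hu v hv with h | h
        · rcases Finset.mem_insert.1 h with h | h
          · exact Or.inr (h ▸ hf)
          · exact Or.inl h
        · exact Or.inr (h.mono hsub)
    by_cases hf : WeakSign Q f
    · exact apply_ih Q subset_rfl hne hconv hf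
    · have hf' := hf
      simp only [WeakSign, not_or, not_forall, not_le] at hf'
      obtain ⟨⟨a, ha, hfa⟩, b, hb, hfb⟩ := hf'
      have hpos : Convex ℝ {x : Fin n → ℝ | 0 ≤ f x} := convex_halfSpace_ge f.isLinear 0
      have hneg : Convex ℝ {x : Fin n → ℝ | f x ≤ 0} := convex_halfSpace_le f.isLinear 0
      have hzero : ∀ C : Set (Fin n → ℝ), Convex ℝ C → ∀ x ∈ C, ∀ y ∈ C, 0 ≤ f x → f y ≤ 0 →
          ∃ z ∈ C, f z = 0 := by
        intro C hC x hx y hy hfx hfy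
        by_cases h : f x = f y
        · exact ⟨x, hx, by linarith⟩
        · have hlt : 0 < f x - f y :=
            lt_of_le_of_ne (by linarith) fun h' => h (by linarith)
          refine ⟨(-f y / (f x - f y)) • x + (f x / (f x - f y)) • y,
            hC hx hy (div_nonneg (by linarith) hlt.le) (div_nonneg hfx hlt.le) ?_, ?_⟩
          · field_simp
            ring
          · rw [map_add, map_smul, map_smul]
            simp only [smul_eq_mul]
            field_simp
            ring
      have hunion : S.meeting U F₀ Q = S.meeting U F₀ (Q ∩ {x | 0 ≤ f x}) ∪
          S.meeting U F₀ (Q ∩ {x | f x ≤ 0}) := by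
        ext F
        constructor
        · rintro ⟨hF, h0, x, hx, hxF⟩
          rcases le_total 0 (f x) with h | h
          · exact Or.inl ⟨hF, h0, x, ⟨hx, h⟩, hxF⟩
          · exact Or.inr ⟨hF, h0, x, ⟨hx, h⟩, hxF⟩
        · rintro (⟨hF, h0, x, hx, hxF⟩ | ⟨hF, h0, x, hx, hxF⟩) <;>
            exact ⟨hF, h0, x, hx.1, hxF⟩
      have hinter : S.meeting U F₀ (Q ∩ {x | 0 ≤ f x}) ∩ S.meeting U F₀ (Q ∩ {x | f x ≤ 0}) =
          S.meeting U F₀ (Q ∩ {x | f x = 0}) := by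
        ext F
        constructor
        · rintro ⟨⟨hF, h0, x, hx, hxF⟩, -, -, y, hy, hyF⟩
          obtain ⟨z, hz, hfz⟩ := hzero (Q ∩ S.relCone F₀ F) (hconv.inter (convex_relCone _ _))
            x ⟨hx.1, hxF⟩ y ⟨hy.1, hyF⟩ hx.2 hy.2
          exact ⟨hF, h0, z, ⟨hz.1, hfz⟩, hz.2⟩
        · rintro ⟨hF, h0, x, hx, hxF⟩
          exact ⟨⟨hF, h0, x, ⟨hx.1, (show f x = 0 from hx.2).ge⟩, hxF⟩,
            ⟨hF, h0, x, ⟨hx.1, (show f x = 0 from hx.2).le⟩, hxF⟩⟩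
      rw [hunion]
      refine Acyc.union (upClosed_meeting _ _ _) (upClosed_meeting _ _ _)
        (apply_ih _ Set.inter_subset_left ⟨b, hb, hfb.le⟩ (hconv.inter hpos)
          (Or.inl fun x hx => hx.2))
        (apply_ih _ Set.inter_subset_left ⟨a, ha, hfa.le⟩ (hconv.inter hneg)
          (Or.inr fun x hx => hx.2)) ?_
      rw [hinter]
      obtain ⟨z, hz, hfz⟩ := hzero Q hconv b hb a ha hfb.le hfa.le
      exact apply_ih _ Set.inter_subset_left ⟨z, hz, hfz⟩
        (hconv.inter (convex_hyperplane f.isLinear 0)) (Or.inl fun x hx => hx.2.ge)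

theorem acyc_meeting {U : Finset (Fin n)} {F₀ : Finset (Fin n → ℝ)}
    (ih : ∀ F₁ ∈ (S.restrict U).faces, F₀ ⊂ F₁ → suppSet F₁ = U →
      (S.restrict U).Acyc k ((S.restrict U).star F₁))
    {Q : Set (Fin n → ℝ)} (hne : Q.Nonempty) (hconv : Convex ℝ Q)
    (hQU : ∀ x ∈ Q, x ∈ suppSubmodule ℝ U)
    (hcov : ∀ x ∈ Q, ∃ G ∈ (S.restrict U).faces, F₀ ⊆ G ∧ G.card = U.card ∧ x ∈ S.relCone F₀ G)
    (hno : ∀ x ∈ Q, x ∉ S.relCone F₀ F₀)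
    (hint : ∀ x ∈ Q, ∀ F ∈ (S.restrict U).faces, F₀ ⊆ F → x ∈ S.relCone F₀ F → suppSet F = U) :
    (S.restrict U).Acyc k (S.meeting U F₀ Q) := by
  refine acyc_meeting_of_convex_decided ih
    ((S.faces.biUnion fun G => G.image (S.coord G)) ∪
      S.faces.biUnion fun G => (G ×ˢ G).image fun p => S.coord G p.1 - S.coord G p.2)
    Q hne hconv hQU hcov hno hint (fun G hG v hv => Or.inl ?_) fun G hG u hu v hv => Or.inl ?_
  · exact Finset.mem_union_left _
      (Finset.mem_biUnion.2 ⟨G, hG.1, Finset.mem_image_of_mem _ hv⟩)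
  · exact Finset.mem_union_right _ (Finset.mem_biUnion.2 ⟨G, hG.1,
      Finset.mem_image.2 ⟨(u, v), Finset.mem_product.2 ⟨hu, hv⟩, rfl⟩⟩)

end SimplicialFan

namespace BoundedComplex

variable {V : Type*} [DecidableEq V] {K : BoundedComplex V} {k : Type*} [Field k]

theorem Acyc.eq_singleton {W : Set (Finset V)} (hW : K.UpClosed W) (h : K.Acyc k W)
    (hcard : ∀ F ∈ W, F.card = K.N) : ∃ G ∈ W, W = {G} := by
  obtain ⟨⟨G, hG, hGc⟩, -, hex⟩ := h
  refine ⟨G, hG, Set.eq_singleton_iff_unique_mem.2 ⟨hG, fun F hF => ?_⟩⟩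
  have hchain : K.IsChain (fun H : Finset V => if H = G then (1 : k) else 0) := fun H hH => by
    have hne : H ≠ G := by
      rintro rfl
      exact hH (hW.1 hG)
    simp [hne]
  obtain ⟨y, c, hy, e⟩ := hex _ hchain fun H hH => bdry_eq_zero_of_card hchain (hcard H hH)
  have e1 := e G hG
  have e2 := e F hF
  rw [bdry_eq_zero_of_card hy (hcard _ hG)] at e1
  rw [bdry_eq_zero_of_card hy (hcard _ hF)] at e2
  simp only [top, hW.1 hG, hW.1 hF, hcard _ hG, hcard _ hF, and_self, if_true] at e1 e2
  by_contra hne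
  rw [if_neg hne] at e2
  exact one_ne_zero (e1.trans e2.symm)

theorem acyc_star_of_card {F₀ : Finset V} (h₀ : F₀ ∈ K.faces) (hcard : F₀.card = K.N) :
    K.Acyc k (K.star F₀) := by
  have h1 : ∀ F ∈ K.star F₀, F = F₀ := fun F hF =>
    (Finset.eq_of_subset_of_card_le hF.2 (hcard ▸ K.card_le F hF.1)).symm
  refine ⟨⟨F₀, ⟨h₀, subset_rfl⟩, hcard⟩, fun F hF => ?_, fun z hz _ => ?_⟩
  · rw [h1 F hF]
    exact bdry_eq_zero_of_card isChain_top hcard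
  · refine ⟨fun _ => 0, z F₀, fun _ _ => rfl, fun F hF => ?_⟩
    rw [h1 F hF]
    simp [bdry, top, h₀, hcard]

/-- If exactly two faces cover `F₀` and they are top-dimensional, the fundamental chain has no
boundary at `F₀`. -/
theorem bdry_top_eq_zero_of_two [CharP k 2] {F₀ G₁ G₂ : Finset V} (hne : G₁ ≠ G₂)
    (hcard : F₀.card + 1 = K.N) (hstar : K.star F₀ \ {F₀} = {G₁} ∪ {G₂}) :
    K.bdry (K.top k) F₀ = 0 := by
  have key : ∀ G ∈ K.star F₀ \ {F₀}, ∃ v ∈ K.X \ F₀, G = insert v F₀ ∧ K.top k G = 1 := by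
    rintro G ⟨⟨hG, hsub⟩, hG0⟩
    have hlt : F₀ ⊂ G := lt_of_le_of_ne hsub fun e => hG0 e.symm
    obtain ⟨v, hv, hv0⟩ := Finset.exists_of_ssubset hlt
    have hc : G.card = K.N := le_antisymm (K.card_le G hG) (hcard ▸ Finset.card_lt_card hlt)
    refine ⟨v, Finset.mem_sdiff.2 ⟨K.sub _ hG hv, hv0⟩, ?_, by simp [top, hG, hc]⟩
    symm
    refine Finset.eq_of_subset_of_card_le (Finset.insert_subset hv hsub) ?_
    rw [Finset.card_insert_of_notMem hv0]
    omega
  obtain ⟨v₁, hv₁, e₁, t₁⟩ := key G₁ (hstar ▸ Or.inl rfl)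
  obtain ⟨v₂, hv₂, e₂, t₂⟩ := key G₂ (hstar ▸ Or.inr rfl)
  have hv : v₁ ≠ v₂ := by
    rintro rfl
    exact hne (e₁.trans e₂.symm)
  unfold bdry
  rw [Finset.sum_eq_add v₁ v₂ hv, ← e₁, ← e₂, t₁, t₂]
  · exact CharTwo.add_self_eq_zero 1
  · rintro v hvX ⟨hn₁, hn₂⟩
    rw [Finset.mem_sdiff] at hvX
    unfold top
    rw [if_neg]
    rintro ⟨hf, -⟩
    have hmem : insert v F₀ ∈ K.star F₀ \ {F₀} := ⟨⟨hf, Finset.subset_insert _ _⟩,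
      fun h => hvX.2 (Finset.insert_eq_self.1 h)⟩
    have hvm : v ∈ insert v F₀ := Finset.mem_insert_self _ _
    rw [hstar] at hmem
    rcases hmem with h | h
    · rw [Set.mem_singleton_iff.1 h, e₁, Finset.mem_insert] at hvm
      exact hvm.elim hn₁ hvX.2
    · rw [Set.mem_singleton_iff.1 h, e₂, Finset.mem_insert] at hvm
      exact hvm.elim hn₂ hvX.2
  · exact fun h => absurd hv₁ h
  · exact fun h => absurd hv₂ h

end BoundedComplex

namespace SimplicialFan
open BoundedComplex Filter Topology

variable {n : ℕ} {S : SimplicialFan n}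

theorem exists_pos_perturbation {ι : Type*} (A : Finset ι) (c d : ι → ℝ) (h : ∀ v ∈ A, 0 < c v) :
    ∃ δ > 0, ∀ v ∈ A, 0 ≤ c v + δ * d v := by
  have h1 : ∀ᶠ δ in 𝓝[>] (0 : ℝ), ∀ v ∈ A, 0 ≤ c v + δ * d v := by
    rw [Finset.eventually_all]
    intro v hv
    have hc : ContinuousAt (fun δ : ℝ => c v + δ * d v) 0 := by fun_prop
    have := hc.eventually_const_lt (by simpa using h v hv)
    exact (this.filter_mono nhdsWithin_le_nhds).mono fun δ hδ => hδ.le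
  obtain ⟨δ, hδ, h2⟩ := (h1.and self_mem_nhdsWithin).exists
  exact ⟨δ, h2, hδ⟩

theorem relCone_smul {F₀ F : Finset (Fin n → ℝ)} {x : Fin n → ℝ} (hx : x ∈ S.relCone F₀ F) {c : ℝ}
    (hc : 0 ≤ c) : c • x ∈ S.relCone F₀ F := by
  refine ⟨fun v hv => ?_, ?_⟩
  · rw [map_smul]
    exact mul_nonneg hc (hx.1 v hv)
  · simp only [map_smul, smul_assoc]
    rw [← Finset.smul_sum, hx.2]

theorem mem_suppSubmodule_of_mem_relCone {U : Finset (Fin n)} {F₀ F : Finset (Fin n → ℝ)}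
    (hU : suppSet F ⊆ U) {x : Fin n → ℝ} (hx : x ∈ S.relCone F₀ F) : x ∈ suppSubmodule ℝ U := by
  rw [← hx.2]
  exact Submodule.sum_mem _ fun v hv => Submodule.smul_mem _ _ (mem_suppSubmodule_of_mem hU hv)

/-- A flag of functionals vanishing on `F₀` and generic with respect to the star of `F₀`. -/
def IsGenericFlag (S : SimplicialFan n) (F₀ : Finset (Fin n → ℝ))
    (h : ℕ → (Fin n → ℝ) →ₗ[ℝ] ℝ) : Prop :=
  (∀ j, ∀ v ∈ F₀, h j v = 0) ∧ ∀ F ∈ S.faces, F₀ ⊆ F →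
    (∀ lam : (Fin n → ℝ) → ℝ, (∀ j < (F \ F₀).card, ∑ v ∈ F \ F₀, lam v * h j v = 0) →
      ∀ v ∈ F \ F₀, lam v = 0) ∧
    ∀ b : ℕ → ℝ, ∃ lam : (Fin n → ℝ) → ℝ, ∀ j < (F \ F₀).card,
      ∑ v ∈ F \ F₀, lam v * h j v = b j

theorem exists_isGenericFlag (S : SimplicialFan n) (F₀ : Finset (Fin n → ℝ)) :
    ∃ h, IsGenericFlag S F₀ h := by
  let W : Submodule ℝ ((Fin n → ℝ) →ₗ[ℝ] ℝ) :=
    { carrier := {f | ∀ v ∈ F₀, f v = 0}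
      add_mem' := fun {f g} hf hg v hv => by simp [hf v hv, hg v hv]
      zero_mem' := fun _ _ => rfl
      smul_mem' := fun c f hf v hv => by simp [hf v hv] }
  let r : W →ₗ[ℝ] (Fin n → ℝ) → ℝ :=
    { toFun := fun f v => f.1 v
      map_add' := fun _ _ => rfl
      map_smul' := fun _ _ => rfl }
  obtain ⟨y, hy⟩ := exists_generic_sequence (K := ℝ) (W := W) r ((S.faces.filter fun F => F₀ ⊆ F).image (· \ F₀)) (by
    simp only [Finset.mem_image, Finset.mem_filter]
    rintro _ ⟨F, ⟨hF, h0⟩, rfl⟩ b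
    refine ⟨⟨∑ v ∈ F \ F₀, b v • S.coord F v, fun w hw => ?_⟩, fun w hw => ?_⟩
    · rw [LinearMap.sum_apply]
      refine Finset.sum_eq_zero fun v hv => ?_
      rw [Finset.mem_sdiff] at hv
      rw [LinearMap.smul_apply, coord_apply hF hv.1 (h0 hw), if_neg, smul_zero]
      rintro rfl
      exact hv.2 hw
    · change (∑ v ∈ F \ F₀, b v • S.coord F v) w = b w
      rw [LinearMap.sum_apply, Finset.sum_eq_single w]
      · simp [coord_apply hF (Finset.mem_sdiff.1 hw).1 (Finset.mem_sdiff.1 hw).1]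
      · intro v hv hne
        rw [LinearMap.smul_apply, coord_apply hF (Finset.mem_sdiff.1 hv).1
          (Finset.mem_sdiff.1 hw).1, if_neg (Ne.symm hne), smul_zero]
      · exact fun h => absurd hw h)
  exact ⟨fun j => (y j).1, fun j => (y j).2, fun F hF h0 => hy _ (Finset.mem_image_of_mem _
    (Finset.mem_filter.2 ⟨hF, h0⟩))⟩

section flag

variable {F₀ : Finset (Fin n → ℝ)} {h : ℕ → (Fin n → ℝ) →ₗ[ℝ] ℝ}

theorem IsGenericFlag.apply_sum (hflag : IsGenericFlag S F₀ h) {F : Finset (Fin n → ℝ)}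
    (lam : (Fin n → ℝ) → ℝ) (j : ℕ) :
    h j (∑ v ∈ F, lam v • v) = ∑ v ∈ F \ F₀, lam v * h j v := by
  rw [map_sum]
  symm
  simp only [map_smul, smul_eq_mul]
  refine Finset.sum_subset Finset.sdiff_subset fun v hv hv' => ?_
  rw [hflag.1 j v (by simpa [hv] using hv'), mul_zero]

theorem IsGenericFlag.apply_relCone_self (hflag : IsGenericFlag S F₀ h) {x : Fin n → ℝ}
    (hx : x ∈ S.relCone F₀ F₀) (j : ℕ) : h j x = 0 := by
  rw [← hx.2, hflag.apply_sum]
  simp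

theorem IsGenericFlag.mem_relCone_self (hflag : IsGenericFlag S F₀ h) {F : Finset (Fin n → ℝ)}
    (hF : F ∈ S.faces) (h₀ : F₀ ⊆ F) {x : Fin n → ℝ} (hx : x ∈ S.relCone F₀ F)
    (hzero : ∀ j < (F \ F₀).card, h j x = 0) : x ∈ S.relCone F₀ F₀ := by
  have := (hflag.2 F hF h₀).1 (fun v => S.coord F v x) fun j hj => by
    rw [← hflag.apply_sum, hx.2, hzero j hj]
  refine mem_relCone_of_carrier_subset h₀ (S.down_closed F hF F₀ h₀) hx fun v hv => ?_
  by_contra hv0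
  rw [mem_carrier_iff hv0] at hv
  exact hv.2.ne' (this v (Finset.mem_sdiff.2 ⟨hv.1, hv0⟩))

theorem IsGenericFlag.exists_perturbation (hflag : IsGenericFlag S F₀ h)
    {F : Finset (Fin n → ℝ)} (hF : F ∈ S.faces) (h₀ : F₀ ⊆ F) {x : Fin n → ℝ}
    (hx : x ∈ S.relCone F₀ F) (hx0 : x ∉ S.relCone F₀ F₀) {m : ℕ} (hzero : ∀ j < m, h j x = 0)
    {s : ℝ} (hs : s * s = 1) (hsx : 0 ≤ s * h m x) :
    ∃ x' ∈ S.relCone F₀ F, (∀ j < m, h j x' = 0) ∧ h m x' = s := by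
  set C := S.carrier F₀ F x with hCdef
  have hCF : C ⊆ F := carrier_subset h₀ x
  have hC : C ∈ S.faces := S.down_closed F hF _ hCF
  have h₀C : F₀ ⊆ C := subset_carrier _ _ _
  have hxC : x ∈ S.relCone F₀ C := mem_relCone_of_carrier_subset h₀ hC hx subset_rfl
  have hm : m < (C \ F₀).card := by
    by_contra hle
    exact hx0 (hflag.mem_relCone_self hC h₀C hxC fun j hj => hzero j (by omega))
  obtain ⟨lam, hlam⟩ := (hflag.2 C hC h₀C).2 fun j => if j = m then s else 0
  obtain ⟨δ, hδ, hpos⟩ := exists_pos_perturbation (C \ F₀) (fun v => S.coord F v x) lam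
    fun v hv => by
      rw [Finset.mem_sdiff] at hv
      exact ((mem_carrier_iff hv.2).1 hv.1).2
  set z := ∑ v ∈ C, (S.coord F v x + δ * lam v) • v with hz
  have hzF : z ∈ S.relCone F₀ F := mem_relCone_sum hF hCF hpos
  have hzx : ∀ j < (C \ F₀).card, h j z = h j x + δ * if j = m then s else 0 := by
    intro j hj
    rw [hz, hflag.apply_sum, ← hlam j hj]
    simp only [add_mul, Finset.sum_add_distrib, mul_assoc]
    rw [← Finset.mul_sum, ← hflag.apply_sum, ← eq_sum_carrier h₀ hx]
  have hd : 0 < s * h m x + δ := by linarith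
  refine ⟨(s * h m x + δ)⁻¹ • z, relCone_smul hzF (inv_nonneg.2 hd.le), fun j hj => ?_, ?_⟩
  · rw [map_smul, hzx j (by omega), hzero j hj, if_neg (by omega)]
    simp
  · rw [map_smul, hzx m hm, if_pos rfl, smul_eq_mul, inv_mul_eq_iff_eq_mul₀ hd.ne']
    linear_combination (-h m x) * hs

variable (S h F₀) in
/-- The faces of the star meeting the `m`-th member of the flag outside the span of `F₀`. -/
def flagSlice (U : Finset (Fin n)) (m : ℕ) : Set (Finset (Fin n → ℝ)) :=
  {F | F ∈ (S.restrict U).faces ∧ F₀ ⊆ F ∧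
    ∃ x ∈ S.relCone F₀ F, x ∉ S.relCone F₀ F₀ ∧ ∀ j < m, h j x = 0}

variable (h) in
/-- The affine section of the `m`-th member of the flag at height `s`. -/
def flagSection (U : Finset (Fin n)) (m : ℕ) (s : ℝ) : Set (Fin n → ℝ) :=
  {x | x ∈ suppSubmodule ℝ U ∧ (∀ j < m, h j x = 0) ∧ h m x = s}

theorem convex_flagSection (U : Finset (Fin n)) (m : ℕ) (s : ℝ) :
    Convex ℝ (flagSection h U m s) := by
  rintro x ⟨hxU, hx, hxs⟩ y ⟨hyU, hy, hys⟩ a b ha hb hab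
  refine ⟨Submodule.add_mem _ (Submodule.smul_mem _ _ hxU) (Submodule.smul_mem _ _ hyU),
    fun j hj => by simp [hx j hj, hy j hj], ?_⟩
  rw [map_add, map_smul, map_smul, hxs, hys, ← add_smul, hab, one_smul]

theorem IsGenericFlag.flagSlice_eq_union (hflag : IsGenericFlag S F₀ h) (U : Finset (Fin n))
    (m : ℕ) : flagSlice S F₀ h U m =
      S.meeting U F₀ (flagSection h U m 1) ∪ S.meeting U F₀ (flagSection h U m (-1)) := by
  ext F
  constructor
  · rintro ⟨hF, h0, x, hx, hx0, hz⟩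
    rcases le_total 0 (h m x) with hs | hs
    · obtain ⟨x', hx', hz', hs'⟩ := hflag.exists_perturbation hF.1 h0 hx hx0 hz (s := 1)
        (by norm_num) (by linarith)
      exact Or.inl ⟨hF, h0, x', ⟨mem_suppSubmodule_of_mem_relCone hF.2 hx', hz', hs'⟩, hx'⟩
    · obtain ⟨x', hx', hz', hs'⟩ := hflag.exists_perturbation hF.1 h0 hx hx0 hz (s := -1)
        (by norm_num) (by linarith)
      exact Or.inr ⟨hF, h0, x', ⟨mem_suppSubmodule_of_mem_relCone hF.2 hx', hz', hs'⟩, hx'⟩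
  · rintro (⟨hF, h0, x, ⟨-, hz, hs⟩, hx⟩ | ⟨hF, h0, x, ⟨-, hz, hs⟩, hx⟩) <;>
    · refine ⟨hF, h0, x, hx, fun hx0 => ?_, hz⟩
      rw [hflag.apply_relCone_self hx0] at hs
      norm_num at hs

theorem IsGenericFlag.flagSlice_succ (hflag : IsGenericFlag S F₀ h) (U : Finset (Fin n))
    (m : ℕ) : S.meeting U F₀ (flagSection h U m 1) ∩ S.meeting U F₀ (flagSection h U m (-1)) =
      flagSlice S F₀ h U (m + 1) := by
  ext F
  constructor
  · rintro ⟨⟨hF, h0, x, ⟨-, hz, hs⟩, hx⟩, -, -, y, ⟨-, hz', hs'⟩, hy⟩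
    refine ⟨hF, h0, (1 / 2 : ℝ) • x + (1 / 2 : ℝ) • y, convex_relCone _ _ hx hy (by norm_num)
      (by norm_num) (by norm_num), fun hmid => ?_, fun j hj => ?_⟩
    · have hcar := carrier_subset_of_mem_relCone hF.1 (S.down_closed F hF.1 F₀ h0) h0 subset_rfl
        (convex_relCone _ _ hx hy (by norm_num : (0 : ℝ) ≤ 1 / 2) (by norm_num : (0 : ℝ) ≤ 1 / 2)
        (by norm_num)) hmid
      have hx0 : x ∈ S.relCone F₀ F₀ := by
        refine mem_relCone_of_carrier_subset h0 (S.down_closed F hF.1 F₀ h0) hx fun v hv => ?_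
        by_contra hv0
        rw [mem_carrier_iff hv0] at hv
        refine hv0 (hcar ((mem_carrier_iff hv0).2 ⟨hv.1, ?_⟩))
        rw [map_add, map_smul, map_smul, smul_eq_mul, smul_eq_mul]
        have := hy.1 v (Finset.mem_sdiff.2 ⟨hv.1, hv0⟩)
        linarith [hv.2]
      rw [hflag.apply_relCone_self hx0] at hs
      norm_num at hs
    · rw [map_add, map_smul, map_smul]
      rcases Nat.lt_succ_iff_lt_or_eq.1 hj with hj | rfl
      · simp [hz j hj, hz' j hj]
      · rw [hs, hs']
        norm_num
  · rintro ⟨hF, h0, x, hx, hx0, hz⟩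
    have hz1 : ∀ j < m, h j x = 0 := fun j hj => hz j (by omega)
    have hz2 : h m x = 0 := hz m (by omega)
    obtain ⟨x', hx', hz', hs'⟩ := hflag.exists_perturbation hF.1 h0 hx hx0 hz1 (s := 1)
      (by norm_num) (by simp [hz2])
    obtain ⟨y', hy', hw', ht'⟩ := hflag.exists_perturbation hF.1 h0 hx hx0 hz1 (s := -1)
      (by norm_num) (by simp [hz2])
    exact ⟨⟨hF, h0, x', ⟨mem_suppSubmodule_of_mem_relCone hF.2 hx', hz', hs'⟩, hx'⟩,
      ⟨hF, h0, y', ⟨mem_suppSubmodule_of_mem_relCone hF.2 hy', hw', ht'⟩, hy'⟩⟩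

theorem IsGenericFlag.flagSlice_eq_empty (hflag : IsGenericFlag S F₀ h) (U : Finset (Fin n))
    {m : ℕ} (hm : U.card ≤ F₀.card + m) : flagSlice S F₀ h U m = ∅ := by
  refine Set.eq_empty_iff_forall_notMem.2 ?_
  rintro F ⟨hF, h0, x, hx, hx0, hz⟩
  refine hx0 (hflag.mem_relCone_self hF.1 h0 hx fun j hj => hz j ?_)
  have h1 := (S.restrict U).card_le F hF
  have h2 := Finset.card_sdiff_add_card_eq_card h0
  have h3 : (S.restrict U).N = U.card := rfl
  omega

theorem flagSlice_zero {U : Finset (Fin n)} :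
    flagSlice S F₀ h U 0 = (S.restrict U).star F₀ \ {F₀} := by
  ext F
  constructor
  · rintro ⟨hF, h0, x, hx, hx0, -⟩
    refine ⟨⟨hF, h0⟩, ?_⟩
    rintro rfl
    exact hx0 hx
  · rintro ⟨⟨hF, h0⟩, hne⟩
    have hlt : F₀ ⊂ F := lt_of_le_of_ne h0 fun e => hne e.symm
    obtain ⟨v, hv, hv0⟩ := Finset.exists_of_ssubset hlt
    have hF₀ := S.down_closed F hF.1 F₀ h0
    have hv1 : v = ∑ w ∈ {v}, (fun _ => (1 : ℝ)) w • w := by simp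
    have hvF : v ∈ S.relCone F₀ F := by
      rw [hv1]
      exact mem_relCone_sum hF.1 (Finset.singleton_subset_iff.2 hv) fun _ _ => zero_le_one
    refine ⟨hF, h0, v, hvF, fun hmem => ?_, fun j hj => by omega⟩
    have := carrier_subset_of_mem_relCone hF.1 hF₀ h0 subset_rfl hvF hmem
    refine hv0 (this ((mem_carrier_iff hv0).2 ⟨hv, ?_⟩))
    rw [coord_apply hF.1 hv hv]
    simp

variable {k : Type*} [Field k] [CharP k 2]

theorem acyc_star_of_forall {U : Finset (Fin n)} (h₀ : F₀ ∈ (S.restrict U).faces)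
    (hU : suppSet F₀ = U)
    (ih : ∀ F₁ ∈ (S.restrict U).faces, F₀ ⊂ F₁ → suppSet F₁ = U →
      (S.restrict U).Acyc k ((S.restrict U).star F₁)) :
    (S.restrict U).Acyc k ((S.restrict U).star F₀) := by
  have hle : F₀.card ≤ U.card := (S.restrict U).card_le F₀ h₀
  rcases eq_or_lt_of_le hle with heq | hlt
  · exact acyc_star_of_card h₀ heq
  obtain ⟨h, hflag⟩ := exists_isGenericFlag S F₀
  have hcov : ∀ x ∈ suppSubmodule ℝ U, ∃ G ∈ (S.restrict U).faces, F₀ ⊆ G ∧ G.card = U.card ∧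
      x ∈ S.relCone F₀ G := fun x hx => exists_mem_relCone h₀ hx (by simp [hU])
  obtain ⟨G, hG, h₀G, hGc, -⟩ := hcov 0 (Submodule.zero_mem _)
  have hGsd := Finset.card_sdiff_add_card_eq_card h₀G
  have hN : (S.restrict U).N = U.card := rfl
  have hac : ∀ m s, F₀.card + m < U.card → s ≠ 0 →
      (S.restrict U).Acyc k (S.meeting U F₀ (flagSection h U m s)) := by
    intro m s hm hs
    refine acyc_meeting ih ?_ (convex_flagSection _ _ _) (fun x hx => hx.1)
      (fun x hx => hcov x hx.1) (fun x hx hx0 => hs ?_) fun x _ F hF h0 _ =>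
        le_antisymm hF.2 (hU ▸ suppSet_mono h0)
    · obtain ⟨lam, hlam⟩ := (hflag.2 G hG.1 h₀G).2 fun j => if j = m then s else 0
      have e : ∀ j ≤ m, h j (∑ v ∈ G, lam v • v) = if j = m then s else 0 := fun j hj => by
        rw [hflag.apply_sum, hlam j (by omega)]
      exact ⟨∑ v ∈ G, lam v • v, Submodule.sum_mem _ fun v hv => Submodule.smul_mem _ _
        (mem_suppSubmodule_of_mem hG.2 hv), fun j hj => by rw [e j hj.le, if_neg hj.ne],
        by rw [e m le_rfl, if_pos rfl]⟩
    · rw [← hx.2.2, hflag.apply_relCone_self hx0]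
  have hdep : ∀ j m, F₀.card + m + 1 + j = U.card →
      (S.restrict U).DepCycles k (flagSlice S F₀ h U m) := by
    intro j
    induction j with
    | zero =>
      intro m hm
      rw [hflag.flagSlice_eq_union]
      refine DepCycles.union (upClosed_meeting _ _ _) (upClosed_meeting _ _ _)
        (hac m 1 (by omega) one_ne_zero) (hac m (-1) (by omega) (by norm_num)) (Or.inl ?_)
      rw [hflag.flagSlice_succ, hflag.flagSlice_eq_empty U (by omega)]
    | succ j ihj =>
      intro m hm
      rw [hflag.flagSlice_eq_union]
      refine DepCycles.union (upClosed_meeting _ _ _) (upClosed_meeting _ _ _)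
        (hac m 1 (by omega) one_ne_zero) (hac m (-1) (by omega) (by norm_num)) (Or.inr ?_)
      rw [hflag.flagSlice_succ]
      refine ⟨?_, ihj (m + 1) (by omega)⟩
      obtain ⟨⟨H, hH, hHc⟩, -⟩ := hac (m + 1) 1 (by omega) one_ne_zero
      exact ⟨H, by rw [hflag.flagSlice_eq_union]; exact Or.inl hH, hHc⟩
  have hD := hdep (U.card - F₀.card - 1) 0 (by omega)
  rw [flagSlice_zero] at hD
  obtain ⟨v₀, hv₀, hv₀'⟩ := Finset.exists_of_ssubset
    (lt_of_le_of_ne h₀G (by rintro rfl; omega) : F₀ ⊂ G)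
  refine acyc_star_of_depCycles hD hv₀'
    ((S.restrict U).down G hG _ (Finset.insert_subset hv₀ h₀G)) ⟨G, ⟨hG, h₀G⟩, hGc⟩ fun F hF => ?_
  by_cases hFF : F = F₀
  · subst hFF
    by_cases h1 : F.card + 1 = U.card
    · have hcards : ∀ s, ∀ H ∈ S.meeting U F (flagSection h U 0 s), s ≠ 0 →
          H.card = (S.restrict U).N := by
        rintro s H ⟨hH, h0, x, ⟨-, -, hxs⟩, hxH⟩ hs
        refine le_antisymm ((S.restrict U).card_le H hH) ?_
        have : F ⊂ H := lt_of_le_of_ne h0 (by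
          rintro rfl
          exact hs (by rw [← hxs, hflag.apply_relCone_self hxH]))
        have := Finset.card_lt_card this
        omega
      obtain ⟨G₁, hG₁, e₁⟩ := (hac 0 1 (by omega) one_ne_zero).eq_singleton
        (upClosed_meeting _ _ _) fun H hH => hcards _ H hH one_ne_zero
      obtain ⟨G₂, hG₂, e₂⟩ := (hac 0 (-1) (by omega) (by norm_num)).eq_singleton
        (upClosed_meeting _ _ _) fun H hH => hcards _ H hH (by norm_num)
      refine bdry_top_eq_zero_of_two (G₁ := G₁) (G₂ := G₂) ?_ h1 ?_
      · rintro rfl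
        have : G₁ ∈ flagSlice S F h U (0 + 1) := by
          rw [← hflag.flagSlice_succ]
          exact ⟨hG₁, hG₂⟩
        rw [hflag.flagSlice_eq_empty U (by omega)] at this
        exact this
      · rw [← flagSlice_zero, hflag.flagSlice_eq_union, e₁, e₂]
    · refine Finset.sum_eq_zero fun v hv => ?_
      unfold top
      rw [if_neg]
      rintro ⟨-, hc⟩
      rw [Finset.card_insert_of_notMem (Finset.mem_sdiff.1 hv).2] at hc
      omega
  · exact (ih F hF.1 (lt_of_le_of_ne hF.2 fun e => hFF e.symm)
      (le_antisymm hF.1.2 (hU ▸ suppSet_mono hF.2))).2.1 F ⟨hF.1, subset_rfl⟩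

theorem acyc_star {U : Finset (Fin n)} (h₀ : F₀ ∈ (S.restrict U).faces) (hU : suppSet F₀ = U) :
    (S.restrict U).Acyc k ((S.restrict U).star F₀) := by
  induction hm : U.card - F₀.card using Nat.strong_induction_on generalizing F₀ with
  | _ m ih =>
    refine acyc_star_of_forall h₀ hU fun F₁ hF₁ hlt hU₁ => ih (U.card - F₁.card) ?_ hF₁ hU₁ rfl
    have h1 := Finset.card_lt_card hlt
    have h2 : F₁.card ≤ U.card := (S.restrict U).card_le F₁ hF₁
    omega

/-- The faces containing `F₀` with support exactly `U` form an acyclic set. -/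
theorem acyc_interior {U : Finset (Fin n)} (h₀ : F₀ ∈ (S.restrict U).faces) :
    (S.restrict U).Acyc k {F | F ∈ (S.restrict U).faces ∧ F₀ ⊆ F ∧ suppSet F = U} := by
  by_cases hU : suppSet F₀ = U
  · have : {F | F ∈ (S.restrict U).faces ∧ F₀ ⊆ F ∧ suppSet F = U} = (S.restrict U).star F₀ := by
      ext F
      exact ⟨fun h => ⟨h.1, h.2.1⟩, fun h => ⟨h.1, h.2,
        le_antisymm h.1.2 (hU ▸ suppSet_mono h.2)⟩⟩
    rw [this]
    exact acyc_star h₀ hU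
  have hnn : ∀ F ∈ S.faces, ∀ v ∈ F, ∀ i, 0 ≤ v i := fun F hF v hv =>
    S.verts_nonneg v (S.faces_subset_verts F hF hv)
  set Q : Set (Fin n → ℝ) := {x | x ∈ suppSubmodule ℝ U ∧ ∀ i ∈ U \ suppSet F₀, 1 ≤ x i} with hQ
  have hint : ∀ x ∈ Q, ∀ F ∈ (S.restrict U).faces, F₀ ⊆ F → x ∈ S.relCone F₀ F →
      suppSet F = U := by
    intro x hx F hF h0 hxF
    refine le_antisymm hF.2 fun i hi => ?_
    by_cases hi0 : i ∈ suppSet F₀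
    · exact suppSet_mono h0 hi0
    · have h1 := hx.2 i (Finset.mem_sdiff.2 ⟨hi, hi0⟩)
      by_contra hiF
      have h2 : x i = 0 := by
        rw [← hxF.2, Finset.sum_apply]
        refine Finset.sum_eq_zero fun v hv => ?_
        have : v i = 0 := by
          by_contra hne
          exact hiF (mem_suppSet.2 ⟨v, hv, hne⟩)
        simp [this]
      linarith
  have heq : {F | F ∈ (S.restrict U).faces ∧ F₀ ⊆ F ∧ suppSet F = U} = S.meeting U F₀ Q := by
    ext F
    constructor
    · rintro ⟨hF, h0, hFU⟩
      refine ⟨hF, h0, ?_⟩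
      have hpos : ∀ i ∈ U \ suppSet F₀, 0 < ∑ v ∈ F \ F₀, v i := by
        intro i hi
        rw [Finset.mem_sdiff, ← hFU, mem_suppSet] at hi
        obtain ⟨⟨v, hv, hvi⟩, hi0⟩ := hi
        refine Finset.sum_pos' (fun w hw => hnn F hF.1 w (Finset.mem_sdiff.1 hw).1 i) ⟨v,
          Finset.mem_sdiff.2 ⟨hv, fun h => hi0 (mem_suppSet.2 ⟨v, h, hvi⟩)⟩,
          lt_of_le_of_ne (hnn F hF.1 v hv i) (Ne.symm hvi)⟩
      obtain ⟨δ, hδ, hδ'⟩ := exists_pos_perturbation (U \ suppSet F₀)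
        (fun i => ∑ v ∈ F \ F₀, v i) (fun _ => -1) hpos
      have hmem : ∑ v ∈ F \ F₀, (fun _ => δ⁻¹) v • v ∈ S.relCone F₀ F :=
        mem_relCone_sum hF.1 Finset.sdiff_subset fun _ _ => (inv_pos.2 hδ).le
      refine ⟨_, ⟨mem_suppSubmodule_of_mem_relCone hF.2 hmem, fun i hi => ?_⟩, hmem⟩
      have := hδ' i hi
      rw [Finset.sum_apply]
      simp only [Pi.smul_apply, smul_eq_mul]
      rw [← Finset.mul_sum, ← div_eq_inv_mul, le_div_iff₀ hδ]
      linarith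
    · rintro ⟨hF, h0, x, hx, hxF⟩
      exact ⟨hF, h0, hint x hx F hF h0 hxF⟩
  rw [heq]
  refine acyc_meeting (fun F₁ hF₁ _ hU₁ => acyc_star hF₁ hU₁) ?_ ?_ (fun x hx => hx.1)
    (fun x hx => exists_mem_relCone h₀ hx.1 fun i hi => zero_le_one.trans (hx.2 i hi))
    (fun x hx hx0 => hU (hint x hx F₀ h₀ subset_rfl hx0)) hint
  · refine ⟨fun i => if i ∈ U then 1 else 0, fun i hi => by simp [hi], fun i hi => ?_⟩
    simp [(Finset.mem_sdiff.1 hi).1]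
  · rintro x ⟨hxU, hx⟩ y ⟨hyU, hy⟩ a b ha hb hab
    refine ⟨Submodule.add_mem _ (Submodule.smul_mem _ _ hxU) (Submodule.smul_mem _ _ hyU),
      fun i hi => ?_⟩
    have h1 := hx i hi
    have h2 := hy i hi
    simp only [Pi.add_apply, Pi.smul_apply, smul_eq_mul]
    nlinarith

end flag

end SimplicialFan

section WeaklyRegular

variable {Z : Type*} [AddCommGroup Z] {T : ℕ → Z →+ Z}

/-- `x` is a combination of the images of the first `m` operators with coefficients in `A`. -/
def CombMem (T : ℕ → Z →+ Z) (A : AddSubgroup Z) (m : ℕ) (x : Z) : Prop :=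
  ∃ c : ℕ → Z, (∀ i, c i ∈ A) ∧ x = ∑ i ∈ Finset.range m, T i (c i)

/-- The first `s` operators form a weakly regular sequence on `A`. -/
def IsWeaklyRegularOn (T : ℕ → Z →+ Z) (A : AddSubgroup Z) (s : ℕ) : Prop :=
  ∀ m < s, ∀ x ∈ A, CombMem T A m (T m x) → CombMem T A m x

/-- Elements of the kernel of `d` which are combinations over `B` are combinations over the kernel,
when the image of `d` is weakly regular. -/
theorem CombMem.of_ker (hcomm : ∀ i j x, T i (T j x) = T j (T i x)) {d : Z →+ Z}
    (hd : ∀ i x, d (T i x) = T i (d x)) {B : AddSubgroup Z} (hB : ∀ i, ∀ x ∈ B, T i x ∈ B) {s : ℕ}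
    (hC : IsWeaklyRegularOn T (B.map d) s) {m : ℕ} (hm : m ≤ s) {x : Z} (hx : d x = 0)
    (h : CombMem T B m x) : CombMem T (B ⊓ d.ker) m x := by
  induction m generalizing x with
  | zero =>
    obtain ⟨c, -, rfl⟩ := h
    exact ⟨fun _ => 0, fun _ => zero_mem _, rfl⟩
  | succ m ih =>
    obtain ⟨b, hb, rfl⟩ := h
    rw [Finset.sum_range_succ, map_add, hd, map_sum] at hx
    obtain ⟨c, hc, e⟩ := hC m (by omega) (d (b m)) (AddSubgroup.mem_map_of_mem _ (hb m))
      ⟨fun i => -d (b i), fun i => neg_mem (AddSubgroup.mem_map_of_mem _ (hb i)), by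
        rw [eq_neg_of_add_eq_zero_right hx, ← Finset.sum_neg_distrib]
        exact Finset.sum_congr rfl fun i _ => by rw [hd, map_neg]⟩
    choose b' hb' e' using hc
    set a := b m - ∑ i ∈ Finset.range m, T i (b' i) with ha
    have haB : a ∈ B := sub_mem (hb m) (sum_mem fun i _ => hB i _ (hb' i))
    have had : d a = 0 := by
      rw [ha, map_sub, e, map_sum, sub_eq_zero]
      exact Finset.sum_congr rfl fun i _ => by rw [hd, e']
    have hsum : ∑ i ∈ Finset.range m, T i (b i) + T m (b m) =
        ∑ i ∈ Finset.range m, T i (b i + T m (b' i)) + T m a := by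
      simp only [map_add, Finset.sum_add_distrib, ha, map_sub, map_sum]
      rw [Finset.sum_congr rfl fun i _ => hcomm i m (b' i)]
      abel
    obtain ⟨c', hc', e''⟩ := ih (by omega) (x := ∑ i ∈ Finset.range m, T i (b i + T m (b' i))) (by
      have h1 := congrArg d hsum
      rw [map_add, map_add, hd m a, had, map_zero, add_zero, hd m, map_sum, hx] at h1
      exact h1.symm)
      ⟨fun i => b i + T m (b' i), fun i => add_mem (hb i) (hB m _ (hb' i)), rfl⟩
    refine ⟨fun i => if i = m then a else c' i, fun i => ?_, ?_⟩
    · dsimp only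
      split_ifs
      exacts [⟨haB, had⟩, hc' i]
    · rw [Finset.sum_range_succ, hsum, Finset.sum_range_succ, e'']
      simp only [if_true]
      congr 1
      refine Finset.sum_congr rfl fun i hi => ?_
      rw [if_neg (Finset.mem_range.1 hi).ne]

theorem IsWeaklyRegularOn.inf_ker (hcomm : ∀ i j x, T i (T j x) = T j (T i x)) {d : Z →+ Z}
    (hd : ∀ i x, d (T i x) = T i (d x)) {B : AddSubgroup Z} (hB : ∀ i, ∀ x ∈ B, T i x ∈ B) {s : ℕ}
    (hC : IsWeaklyRegularOn T (B.map d) s) (hreg : IsWeaklyRegularOn T B (s + 1)) :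
    IsWeaklyRegularOn T (B ⊓ d.ker) (s + 1) := by
  rintro m hm x hx ⟨c, hc, e⟩
  exact CombMem.of_ker hcomm hd hB hC (by omega) hx.2 (hreg m hm x hx.1 ⟨c, fun i => (hc i).1, e⟩)

end WeaklyRegular

section restrictVars

open MvPolynomial

variable {V k : Type*} [DecidableEq V] [Field k]

/-- The substitution killing the variables outside `F`. -/
def restrictVars (k : Type*) [Field k] (F : Finset V) : MvPolynomial V k →ₐ[k] MvPolynomial V k :=
  aeval fun v => if v ∈ F then X v else 0

theorem restrictVars_monomial (F : Finset V) (μ : V →₀ ℕ) (c : k) :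
    restrictVars k F (monomial μ c) = if μ.support ⊆ F then monomial μ c else 0 := by
  rw [restrictVars, aeval_monomial]
  split_ifs with h
  · rw [monomial_eq]
    congr 1
    exact Finset.prod_congr rfl fun v hv => by simp only [if_pos (h hv)]
  · obtain ⟨v, hv, hvF⟩ := Finset.not_subset.1 h
    rw [Finsupp.prod, Finset.prod_eq_zero hv, mul_zero]
    rw [if_neg hvF, zero_pow (Finsupp.mem_support_iff.1 hv)]

theorem coeff_restrictVars (F : Finset V) (p : MvPolynomial V k) (μ : V →₀ ℕ) :
    coeff μ (restrictVars k F p) = if μ.support ⊆ F then coeff μ p else 0 := by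
  induction p using MvPolynomial.induction_on' with
  | monomial ν c =>
    rw [restrictVars_monomial, coeff_monomial]
    by_cases h : ν = μ
    · subst h
      by_cases h' : ν.support ⊆ F <;> simp [h']
    · split_ifs <;> simp [coeff_monomial, h]
  | add p q hp hq =>
    rw [map_add, coeff_add, coeff_add, hp, hq]
    split_ifs <;> simp

theorem restrictVars_restrictVars {F G : Finset V} (h : F ⊆ G) (p : MvPolynomial V k) :
    restrictVars k F (restrictVars k G p) = restrictVars k F p := by
  ext μ
  simp only [coeff_restrictVars]
  split_ifs with h1 h2
  · rfl
  · exact absurd (h1.trans h) h2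
  · rfl

theorem restrictVars_X (F : Finset V) (v : V) :
    restrictVars k F (X v) = if v ∈ F then X v else 0 := by
  simp [restrictVars]

/-- The ideal of polynomials vanishing upon restriction to each member of `W`. -/
def faceIdeal (k : Type*) [Field k] (W : Set (Finset V)) : Ideal (MvPolynomial V k) where
  carrier := {p | ∀ F ∈ W, restrictVars k F p = 0}
  add_mem' := fun hp hq F hF => by rw [map_add, hp F hF, hq F hF, add_zero]
  zero_mem' := fun F _ => map_zero _
  smul_mem' := fun c p hp F hF => by rw [smul_eq_mul, map_mul, hp F hF, mul_zero]

theorem mem_faceIdeal {W : Set (Finset V)} {p : MvPolynomial V k} :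
    p ∈ faceIdeal k W ↔ ∀ F ∈ W, restrictVars k F p = 0 := Iff.rfl

theorem mem_faceIdeal_iff_coeff {W : Set (Finset V)} {p : MvPolynomial V k} :
    p ∈ faceIdeal k W ↔ ∀ F ∈ W, ∀ μ : V →₀ ℕ, μ.support ⊆ F → coeff μ p = 0 := by
  rw [mem_faceIdeal]
  refine forall₂_congr fun F _ => ⟨fun h μ hμ => ?_, fun h => ?_⟩
  · have := congrArg (coeff μ) h
    rwa [coeff_restrictVars, if_pos hμ, coeff_zero] at this
  · ext μ
    rw [coeff_restrictVars, coeff_zero]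
    split_ifs with h1
    exacts [h μ h1, rfl]

/-- The linear form with the given coefficients. -/
def linForm (X₀ : Finset V) (r : V → k) : MvPolynomial V k := ∑ v ∈ X₀, C (r v) * X v

theorem restrictVars_linForm {X₀ F : Finset V} (h : F ⊆ X₀) (r : V → k) :
    restrictVars k F (linForm X₀ r) = linForm F r := by
  rw [linForm, map_sum, linForm, ← Finset.sum_subset h]
  · refine Finset.sum_congr rfl fun v hv => ?_
    rw [map_mul, restrictVars_X, if_pos hv, ← algebraMap_eq, AlgHom.commutes]
  · intro v _ hv
    rw [map_mul, restrictVars_X, if_neg hv, mul_zero]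

/-- `M` is inverse to the square matrix formed by the first `|A|` of the `r j` restricted to
`A`. -/
structure IsSquareInverse (A : Finset V) (r : ℕ → V → k) (M : V → ℕ → k) : Prop where
  right : ∀ i < A.card, ∀ j < A.card, ∑ v ∈ A, M v i * r j v = if j = i then 1 else 0
  left : ∀ v ∈ A, ∀ w ∈ A, ∑ j ∈ Finset.range A.card, M v j * r j w = if v = w then 1 else 0

theorem exists_isSquareInverse {A : Finset V} {r : ℕ → V → k}
    (h₁ : ∀ lam : V → k, (∀ j < A.card, ∑ v ∈ A, lam v * r j v = 0) → ∀ v ∈ A, lam v = 0)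
    (h₂ : ∀ b : ℕ → k, ∃ lam : V → k, ∀ j < A.card, ∑ v ∈ A, lam v * r j v = b j) :
    ∃ M, IsSquareInverse A r M := by
  choose lam hlam using fun i : ℕ => h₂ fun j => if j = i then 1 else 0
  refine ⟨fun v i => lam i v, fun i _ j hj => hlam i j hj, fun v hv w hw => ?_⟩
  have := h₁ (fun v => ∑ i ∈ Finset.range A.card, lam i v * r i w - if v = w then 1 else 0)
    (fun j hj => ?_) v hv
  · exact sub_eq_zero.1 this
  · simp only [sub_mul, Finset.sum_sub_distrib, Finset.sum_mul, ite_mul, one_mul, zero_mul]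
    rw [Finset.sum_comm, Finset.sum_ite_eq' A w, if_pos hw]
    have : ∀ i ∈ Finset.range A.card, ∑ v ∈ A, lam i v * r i w * r j v =
        if j = i then r i w else 0 := by
      intro i _
      have := hlam i j hj
      calc _ = (∑ v ∈ A, lam i v * r j v) * r i w := by
            rw [Finset.sum_mul]
            exact Finset.sum_congr rfl fun v _ => by ring
        _ = _ := by rw [this]; simp
    rw [Finset.sum_congr rfl this, Finset.sum_ite_eq, if_pos (Finset.mem_range.2 hj), sub_self]

namespace IsSquareInverse

variable {A : Finset V} {r : ℕ → V → k} {M : V → ℕ → k}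

/-- The change of variables expressing the variables in `A` through the linear forms. -/
def toCoords (A : Finset V) (M : V → ℕ → k) : MvPolynomial V k →ₐ[k] MvPolynomial ℕ k :=
  aeval fun v => if v ∈ A then ∑ j ∈ Finset.range A.card, C (M v j) * X j else 0

theorem toCoords_linForm (h : IsSquareInverse A r M) {j : ℕ} (hj : j < A.card) :
    toCoords A M (linForm A (r j)) = X j := by
  have e : ∀ v ∈ A, toCoords A M (C (r j v) * X v) =
      ∑ i ∈ Finset.range A.card, C (M v i * r j v) * X i := by
    intro v hv
    rw [map_mul, ← algebraMap_eq, AlgHom.commutes, toCoords, aeval_X, if_pos hv, Finset.mul_sum]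
    refine Finset.sum_congr rfl fun i _ => ?_
    rw [algebraMap_eq, C_mul]
    ring
  rw [linForm, map_sum, Finset.sum_congr rfl e, Finset.sum_comm]
  have e' : ∀ i ∈ Finset.range A.card, ∑ v ∈ A, (C (M v i * r j v) * X i : MvPolynomial ℕ k) =
      if j = i then X i else 0 := by
    intro i hi
    rw [← Finset.sum_mul, ← map_sum, h.right i (Finset.mem_range.1 hi) j hj]
    split_ifs <;> simp
  rw [Finset.sum_congr rfl e', Finset.sum_ite_eq, if_pos (Finset.mem_range.2 hj)]

theorem aeval_toCoords (h : IsSquareInverse A r M) (p : MvPolynomial V k) :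
    aeval (fun j => linForm A (r j)) (toCoords A M p) = restrictVars k A p := by
  have : (aeval (fun j => linForm A (r j))).comp (toCoords A M) = restrictVars k A := by
    refine algHom_ext fun v => ?_
    rw [AlgHom.comp_apply, toCoords, aeval_X, restrictVars_X]
    split_ifs with hv
    · simp only [map_sum, map_mul, aeval_X, linForm, Finset.mul_sum]
      rw [Finset.sum_comm]
      have e' : ∀ w ∈ A, ∑ j ∈ Finset.range A.card, (aeval fun j => ∑ v ∈ A, C (r j v) * X v)
          (C (M v j)) * (C (r j w) * X w : MvPolynomial V k) = if v = w then X w else 0 := by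
        intro w hw
        have := congrArg (fun c : k => (C c * X w : MvPolynomial V k)) (h.left v hv w hw)
        simp only [map_sum, Finset.sum_mul, C_mul] at this
        rw [show (if v = w then X w else 0 : MvPolynomial V k) = C (if v = w then 1 else 0) * X w by
          split_ifs <;> simp, ← this]
        refine Finset.sum_congr rfl fun j _ => ?_
        rw [aeval_C, algebraMap_eq, mul_assoc]
      rw [Finset.sum_congr rfl e', Finset.sum_ite_eq, if_pos hv]
    · simp
  rw [← this]
  rfl

theorem ker_toCoords (h : IsSquareInverse A r M) (p : MvPolynomial V k) :
    toCoords A M p = 0 ↔ restrictVars k A p = 0 := by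
  refine ⟨fun e => by rw [← h.aeval_toCoords, e, map_zero], fun e => ?_⟩
  have : toCoords A M (restrictVars k A p) = toCoords A M p := by
    have : (toCoords A M).comp (restrictVars k A) = toCoords A M := by
      refine algHom_ext fun v => ?_
      rw [AlgHom.comp_apply, restrictVars_X]
      split_ifs with hv
      · rfl
      · rw [map_zero, toCoords, aeval_X, if_neg hv]
    exact DFunLike.congr_fun this p
  rw [← this, e, map_zero]

end IsSquareInverse

theorem exists_sum_of_mem_span_X {f : MvPolynomial ℕ k} {m : ℕ}
    (h : f ∈ Ideal.span (X '' (Finset.range m : Set ℕ) : Set (MvPolynomial ℕ k))) :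
    ∃ d : ℕ → MvPolynomial ℕ k, f = ∑ i ∈ Finset.range m, X i * d i := by
  obtain ⟨d, hd⟩ := Submodule.mem_span_image_finset_iff_exists_fun _ |>.1 h
  refine ⟨fun i => if hi : i ∈ Finset.range m then d ⟨i, hi⟩ else 0, ?_⟩
  rw [← hd, ← Finset.sum_coe_sort (Finset.range m)]
  refine Finset.sum_congr rfl fun i _ => ?_
  simp only [dif_pos i.2, smul_eq_mul]
  exact mul_comm _ _

theorem exists_sum_X_of_X_mul {f : MvPolynomial ℕ k} {m : ℕ} {c : ℕ → MvPolynomial ℕ k}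
    (h : X m * f = ∑ i ∈ Finset.range m, X i * c i) :
    ∃ d : ℕ → MvPolynomial ℕ k, f = ∑ i ∈ Finset.range m, X i * d i := by
  refine exists_sum_of_mem_span_X (mem_ideal_span_X_image.2 fun μ hμ => ?_)
  have hmem : X m * f ∈ Ideal.span (X '' (Finset.range m : Set ℕ) : Set (MvPolynomial ℕ k)) := by
    rw [h]
    exact sum_mem fun i hi => Ideal.mul_mem_right _ _
      (Ideal.subset_span (Set.mem_image_of_mem _ hi))
  obtain ⟨i, hi, hne⟩ := mem_ideal_span_X_image.1 hmem (μ + Finsupp.single m 1) (by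
    rw [mem_support_iff, mul_comm, coeff_mul_X]
    exact mem_support_iff.1 hμ)
  refine ⟨i, hi, ?_⟩
  have : m ≠ i := (Finset.mem_range.1 hi).ne'
  simpa [Finsupp.single_apply, this] using hne

/-- Independent linear forms are weakly regular on the polynomial ring of a face. -/
theorem IsSquareInverse.exists_sum {A : Finset V} {r : ℕ → V → k} {M : V → ℕ → k}
    (h : IsSquareInverse A r M) {m : ℕ} (hm : m < A.card) {f : MvPolynomial V k}
    {c : ℕ → MvPolynomial V k}
    (e : linForm A (r m) * f = ∑ i ∈ Finset.range m, linForm A (r i) * c i) :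
    ∃ d : ℕ → MvPolynomial V k,
      restrictVars k A f = ∑ i ∈ Finset.range m, linForm A (r i) * d i := by
  have e1 := congrArg (toCoords A M) e
  rw [map_mul, h.toCoords_linForm hm, map_sum, Finset.sum_congr rfl (g := fun i =>
    X i * toCoords A M (c i)) fun i hi => by
      rw [map_mul, h.toCoords_linForm ((Finset.mem_range.1 hi).trans hm)]] at e1
  obtain ⟨d, hd⟩ := exists_sum_X_of_X_mul e1
  refine ⟨fun i => aeval (fun j => linForm A (r j)) (d i), ?_⟩
  rw [← h.aeval_toCoords, hd, map_sum]
  exact Finset.sum_congr rfl fun i _ => by rw [map_mul, aeval_X]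

end restrictVars

section WeaklyRegularPolynomials

open MvPolynomial

section WeaklyRegularModulo

variable {V k : Type*} [Field k]

/-- The ideal generated by the first `m` of a sequence of linear forms. -/
def linIdeal (X₀ : Finset V) (r : ℕ → V → k) (m : ℕ) : Ideal (MvPolynomial V k) :=
  Ideal.span ((fun j => linForm X₀ (r j)) '' (Finset.range m : Set ℕ))

/-- The first `N` linear forms are weakly regular modulo `J`. -/
def IsWeaklyRegularMod (J : Ideal (MvPolynomial V k)) (X₀ : Finset V) (r : ℕ → V → k) (N : ℕ) :
    Prop :=
  ∀ m < N, ∀ p, linForm X₀ (r m) * p ∈ J ⊔ linIdeal X₀ r m → p ∈ J ⊔ linIdeal X₀ r m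

theorem mem_sup_linIdeal {J : Ideal (MvPolynomial V k)} {X₀ : Finset V} {r : ℕ → V → k} {m : ℕ}
    {p : MvPolynomial V k} : p ∈ J ⊔ linIdeal X₀ r m ↔ ∃ j ∈ J, ∃ c : ℕ → MvPolynomial V k,
      p = j + ∑ i ∈ Finset.range m, linForm X₀ (r i) * c i := by
  constructor
  · intro h
    obtain ⟨j, hj, q, hq, rfl⟩ := Submodule.mem_sup.1 h
    obtain ⟨d, hd⟩ := Submodule.mem_span_image_finset_iff_exists_fun _ |>.1 hq
    refine ⟨j, hj, fun i => if hi : i ∈ Finset.range m then d ⟨i, hi⟩ else 0, ?_⟩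
    rw [← hd, ← Finset.sum_coe_sort (Finset.range m)]
    congr 1
    refine Finset.sum_congr rfl fun i _ => ?_
    simp only [dif_pos i.2, smul_eq_mul]
    exact mul_comm _ _
  · rintro ⟨j, hj, c, rfl⟩
    exact add_mem (Ideal.mem_sup_left hj) (sum_mem fun i hi => Ideal.mem_sup_right
      (Ideal.mul_mem_right _ _ (Ideal.subset_span (Set.mem_image_of_mem _ hi))))

end WeaklyRegularModulo

namespace BoundedComplex

variable {V k : Type*} [DecidableEq V] [Field k] (K : BoundedComplex V) (W : Set (Finset V))

/-- The polynomial chains concentrated on the `s`-element members of `W`. -/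
def polyChains (k : Type*) [Field k] (s : ℕ) : AddSubgroup (Finset V → MvPolynomial V k) where
  carrier := {z | ∀ F, restrictVars k F (z F) = z F ∧ (¬(F ∈ W ∧ F.card = s) → z F = 0)}
  add_mem' := fun {y z} hy hz F => ⟨by rw [Pi.add_apply, map_add, (hy F).1, (hz F).1],
    fun h => by rw [Pi.add_apply, (hy F).2 h, (hz F).2 h, add_zero]⟩
  zero_mem' := fun F => ⟨map_zero _, fun _ => rfl⟩
  neg_mem' := fun {z} hz F => ⟨by rw [Pi.neg_apply, map_neg, (hz F).1],
    fun h => by rw [Pi.neg_apply, (hz F).2 h, neg_zero]⟩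

/-- The boundary of polynomial chains. -/
def polyBdry (k : Type*) [Field k] :
    (Finset V → MvPolynomial V k) →+ (Finset V → MvPolynomial V k) where
  toFun := fun z F => if F ∈ W then ∑ v ∈ K.X \ F, restrictVars k F (z (insert v F)) else 0
  map_zero' := by
    funext F
    simp
  map_add' := fun y z => by
    funext F
    simp only [Pi.add_apply, map_add, Finset.sum_add_distrib]
    split_ifs <;> simp

/-- Multiplication of polynomial chains by the restrictions of linear forms. -/
def polyMul (r : ℕ → V → k) (i : ℕ) :
    (Finset V → MvPolynomial V k) →+ (Finset V → MvPolynomial V k) where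
  toFun := fun z F => linForm F (r i) * z F
  map_zero' := by
    funext F
    simp
  map_add' := fun y z => by
    funext F
    simp [mul_add]

variable {K W}

theorem polyBdry_apply (z : Finset V → MvPolynomial V k) (F : Finset V) :
    K.polyBdry W k z F =
      if F ∈ W then ∑ v ∈ K.X \ F, restrictVars k F (z (insert v F)) else 0 := rfl

theorem coeff_polyBdry (z : Finset V → MvPolynomial V k) (F : Finset V) (μ : V →₀ ℕ) :
    coeff μ (K.polyBdry W k z F) =
      if F ∈ W ∧ μ.support ⊆ F then K.bdry (fun G => coeff μ (z G)) F else 0 := by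
  rw [polyBdry_apply]
  by_cases hF : F ∈ W
  · simp only [hF, if_true, true_and, coeff_sum, coeff_restrictVars, bdry]
    split_ifs <;> simp
  · simp [hF]

theorem polyBdry_polyMul (r : ℕ → V → k) (i : ℕ) (z : Finset V → MvPolynomial V k) :
    K.polyBdry W k (polyMul r i z) = polyMul r i (K.polyBdry W k z) := by
  funext F
  change _ = linForm F (r i) * K.polyBdry W k z F
  rw [polyBdry_apply, polyBdry_apply]
  split_ifs
  · rw [Finset.mul_sum]
    refine Finset.sum_congr rfl fun v _ => ?_
    change restrictVars k F (linForm _ (r i) * z _) = _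
    rw [map_mul, restrictVars_linForm (Finset.subset_insert v F)]
  · simp

theorem restrictVars_linForm_self (F : Finset V) (r : V → k) :
    restrictVars k F (linForm F r) = linForm F r := restrictVars_linForm subset_rfl r

theorem polyMul_mem (r : ℕ → V → k) (i s : ℕ) {z : Finset V → MvPolynomial V k}
    (hz : z ∈ polyChains W k s) : polyMul r i z ∈ polyChains W k s := fun F => by
  change restrictVars k F (linForm F (r i) * z F) = linForm F (r i) * z F ∧
    (_ → linForm F (r i) * z F = 0)
  rw [map_mul, (hz F).1, restrictVars_linForm_self]
  exact ⟨rfl, fun h => by rw [(hz F).2 h, mul_zero]⟩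

theorem coeff_eq_zero_of_mem_polyChains {s : ℕ} {z : Finset V → MvPolynomial V k}
    (hz : z ∈ polyChains W k s) {F : Finset V} {μ : V →₀ ℕ}
    (h : ¬(F ∈ W ∧ F.card = s ∧ μ.support ⊆ F)) : coeff μ (z F) = 0 := by
  by_cases hF : F ∈ W ∧ F.card = s
  · rw [← (hz F).1, coeff_restrictVars, if_neg fun h' => h ⟨hF.1, hF.2, h'⟩]
  · rw [(hz F).2 hF, coeff_zero]

theorem isChain_coeff (hW : K.UpClosed W) {s : ℕ} {z : Finset V → MvPolynomial V k}
    (hz : z ∈ polyChains W k s) (μ : V →₀ ℕ) : K.IsChain fun F => coeff μ (z F) := fun _ hF =>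
  coeff_eq_zero_of_mem_polyChains hz fun h => hF (hW.1 h.1)

theorem polyBdry_mem {s : ℕ} {z : Finset V → MvPolynomial V k}
    (hz : z ∈ polyChains W k (s + 1)) : K.polyBdry W k z ∈ polyChains W k s := by
  intro F
  constructor
  · ext μ
    rw [coeff_restrictVars, coeff_polyBdry]
    by_cases h : μ.support ⊆ F <;> simp [h]
  · intro h
    rw [polyBdry_apply]
    split_ifs with hF
    · refine Finset.sum_eq_zero fun v hv => ?_
      rw [(hz _).2, map_zero]
      rintro ⟨-, hc⟩
      rw [Finset.card_insert_of_notMem (Finset.mem_sdiff.1 hv).2] at hc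
      exact h ⟨hF, by omega⟩
    · rfl

theorem polyBdry_polyBdry [CharP k 2] {s : ℕ} (hW : K.UpClosed W)
    {z : Finset V → MvPolynomial V k} (hz : z ∈ polyChains W k s) :
    K.polyBdry W k (K.polyBdry W k z) = 0 := by
  funext F
  ext μ
  rw [coeff_polyBdry, Pi.zero_apply, coeff_zero]
  split_ifs with h
  · rw [← bdry_bdry (K := K) (fun G => coeff μ (z G)) F]
    refine Finset.sum_congr rfl fun v _ => ?_
    dsimp only
    rw [coeff_polyBdry]
    have hsub := h.2.trans (Finset.subset_insert v F)
    by_cases hv : insert v F ∈ K.faces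
    · rw [if_pos ⟨hW.2 F h.1 _ hv (Finset.subset_insert _ _), hsub⟩]
    · rw [if_neg fun h' => hv (hW.1 h'.1), (isChain_coeff hW hz μ).bdry _ hv]
  · rfl

/-- The family of faces of `W` containing a fixed set is empty or acyclic. -/
def LocallyAcyc (K : BoundedComplex V) (k : Type*) [Field k] (W : Set (Finset V)) : Prop :=
  ∀ F₀ : Finset V, {F | F ∈ W ∧ F₀ ⊆ F} = ∅ ∨ K.Acyc k {F | F ∈ W ∧ F₀ ⊆ F}

theorem LocallyAcyc.exists_chains (hW : K.UpClosed W) (hac : K.LocallyAcyc k W) {s : ℕ}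
    {z : Finset V → MvPolynomial V k} (hz : z ∈ polyChains W k s) (hd : K.polyBdry W k z = 0)
    (μ : V →₀ ℕ) : ∃ (y : Finset V → k) (c : k), K.IsChain y ∧ ∀ F ∈ W, μ.support ⊆ F →
      coeff μ (z F) = K.bdry y F + c * K.top k F := by
  rcases hac μ.support with h | h
  · exact ⟨fun _ => 0, 0, fun _ _ => rfl, fun F hF hμ =>
      (Set.eq_empty_iff_forall_notMem.1 h F ⟨hF, hμ⟩).elim⟩
  · obtain ⟨y, c, hy, e⟩ := h.2.2 (fun F => coeff μ (z F)) (isChain_coeff hW hz μ) fun F hF => by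
      have := congrArg (coeff μ) (congrFun hd F)
      rwa [coeff_polyBdry, if_pos (show F ∈ W ∧ μ.support ⊆ F from hF), Pi.zero_apply,
        coeff_zero] at this
    exact ⟨y, c, hy, fun F hF hμ => e F ⟨hF, hμ⟩⟩

/-- All monomials occurring in a polynomial chain. -/
def chainSupport (K : BoundedComplex V) (z : Finset V → MvPolynomial V k) : Finset (V →₀ ℕ) :=
  K.X.powerset.biUnion fun F => (z F).support

theorem coeff_eq_zero_of_notMem_chainSupport {z : Finset V → MvPolynomial V k} {F : Finset V}
    (hF : F ⊆ K.X) {μ : V →₀ ℕ} (hμ : μ ∉ K.chainSupport z) : coeff μ (z F) = 0 := by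
  by_contra h
  exact hμ (Finset.mem_biUnion.2 ⟨F, Finset.mem_powerset.2 hF, mem_support_iff.2 h⟩)

theorem LocallyAcyc.exists_polyBdry_eq (hW : K.UpClosed W) (hac : K.LocallyAcyc k W) {s : ℕ}
    (hs : s < K.N) {z : Finset V → MvPolynomial V k} (hz : z ∈ polyChains W k s)
    (hd : K.polyBdry W k z = 0) : ∃ y ∈ polyChains W k (s + 1), K.polyBdry W k y = z := by
  choose y c hy e using hac.exists_chains hW hz hd
  let Y (F : Finset V) : MvPolynomial V k := if F ∈ W ∧ F.card = s + 1 then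
    ∑ μ ∈ K.chainSupport z with μ.support ⊆ F, monomial μ (y μ F) else 0
  have hY : ∀ F μ, coeff μ (Y F) = if F ∈ W ∧ F.card = s + 1 ∧ μ ∈ K.chainSupport z ∧
      μ.support ⊆ F then y μ F else 0 := by
    intro F μ
    by_cases hF : F ∈ W ∧ F.card = s + 1
    · simp [Y, hF, coeff_sum, coeff_monomial, Finset.sum_ite_eq']
    · have : ¬(F ∈ W ∧ F.card = s + 1 ∧ μ ∈ K.chainSupport z ∧ μ.support ⊆ F) := fun h =>
        hF ⟨h.1, h.2.1⟩
      simp only [Y, if_neg hF, if_neg this, coeff_zero]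
  refine ⟨Y, fun F => ⟨?_, fun h => if_neg h⟩, ?_⟩
  · ext μ
    rw [coeff_restrictVars, hY]
    by_cases h : μ.support ⊆ F <;> simp [h]
  · funext F
    ext μ
    rw [coeff_polyBdry]
    by_cases h : F ∈ W ∧ F.card = s ∧ μ.support ⊆ F
    · have hFX := K.sub F (hW.1 h.1)
      rw [if_pos ⟨h.1, h.2.2⟩]
      by_cases hμ : μ ∈ K.chainSupport z
      · rw [e μ F h.1 h.2.2, top, if_neg fun h' => by have := h'.2; have := h.2.1; omega, mul_zero,
          add_zero]
        refine Finset.sum_congr rfl fun v hv => ?_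
        dsimp only
        rw [hY]
        by_cases hv' : insert v F ∈ K.faces
        · have hc : (insert v F).card = s + 1 := by
            rw [Finset.card_insert_of_notMem (Finset.mem_sdiff.1 hv).2, h.2.1]
          rw [if_pos ⟨hW.2 F h.1 _ hv' (Finset.subset_insert _ _), hc, hμ,
            h.2.2.trans (Finset.subset_insert _ _)⟩]
        · rw [if_neg fun h' => hv' (hW.1 h'.1), hy μ _ hv']
      · rw [coeff_eq_zero_of_notMem_chainSupport hFX hμ]
        refine Finset.sum_eq_zero fun v _ => ?_
        dsimp only
        rw [hY, if_neg fun h' => hμ h'.2.2.1]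
    · rw [coeff_eq_zero_of_mem_polyChains hz h]
      split_ifs with h'
      · refine Finset.sum_eq_zero fun v hv => ?_
        dsimp only
        rw [hY, if_neg]
        rintro ⟨-, hc, -⟩
        rw [Finset.card_insert_of_notMem (Finset.mem_sdiff.1 hv).2] at hc
        exact h ⟨h'.1, by omega, h'.2⟩
      · rfl

variable (W) in
/-- The top-dimensional polynomial cycle attached to a polynomial. -/
def polyCycle (K : BoundedComplex V) (p : MvPolynomial V k) (F : Finset V) : MvPolynomial V k :=
  if F ∈ W ∧ F.card = K.N then restrictVars k F p else 0

theorem polyCycle_mem (p : MvPolynomial V k) : polyCycle W K p ∈ polyChains W k K.N := fun F => by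
  unfold polyCycle
  refine ⟨?_, fun h => if_neg h⟩
  split_ifs
  exacts [restrictVars_restrictVars subset_rfl p, map_zero _]

theorem LocallyAcyc.polyBdry_polyCycle (hW : K.UpClosed W) (hac : K.LocallyAcyc k W)
    (p : MvPolynomial V k) : K.polyBdry W k (polyCycle W K p) = 0 := by
  funext F
  ext μ
  rw [coeff_polyBdry, Pi.zero_apply, coeff_zero]
  split_ifs with h
  · rcases hac μ.support with h0 | h0
    · exact (Set.eq_empty_iff_forall_notMem.1 h0 F h).elim
    · have := h0.2.1 F h
      rw [← mul_zero (coeff μ p), ← this, ← bdry_mul]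
      refine Finset.sum_congr rfl fun v _ => ?_
      have hsub := h.2.trans (Finset.subset_insert v F)
      by_cases hv : insert v F ∈ K.faces
      · have hvW := hW.2 F h.1 _ hv (Finset.subset_insert _ _)
        simp only [polyCycle, top, hv, hvW, true_and]
        split_ifs
        · rw [coeff_restrictVars, if_pos hsub, mul_one]
        · rw [coeff_zero, mul_zero]
      · have hvW : insert v F ∉ W := fun h' => hv (hW.1 h')
        simp [polyCycle, top, hv, hvW]
  · rfl

theorem LocallyAcyc.exists_polyCycle (hW : K.UpClosed W) (hac : K.LocallyAcyc k W)
    {z : Finset V → MvPolynomial V k} (hz : z ∈ polyChains W k K.N)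
    (hd : K.polyBdry W k z = 0) : ∃ p, z = polyCycle W K p := by
  choose y c hy e using hac.exists_chains hW hz hd
  refine ⟨∑ μ ∈ K.chainSupport z, monomial μ (c μ), ?_⟩
  funext F
  ext μ
  by_cases h : F ∈ W ∧ F.card = K.N ∧ μ.support ⊆ F
  · rw [polyCycle, if_pos ⟨h.1, h.2.1⟩, coeff_restrictVars, if_pos h.2.2, coeff_sum]
    simp only [coeff_monomial, Finset.sum_ite_eq']
    split_ifs with hμ
    · rw [e μ F h.1 h.2.2, bdry_eq_zero_of_card (hy μ) h.2.1, top, if_pos ⟨hW.1 h.1, h.2.1⟩,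
        mul_one, zero_add]
    · exact coeff_eq_zero_of_notMem_chainSupport (K.sub F (hW.1 h.1)) hμ
  · rw [coeff_eq_zero_of_mem_polyChains hz h, coeff_eq_zero_of_mem_polyChains (polyCycle_mem _) h]

theorem isWeaklyRegularOn_polyChains {r : ℕ → V → k}
    (hr : ∀ F ∈ W, ∃ M, IsSquareInverse F r M) (s : ℕ) :
    IsWeaklyRegularOn (polyMul r) (polyChains W k s) s := by
  rintro m hm x hx ⟨c, hc, e⟩
  have key : ∀ F, ∃ d : ℕ → MvPolynomial V k, (∀ i, restrictVars k F (d i) = d i ∧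
      (¬(F ∈ W ∧ F.card = s) → d i = 0)) ∧
      x F = ∑ i ∈ Finset.range m, linForm F (r i) * d i := by
    intro F
    by_cases hF : F ∈ W ∧ F.card = s
    · obtain ⟨M, hM⟩ := hr F hF.1
      have eF := congrFun e F
      rw [Finset.sum_apply] at eF
      obtain ⟨d, hd⟩ := hM.exists_sum (by omega) eF
      refine ⟨fun i => restrictVars k F (d i), fun i =>
        ⟨restrictVars_restrictVars subset_rfl _, fun h => (h hF).elim⟩, ?_⟩
      rw [(hx F).1] at hd
      rw [← (hx F).1, hd, map_sum]
      exact Finset.sum_congr rfl fun i _ => by rw [map_mul, restrictVars_linForm_self]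
    · exact ⟨fun _ => 0, fun i => ⟨map_zero _, fun _ => rfl⟩, by simp [(hx F).2 hF]⟩
  choose d hd e' using key
  refine ⟨fun i F => d F i, fun i F => hd F i, ?_⟩
  funext F
  rw [Finset.sum_apply]
  exact e' F

/-- A generic sequence of linear forms is weakly regular modulo the face ideal of a locally acyclic
family. -/
theorem LocallyAcyc.isWeaklyRegularMod [CharP k 2] (hW : K.UpClosed W) (hac : K.LocallyAcyc k W)
    {r : ℕ → V → k} (hr : ∀ F ∈ W, ∃ M, IsSquareInverse F r M) :
    IsWeaklyRegularMod (faceIdeal k {F | F ∈ W ∧ F.card = K.N}) K.X r K.N := by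
  have hcomm : ∀ i j (x : Finset V → MvPolynomial V k),
      polyMul r i (polyMul r j x) = polyMul r j (polyMul r i x) := fun i j x => by
    funext F
    exact mul_left_comm _ _ _
  have key : ∀ s ≤ K.N, IsWeaklyRegularOn (polyMul r)
      (polyChains W k s ⊓ (K.polyBdry W k).ker) s := by
    intro s
    induction s with
    | zero => exact fun _ m hm => by omega
    | succ s ih =>
      intro hs
      refine IsWeaklyRegularOn.inf_ker hcomm (d := K.polyBdry W k)
        (fun i x => polyBdry_polyMul r i x) (fun i x => polyMul_mem r i _) ?_
        (isWeaklyRegularOn_polyChains hr _)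
      have : (polyChains W k (s + 1)).map (K.polyBdry W k) =
          polyChains W k s ⊓ (K.polyBdry W k).ker := by
        ext z
        constructor
        · rintro ⟨y, hy, rfl⟩
          exact ⟨polyBdry_mem hy, polyBdry_polyBdry hW hy⟩
        · rintro ⟨hz, hd⟩
          exact hac.exists_polyBdry_eq hW (by omega) hz hd
      rw [this]
      exact ih (by omega)
  have hlin : ∀ F ∈ W, ∀ i, restrictVars k F (linForm K.X (r i)) = linForm F (r i) := fun F hF i =>
    restrictVars_linForm (K.sub F (hW.1 hF)) _
  have hcyc : ∀ p, polyCycle W K p ∈ polyChains W k K.N ⊓ (K.polyBdry W k).ker := fun p =>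
    ⟨polyCycle_mem p, hac.polyBdry_polyCycle hW p⟩
  have hmul : ∀ i p, polyMul r i (polyCycle W K p) = polyCycle W K (linForm K.X (r i) * p) := by
    intro i p
    funext F
    change linForm F (r i) * polyCycle W K p F = _
    unfold polyCycle
    split_ifs with h
    · rw [map_mul, hlin F h.1]
    · rw [mul_zero]
  have hadd : ∀ p q : MvPolynomial V k,
      polyCycle W K (p + q) = polyCycle W K p + polyCycle W K q := by
    intro p q
    funext F
    simp only [polyCycle, Pi.add_apply, map_add]
    split_ifs <;> simp
  have hsum : ∀ m (c : ℕ → MvPolynomial V k), polyCycle W K (∑ i ∈ Finset.range m,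
      linForm K.X (r i) * c i) = ∑ i ∈ Finset.range m, polyMul r i (polyCycle W K (c i)) := by
    intro m c
    induction m with
    | zero =>
      funext F
      simp [polyCycle]
    | succ m ih => rw [Finset.sum_range_succ, hadd, ih, Finset.sum_range_succ, hmul]
  have hzero : ∀ p : MvPolynomial V k, polyCycle W K p = 0 ↔
      p ∈ faceIdeal k {F | F ∈ W ∧ F.card = K.N} := by
    intro p
    refine ⟨fun h F hF => ?_, fun h => ?_⟩
    · have := congrFun h F
      rwa [polyCycle, if_pos (show F ∈ W ∧ F.card = K.N from hF), Pi.zero_apply] at this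
    · funext F
      unfold polyCycle
      split_ifs with hF
      exacts [h F hF, rfl]
  intro m hm p hp
  obtain ⟨j, hj, c, e⟩ := mem_sup_linIdeal.1 hp
  obtain ⟨d, hd, e'⟩ := key K.N le_rfl m hm _ (hcyc p) ⟨fun i => polyCycle W K (c i),
    fun i => hcyc _, by rw [hmul, e, hadd, (hzero j).2 hj, zero_add, hsum]⟩
  choose q hq using fun i => hac.exists_polyCycle hW (hd i).1 (hd i).2
  refine mem_sup_linIdeal.2 ⟨p - ∑ i ∈ Finset.range m, linForm K.X (r i) * q i, ?_, q, by ring⟩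
  rw [← hzero]
  have h1 := hadd (p - ∑ i ∈ Finset.range m, linForm K.X (r i) * q i)
    (∑ i ∈ Finset.range m, linForm K.X (r i) * q i)
  rw [sub_add_cancel, hsum, e', Finset.sum_congr rfl fun i _ => by rw [hq i]] at h1
  exact left_eq_add.1 (by rw [add_comm]; exact h1)

end BoundedComplex

end WeaklyRegularPolynomials

section StarIdeal

open MvPolynomial

variable {n : ℕ} {k : Type*} [Field k] {S : SimplicialFan n}

/-- The face ideal of the faces containing `E` with support in `U`. -/
def SimplicialFan.starIdeal (S : SimplicialFan n) (k : Type*) [Field k] (E : Finset (Fin n → ℝ))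
    (U : Finset (Fin n)) : Ideal (MvPolynomial (Fin n → ℝ) k) :=
  faceIdeal k {F | F ∈ S.faces ∧ E ⊆ F ∧ suppSet F ⊆ U}

theorem SimplicialFan.mem_starIdeal {E : Finset (Fin n → ℝ)} {U : Finset (Fin n)}
    {p : MvPolynomial (Fin n → ℝ) k} : p ∈ S.starIdeal k E U ↔
      ∀ μ : (Fin n → ℝ) →₀ ℕ, μ.support ∪ E ∈ S.faces → suppSet (μ.support ∪ E) ⊆ U →
        coeff μ p = 0 := by
  rw [starIdeal, mem_faceIdeal_iff_coeff]
  refine ⟨fun h μ h1 h2 => h _ ⟨h1, Finset.subset_union_right, h2⟩ μ Finset.subset_union_left,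
    fun h F hF μ hμ => ?_⟩
  have hsub : μ.support ∪ E ⊆ F := Finset.union_subset hμ hF.2.1
  exact h μ (S.down_closed _ hF.1 _ hsub) ((suppSet_mono hsub).trans hF.2.2)

theorem SimplicialFan.starIdeal_mono {E E' : Finset (Fin n → ℝ)} {U U' : Finset (Fin n)}
    (hE : E ⊆ E') (hU : U' ⊆ U) : S.starIdeal k E U ≤ S.starIdeal k E' U' :=
  fun _ hp F hF => hp F ⟨hF.1, hE.trans hF.2.1, hF.2.2.trans hU⟩

theorem SimplicialFan.starIdeal_eq [CharP k 2] {E : Finset (Fin n → ℝ)} {U : Finset (Fin n)} :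
    S.starIdeal k E U = faceIdeal k {F | F ∈ {F | F ∈ (S.restrict U).faces ∧ E ⊆ F ∧
      suppSet F = U} ∧ F.card = (S.restrict U).N} := by
  refine le_antisymm (fun p hp F hF => hp F ⟨hF.1.1.1, hF.1.2.1, hF.1.1.2⟩) fun p hp F hF => ?_
  obtain ⟨G, hG, hGN⟩ := (acyc_interior (k := k) (S := S) (U := U) (F₀ := F) ⟨hF.1, hF.2.2⟩).1
  rw [← restrictVars_restrictVars hG.2.1, hp G ⟨⟨hG.1, hF.2.1.trans hG.2.1, hG.2.2⟩, hGN⟩, map_zero]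

/-- A matrix supported on the nonzero coordinates of the vertices, of maximal rank on faces. -/
structure SimplicialFan.IsSystem (S : SimplicialFan n) (a : Fin n → (Fin n → ℝ) → k) : Prop where
  supp : ∀ i v, v i = 0 → a i v = 0
  surj : ∀ F ∈ S.faces, ∀ b : (Fin n → ℝ) → k, ∃ h : Fin n → k, ∀ v ∈ F, ∑ i, h i * a i v = b v

namespace SimplicialFan.IsSystem

variable {a : Fin n → (Fin n → ℝ) → k}

theorem linForm_mem (ha : S.IsSystem a) {E : Finset (Fin n → ℝ)} {U : Finset (Fin n)} {i : Fin n}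
    (hi : i ∉ U) : linForm S.verts (a i) ∈ S.starIdeal k E U := fun F hF => by
  rw [restrictVars_linForm (S.faces_subset_verts F hF.1), linForm]
  refine Finset.sum_eq_zero fun v hv => ?_
  rw [ha.supp i v (by_contra fun h => hi (hF.2.2 (mem_suppSet.2 ⟨v, hv, h⟩))), C_0, zero_mul]

theorem exists_sequence [Infinite k] (ha : S.IsSystem a) (U : Finset (Fin n)) :
    ∃ y : ℕ → Fin n → k, (∃ M, IsSquareInverse U y M) ∧ ∀ F ∈ S.faces, suppSet F ⊆ U →
      ∃ M, IsSquareInverse F (fun j v => ∑ i ∈ U, y j i * a i v) M := by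
  let r : (Fin n → k) →ₗ[k] ((Fin n → ℝ) ⊕ Fin n → k) :=
    { toFun := fun h => Sum.elim (fun v => ∑ i ∈ U, h i * a i v) h
      map_add' := fun h h' => by
        funext x
        rcases x with v | i
        · simp [add_mul, Finset.sum_add_distrib]
        · rfl
      map_smul' := fun c h => by
        funext x
        rcases x with v | i
        · simp [Finset.mul_sum, mul_assoc]
        · rfl }
  let T : Finset (Finset ((Fin n → ℝ) ⊕ Fin n)) :=
    insert (U.map Function.Embedding.inr)
      ((S.faces.filter fun F => suppSet F ⊆ U).image fun F => F.map Function.Embedding.inl)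
  obtain ⟨y, hy⟩ := exists_generic_sequence (K := k) (W := Fin n → k) r T (by
    intro A hA b
    rcases Finset.mem_insert.1 hA with rfl | hA
    · refine ⟨fun i => b (Sum.inr i), fun v hv => ?_⟩
      obtain ⟨i, -, rfl⟩ := Finset.mem_map.1 hv
      rfl
    · obtain ⟨F, hF, rfl⟩ := Finset.mem_image.1 hA
      obtain ⟨hF, hFU⟩ := Finset.mem_filter.1 hF
      obtain ⟨h, hh⟩ := ha.surj F hF fun v => b (Sum.inl v)
      refine ⟨h, fun x hx => ?_⟩
      obtain ⟨v, hv, rfl⟩ := Finset.mem_map.1 hx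
      change ∑ i ∈ U, h i * a i v = b (Sum.inl v)
      rw [← hh v hv]
      refine Finset.sum_subset (Finset.subset_univ _) fun i _ hi => ?_
      rw [ha.supp i v (by_contra fun h => hi (hFU (mem_suppSet.2 ⟨v, hv, h⟩))), mul_zero])
  refine ⟨y, ?_, fun F hF hFU => ?_⟩
  · obtain ⟨h1, h2⟩ := hy _ (Finset.mem_insert_self _ _)
    rw [Finset.card_map] at h1 h2
    refine exists_isSquareInverse (fun lam hlam i hi => ?_) fun b => ?_
    · refine h1 (fun x => Sum.elim (fun _ => 0) lam x) (fun j hj => ?_) (Sum.inr i)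
        (Finset.mem_map_of_mem _ hi)
      rw [Finset.sum_map]
      exact hlam j hj
    · obtain ⟨lam, hlam⟩ := h2 b
      refine ⟨fun i => lam (Sum.inr i), fun j hj => ?_⟩
      rw [← hlam j hj, Finset.sum_map]
      rfl
  · obtain ⟨h1, h2⟩ := hy (F.map Function.Embedding.inl) (Finset.mem_insert_of_mem
      (Finset.mem_image_of_mem _ (Finset.mem_filter.2 ⟨hF, hFU⟩)))
    rw [Finset.card_map] at h1 h2
    refine exists_isSquareInverse (fun lam hlam i hi => ?_) fun b => ?_
    · refine h1 (fun x => Sum.elim lam (fun _ => 0) x) (fun j hj => ?_) (Sum.inl i)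
        (Finset.mem_map_of_mem _ hi)
      rw [Finset.sum_map]
      exact hlam j hj
    · obtain ⟨lam, hlam⟩ := h2 b
      refine ⟨fun i => lam (Sum.inl i), fun j hj => ?_⟩
      rw [← hlam j hj, Finset.sum_map]
      rfl

/-- The ideal generated by the linear forms of the system. -/
def linearIdeal (S : SimplicialFan n) (a : Fin n → (Fin n → ℝ) → k) :
    Ideal (MvPolynomial (Fin n → ℝ) k) :=
  Ideal.span (Set.range fun i => linForm S.verts (a i))

theorem linForm_sum (U : Finset (Fin n)) (y : Fin n → k) :
    linForm S.verts (fun v => ∑ i ∈ U, y i * a i v) =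
      ∑ i ∈ U, C (y i) * linForm S.verts (a i) := by
  simp only [linForm, map_sum, C_mul, Finset.sum_mul, Finset.mul_sum]
  rw [Finset.sum_comm]
  exact Finset.sum_congr rfl fun i _ => Finset.sum_congr rfl fun v _ => by ring

theorem linForm_eq_sum {U : Finset (Fin n)} {y : ℕ → Fin n → k} {M : Fin n → ℕ → k}
    (hM : IsSquareInverse U y M) {i : Fin n} (hi : i ∈ U) :
    linForm S.verts (a i) = ∑ j ∈ Finset.range U.card,
      C (M i j) * linForm S.verts (fun v => ∑ i ∈ U, y j i * a i v) := by
  simp only [linForm_sum, Finset.mul_sum]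
  rw [Finset.sum_comm, Finset.sum_eq_single i]
  · simp only [← mul_assoc, ← Finset.sum_mul, ← C_mul, ← map_sum]
    rw [hM.left i hi i hi, if_pos rfl, C_1, one_mul]
  · intro i' hi' hne
    simp only [← mul_assoc, ← Finset.sum_mul, ← C_mul, ← map_sum]
    rw [hM.left i hi i' hi', if_neg hne.symm, C_0, zero_mul]
  · exact fun h => absurd hi h

theorem sup_linIdeal_eq (ha : S.IsSystem a) {U : Finset (Fin n)} {y : ℕ → Fin n → k}
    {M : Fin n → ℕ → k} (hM : IsSquareInverse U y M) (E : Finset (Fin n → ℝ)) :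
    S.starIdeal k E U ⊔ linIdeal S.verts (fun j v => ∑ i ∈ U, y j i * a i v) U.card =
      S.starIdeal k E U ⊔ linearIdeal S a := by
  refine le_antisymm (sup_le le_sup_left ?_) (sup_le le_sup_left ?_)
  · refine le_sup_of_le_right (Ideal.span_le.2 ?_)
    rintro _ ⟨j, -, rfl⟩
    dsimp only
    rw [linForm_sum]
    exact sum_mem fun i _ => Ideal.mul_mem_left _ _ (Ideal.subset_span ⟨i, rfl⟩)
  · refine Ideal.span_le.2 ?_
    rintro _ ⟨i, rfl⟩
    by_cases hi : i ∈ U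
    · dsimp only
      rw [linForm_eq_sum hM hi]
      exact Ideal.mem_sup_right (sum_mem fun j hj => Ideal.mul_mem_left _ _
        (Ideal.subset_span ⟨j, hj, rfl⟩))
    · exact Ideal.mem_sup_left (ha.linForm_mem hi)

theorem isWeaklyRegularMod [CharP k 2] (E : Finset (Fin n → ℝ)) (U : Finset (Fin n))
    {r : ℕ → (Fin n → ℝ) → k}
    (hr : ∀ F ∈ S.faces, suppSet F ⊆ U → ∃ M, IsSquareInverse F r M) :
    IsWeaklyRegularMod (S.starIdeal k E U) S.verts r U.card := by
  rw [starIdeal_eq]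
  have hW : (S.restrict U).UpClosed {F | F ∈ (S.restrict U).faces ∧ E ⊆ F ∧ suppSet F = U} :=
    ⟨fun F hF => hF.1, fun F hF G hG hFG =>
      ⟨hG, hF.2.1.trans hFG, le_antisymm hG.2 (hF.2.2 ▸ suppSet_mono hFG)⟩⟩
  refine BoundedComplex.LocallyAcyc.isWeaklyRegularMod (K := S.restrict U) hW (fun F₀ => ?_)
    fun F hF => hr F hF.1.1 hF.1.2
  · have e : {F | F ∈ {F | F ∈ (S.restrict U).faces ∧ E ⊆ F ∧ suppSet F = U} ∧ F₀ ⊆ F} =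
        {F | F ∈ (S.restrict U).faces ∧ E ∪ F₀ ⊆ F ∧ suppSet F = U} := by
      ext F
      exact ⟨fun h => ⟨h.1.1, Finset.union_subset h.1.2.1 h.2, h.1.2.2⟩, fun h =>
        ⟨⟨h.1, Finset.subset_union_left.trans h.2.1, h.2.2⟩,
          Finset.subset_union_right.trans h.2.1⟩⟩
    rw [e]
    by_cases h : E ∪ F₀ ∈ (S.restrict U).faces
    · exact Or.inr (acyc_interior h)
    · exact Or.inl (Set.eq_empty_of_forall_notMem fun F hF =>
        h ((S.restrict U).down F hF.1 _ hF.2.1))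

end SimplicialFan.IsSystem

end StarIdeal

section Gysin

open MvPolynomial

variable {n : ℕ} {k : Type*} [Field k] {S : SimplicialFan n}

theorem linIdeal_mono {V : Type*} {X₀ : Finset V} {r : ℕ → V → k} {m m' : ℕ} (h : m ≤ m') :
    linIdeal X₀ r m ≤ linIdeal X₀ r m' :=
  Ideal.span_mono (Set.image_mono fun i hi => by
    simp only [Finset.coe_range, Set.mem_Iio] at *
    omega)

theorem linForm_mem_linIdeal {V : Type*} {X₀ : Finset V} {r : ℕ → V → k} {i m : ℕ} (h : i < m) :
    linForm X₀ (r i) ∈ linIdeal X₀ r m :=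
  Ideal.subset_span ⟨i, by simpa using h, rfl⟩

namespace SimplicialFan

/-- The faces with support `U` which contain `E` and cannot be joined with `v`. -/
def deletedStar (S : SimplicialFan n) (E : Finset (Fin n → ℝ)) (U : Finset (Fin n))
    (v : Fin n → ℝ) : Set (Finset (Fin n → ℝ)) :=
  {F | F ∈ (S.restrict U).faces ∧ E ⊆ F ∧ suppSet F = U ∧ insert v F ∉ (S.restrict U).faces}

theorem upClosed_deletedStar {E : Finset (Fin n → ℝ)} {U : Finset (Fin n)} {v : Fin n → ℝ} :
    (S.restrict U).UpClosed (S.deletedStar E U v) :=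
  ⟨fun _ hF => hF.1, fun _ hF _ hG hFG =>
    ⟨hG, hF.2.1.trans hFG, le_antisymm hG.2 (hF.2.2.1 ▸ suppSet_mono hFG), fun h =>
      hF.2.2.2 ((S.restrict U).down _ h _ (Finset.insert_subset_insert _ hFG))⟩⟩

theorem notMem_of_mem_deletedStar {E F : Finset (Fin n → ℝ)} {U : Finset (Fin n)} {v : Fin n → ℝ}
    (h : F ∈ S.deletedStar E U v) : v ∉ F := fun hv => h.2.2.2 (by
  rw [Finset.insert_eq_of_mem hv]
  exact h.1)

theorem acyc_deletedStar [CharP k 2] {E F₀ : Finset (Fin n → ℝ)} {U : Finset (Fin n)}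
    {v : Fin n → ℝ} (hσ : suppSet {v} ⊆ suppSet E) (h₀ : F₀ ∪ E ∈ (S.restrict U).faces)
    (hv : v ∉ F₀ ∪ E) : (S.restrict U).Acyc k {F | F ∈ S.deletedStar E U v ∧ F₀ ⊆ F} := by
  have hW : (S.restrict U).UpClosed
      {F | F ∈ (S.restrict U).faces ∧ F₀ ∪ E ⊆ F ∧ suppSet F = U} :=
    ⟨fun F hF => hF.1, fun F hF G hG hFG =>
      ⟨hG, hF.2.1.trans hFG, le_antisymm hG.2 (hF.2.2 ▸ suppSet_mono hFG)⟩⟩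
  have e : {F | F ∈ S.deletedStar E U v ∧ F₀ ⊆ F} =
      {F | F ∈ {F | F ∈ (S.restrict U).faces ∧ F₀ ∪ E ⊆ F ∧ suppSet F = U} ∧
        insert v F ∉ (S.restrict U).faces} := by
    ext F
    exact ⟨fun h => ⟨⟨h.1.1, Finset.union_subset h.2 h.1.2.1, h.1.2.2.1⟩, h.1.2.2.2⟩, fun h =>
      ⟨⟨h.1.1, Finset.subset_union_right.trans h.1.2.1, h.1.2.2, h.2⟩,
        Finset.subset_union_left.trans h.1.2.1⟩⟩
  by_cases hf : insert v (F₀ ∪ E) ∈ (S.restrict U).faces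
  · rw [e]
    refine BoundedComplex.Acyc.deletion hW (acyc_interior h₀) (fun H hH => ?_) ?_
    · have hsub : F₀ ∪ E ⊆ H.erase v := fun x hx =>
        Finset.mem_erase.2 ⟨fun h => hv (h ▸ hx), hH.2.1 hx⟩
      refine ⟨(S.restrict U).down _ hH.1 _ (Finset.erase_subset _ _), hsub, ?_⟩
      rw [← hH.2.2]
      refine le_antisymm (suppSet_mono (Finset.erase_subset _ _)) ?_
      calc suppSet H ⊆ suppSet ({v} ∪ H.erase v) := suppSet_mono fun x hx => by
            by_cases h : x = v <;> simp [h, hx]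
        _ = suppSet {v} ∪ suppSet (H.erase v) := suppSet_union _ _
        _ ⊆ suppSet (H.erase v) := Finset.union_subset
            (hσ.trans (suppSet_mono (Finset.subset_union_right.trans hsub))) subset_rfl
    · obtain ⟨G, hG, hGN⟩ := (acyc_interior (k := k) hf).1
      exact ⟨G, ⟨hG.1, (Finset.subset_insert _ _).trans hG.2.1, hG.2.2⟩,
        hG.2.1 (Finset.mem_insert_self _ _), hGN⟩
  · have e' : {F | F ∈ S.deletedStar E U v ∧ F₀ ⊆ F} =
        {F | F ∈ (S.restrict U).faces ∧ F₀ ∪ E ⊆ F ∧ suppSet F = U} := by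
      rw [e]
      ext F
      exact ⟨fun h => h.1, fun h => ⟨h, fun h' =>
        hf ((S.restrict U).down _ h' _ (Finset.insert_subset_insert _ h.2.1))⟩⟩
    rw [e']
    exact acyc_interior h₀

/-- The face ideal of the deletion of `v` from the star of `E`. -/
def deletedIdeal (S : SimplicialFan n) (k : Type*) [Field k] (E : Finset (Fin n → ℝ))
    (U : Finset (Fin n)) (v : Fin n → ℝ) : Ideal (MvPolynomial (Fin n → ℝ) k) :=
  faceIdeal k {F | F ∈ S.deletedStar E U v ∧ F.card = (S.restrict U).N}

theorem isWeaklyRegularMod_deletedIdeal [CharP k 2] {E : Finset (Fin n → ℝ)} {U : Finset (Fin n)}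
    {v : Fin n → ℝ} (hσ : suppSet {v} ⊆ suppSet E) {r : ℕ → (Fin n → ℝ) → k}
    (hr : ∀ F ∈ S.faces, suppSet F ⊆ U → ∃ M, IsSquareInverse F r M) :
    IsWeaklyRegularMod (S.deletedIdeal k E U v) S.verts r U.card := by
  refine BoundedComplex.LocallyAcyc.isWeaklyRegularMod (K := S.restrict U) upClosed_deletedStar
    (fun F₀ => ?_) fun F hF => hr F hF.1.1 hF.1.2
  by_cases h : F₀ ∪ E ∈ (S.restrict U).faces ∧ v ∉ F₀ ∪ E
  · exact Or.inr (acyc_deletedStar hσ h.1 h.2)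
  · refine Or.inl (Set.eq_empty_of_forall_notMem fun F hF => h ?_)
    have hsub := Finset.union_subset hF.2 hF.1.2.1
    exact ⟨(S.restrict U).down _ hF.1.1 _ hsub, fun hv =>
      notMem_of_mem_deletedStar hF.1 (hsub hv)⟩

theorem starIdeal_le_deletedIdeal {E : Finset (Fin n → ℝ)} {U : Finset (Fin n)} {v : Fin n → ℝ} :
    S.starIdeal k E U ≤ S.deletedIdeal k E U v :=
  fun _ hp F hF => hp F ⟨hF.1.1.1, hF.1.2.1, hF.1.1.2⟩

theorem X_mem_deletedIdeal {E : Finset (Fin n → ℝ)} {U : Finset (Fin n)} {v : Fin n → ℝ} :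
    X v ∈ S.deletedIdeal k E U v := fun F hF => by
  rw [restrictVars_X, if_neg (notMem_of_mem_deletedStar hF.1)]

theorem exists_of_mem_deletedIdeal [CharP k 2] {E : Finset (Fin n → ℝ)} {U : Finset (Fin n)}
    {v : Fin n → ℝ} (hvE : v ∉ E) (hσ : suppSet {v} ⊆ suppSet E)
    {p : MvPolynomial (Fin n → ℝ) k} (hp : p ∈ S.deletedIdeal k E U v) :
    ∃ j ∈ S.starIdeal k E U, ∃ g, p = j + X v * g := by
  refine ⟨p.modMonomial (Finsupp.single v 1), mem_starIdeal.2 fun μ h1 h2 => ?_,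
    p.divMonomial (Finsupp.single v 1), ?_⟩
  · by_cases hμ : Finsupp.single v 1 ≤ μ
    · exact coeff_modMonomial_of_le _ hμ
    · rw [coeff_modMonomial_of_not_le _ hμ]
      have hv : v ∉ μ.support ∪ E := by
        rw [Finset.mem_union, not_or]
        refine ⟨fun h => hμ ?_, hvE⟩
        rw [Finsupp.single_le_iff]
        exact Nat.one_le_iff_ne_zero.2 (Finsupp.mem_support_iff.1 h)
      obtain ⟨G, hG, hGN⟩ := (acyc_deletedStar (k := k) (S := S) hσ ⟨h1, h2⟩ hv).1
      exact mem_faceIdeal_iff_coeff.1 hp G ⟨hG.1, hGN⟩ μ hG.2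
  · rw [add_comm]
    exact (divMonomial_add_modMonomial_single p v).symm

theorem mem_starIdeal_of_X_mul {E : Finset (Fin n → ℝ)} {U : Finset (Fin n)}
    {v : Fin n → ℝ} {f : MvPolynomial (Fin n → ℝ) k} (h : X v * f ∈ S.starIdeal k E U) :
    f ∈ S.starIdeal k (insert v E) U := by
  rw [mem_starIdeal] at h ⊢
  intro μ h1 h2
  have e : (μ + Finsupp.single v 1).support ∪ E = μ.support ∪ insert v E := by
    ext w
    by_cases hw : w = v
    · simp [hw]
    · simp [hw]
  have := h (μ + Finsupp.single v 1) (e ▸ h1) (e ▸ h2)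
  rwa [mul_comm, coeff_mul_X] at this

theorem IsSystem.mem_of_X_mul [CharP k 2] [Infinite k] {a : Fin n → (Fin n → ℝ) → k}
    (ha : S.IsSystem a) {E : Finset (Fin n → ℝ)} {U : Finset (Fin n)} {v : Fin n → ℝ}
    (hvE : v ∉ E) (hσ : suppSet {v} ⊆ suppSet E) {f : MvPolynomial (Fin n → ℝ) k}
    (h : X v * f ∈ S.starIdeal k E U ⊔ linearIdeal S a) :
    f ∈ S.starIdeal k (insert v E) U ⊔ linearIdeal S a := by
  obtain ⟨y, ⟨M, hM⟩, hy⟩ := ha.exists_sequence U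
  have hreg := isWeaklyRegularMod_deletedIdeal (k := k) (E := E) hσ hy
  rw [← ha.sup_linIdeal_eq hM] at h ⊢
  set r : ℕ → (Fin n → ℝ) → k := fun j v => ∑ i ∈ U, y j i * a i v
  have key : ∀ m ≤ U.card, ∀ f : MvPolynomial (Fin n → ℝ) k,
      X v * f ∈ S.starIdeal k E U ⊔ linIdeal S.verts r m →
      f ∈ S.starIdeal k (insert v E) U ⊔ linIdeal S.verts r m := by
    intro m
    induction m with
    | zero =>
      intro _ f hf
      have e : linIdeal S.verts r 0 = ⊥ := by simp [linIdeal]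
      rw [e, sup_bot_eq] at hf ⊢
      exact mem_starIdeal_of_X_mul hf
    | succ m ih =>
      intro hm f hf
      obtain ⟨j, hj, c, hc⟩ := mem_sup_linIdeal.1 hf
      rw [Finset.sum_range_succ] at hc
      have hl : ∑ i ∈ Finset.range m, linForm S.verts (r i) * c i ∈ linIdeal S.verts r m :=
        sum_mem fun i hi => Ideal.mul_mem_right _ _ (linForm_mem_linIdeal (Finset.mem_range.1 hi))
      have h1 := hreg m hm (c m) (by
        have : linForm S.verts (r m) * c m =
            (X v * f - j) - ∑ i ∈ Finset.range m, linForm S.verts (r i) * c i := by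
          rw [hc]
          ring
        rw [this]
        exact sub_mem (Ideal.mem_sup_left (sub_mem (Ideal.mul_mem_right _ _ X_mem_deletedIdeal)
          (starIdeal_le_deletedIdeal hj))) (Ideal.mem_sup_right hl))
      obtain ⟨q, hq, l, hl', e⟩ := Submodule.mem_sup.1 h1
      obtain ⟨j', hj', g, rfl⟩ := exists_of_mem_deletedIdeal hvE hσ hq
      have h2 := ih (by omega) (f - linForm S.verts (r m) * g) (by
        have : X v * (f - linForm S.verts (r m) * g) = (j + linForm S.verts (r m) * j') +
            (∑ i ∈ Finset.range m, linForm S.verts (r i) * c i + linForm S.verts (r m) * l) := by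
          rw [mul_sub, hc, ← e]
          ring
        rw [this]
        exact add_mem (Ideal.mem_sup_left (add_mem hj (Ideal.mul_mem_left _ _ hj')))
          (Ideal.mem_sup_right (add_mem hl (Ideal.mul_mem_left _ _ hl'))))
      have h3 := add_mem (sup_le_sup_left (linIdeal_mono (Nat.le_succ m)) _ h2)
        (Ideal.mem_sup_right (S := S.starIdeal k (insert v E) U) (Ideal.mul_mem_right g _
          (linForm_mem_linIdeal (r := r) (X₀ := S.verts) (Nat.lt_succ_self m))))
      rwa [sub_add_cancel] at h3
  exact key _ le_rfl f h

end SimplicialFan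

end Gysin

section Freeness

open MvPolynomial

variable {V k : Type*} [Field k] {J : Ideal (MvPolynomial V k)} {X₀ : Finset V} {r : ℕ → V → k}
  {N : ℕ}

theorem IsWeaklyRegularMod.eq_zero_of_mem_sup (hreg : IsWeaklyRegularMod J X₀ r N) {β : Type*}
    {s : Finset β} {b : β → MvPolynomial V k}
    (hb : ∀ t : β → k, ∑ i ∈ s, C (t i) * b i ∈ J ⊔ linIdeal X₀ r N → ∀ i ∈ s, t i = 0) (d : ℕ) :
    ∀ m, m + d = N → ∀ c : β → MvPolynomial ℕ k,
      (∀ i ∈ s, ∀ ν, coeff ν (c i) ≠ 0 → ∀ j ∈ ν.support, m ≤ j ∧ j < N) →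
      ∑ i ∈ s, aeval (fun j => linForm X₀ (r j)) (c i) * b i ∈ J ⊔ linIdeal X₀ r m →
      ∀ i ∈ s, c i = 0 := by
  induction d with
  | zero =>
    intro m hm c hc h i hi
    have hC : ∀ i ∈ s, c i = C (coeff 0 (c i)) := by
      intro i hi
      ext ν
      rw [coeff_C]
      split_ifs with hν
      · rw [hν]
      · by_contra hne
        obtain ⟨j, hj⟩ := Finsupp.support_nonempty_iff.2 (Ne.symm hν)
        have := hc i hi ν hne j hj
        omega
    rw [hC i hi, hb (fun i => coeff 0 (c i)) ?_ i hi, C_0]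
    have e : ∑ i ∈ s, C (coeff 0 (c i)) * b i =
        ∑ i ∈ s, aeval (fun j => linForm X₀ (r j)) (c i) * b i := by
      refine Finset.sum_congr rfl fun i hi => ?_
      conv_rhs => rw [hC i hi, aeval_C]
      rfl
    rwa [e, ← hm]
  | succ d ih =>
    intro m hm
    have key : ∀ D : ℕ, ∀ c : β → MvPolynomial ℕ k,
        (∀ i ∈ s, ∀ ν, coeff ν (c i) ≠ 0 → ν.degree < D) →
        (∀ i ∈ s, ∀ ν, coeff ν (c i) ≠ 0 → ∀ j ∈ ν.support, m ≤ j ∧ j < N) →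
        ∑ i ∈ s, aeval (fun j => linForm X₀ (r j)) (c i) * b i ∈ J ⊔ linIdeal X₀ r m →
        ∀ i ∈ s, c i = 0 := by
      intro D
      induction D with
      | zero =>
        intro c hD _ _ i hi
        ext ν
        by_contra hne
        exact absurd (hD i hi ν hne) (Nat.not_lt_zero _)
      | succ D ihD =>
        intro c hD hc h
        set c₁ : β → MvPolynomial ℕ k := fun i => (c i).divMonomial (Finsupp.single m 1)
        set c₀ : β → MvPolynomial ℕ k := fun i => (c i).modMonomial (Finsupp.single m 1)
        have hsplit : ∀ i, c i = X m * c₁ i + c₀ i := fun i =>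
          (divMonomial_add_modMonomial_single (c i) m).symm
        have e : ∑ i ∈ s, aeval (fun j => linForm X₀ (r j)) (c i) * b i =
            linForm X₀ (r m) * ∑ i ∈ s, aeval (fun j => linForm X₀ (r j)) (c₁ i) * b i +
              ∑ i ∈ s, aeval (fun j => linForm X₀ (r j)) (c₀ i) * b i := by
          rw [Finset.mul_sum, ← Finset.sum_add_distrib]
          refine Finset.sum_congr rfl fun i _ => ?_
          rw [hsplit i, map_add, map_mul, aeval_X]
          ring
        have h₀ : ∀ i ∈ s, c₀ i = 0 := by
          refine ih (m + 1) (by omega) c₀ (fun i hi ν hν j hj => ?_) ?_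
          · have hle : ¬ Finsupp.single m 1 ≤ ν := fun hle =>
              hν (coeff_modMonomial_of_le _ hle)
            have hj' := hc i hi ν (by rwa [← coeff_modMonomial_of_not_le _ hle]) j hj
            have : j ≠ m := by
              rintro rfl
              exact hle (Finsupp.single_le_iff.2
                (Nat.one_le_iff_ne_zero.2 (Finsupp.mem_support_iff.1 hj)))
            omega
          · have := sub_mem (sup_le_sup_left (linIdeal_mono (Nat.le_succ m)) _ h)
              (Ideal.mem_sup_right (S := J) (Ideal.mul_mem_right
                (∑ i ∈ s, aeval (fun j => linForm X₀ (r j)) (c₁ i) * b i) _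
                (linForm_mem_linIdeal (r := r) (X₀ := X₀) (Nat.lt_succ_self m))))
            rwa [e, add_sub_cancel_left] at this
        rw [e, Finset.sum_eq_zero (s := s) (f := fun i =>
          aeval (fun j => linForm X₀ (r j)) (c₀ i) * b i) fun i hi => by
            rw [h₀ i hi, map_zero, zero_mul], add_zero] at h
        have hcoeff : ∀ i ν, coeff ν (c₁ i) = coeff (Finsupp.single m 1 + ν) (c i) := fun i ν =>
          coeff_divMonomial _ _ _
        have h₁ := ihD c₁ (fun i hi ν hν => by
            have := hD i hi _ (hcoeff i ν ▸ hν)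
            rw [map_add, Finsupp.degree_single] at this
            omega)
          (fun i hi ν hν j hj => hc i hi _ (hcoeff i ν ▸ hν) j (by
            rw [Finsupp.mem_support_iff] at hj ⊢
            rw [Finsupp.add_apply]
            omega)) (hreg m (by omega) _ h)
        intro i hi
        rw [hsplit i, h₀ i hi, h₁ i hi, mul_zero, add_zero]
    intro c hc h
    refine key (s.sup (fun i => (c i).totalDegree) + 1) c (fun i hi ν hν => ?_) hc h
    have h1 := le_totalDegree (mem_support_iff.2 hν)
    have h2 := Finset.le_sup (f := fun i => (c i).totalDegree) hi
    have h3 : ν.degree = ν.sum fun _ e => e := rfl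
    omega

/-- Elements independent modulo a weakly regular sequence remain independent over the polynomial
ring generated by the sequence. -/
theorem IsWeaklyRegularMod.eq_zero (hreg : IsWeaklyRegularMod J X₀ r N) {β : Type*}
    {s : Finset β} {b : β → MvPolynomial V k}
    (hb : ∀ t : β → k, ∑ i ∈ s, C (t i) * b i ∈ J ⊔ linIdeal X₀ r N → ∀ i ∈ s, t i = 0)
    {c : β → MvPolynomial ℕ k} (hc : ∀ i ∈ s, ∀ ν, coeff ν (c i) ≠ 0 → ∀ j ∈ ν.support, j < N)
    (h : ∑ i ∈ s, aeval (fun j => linForm X₀ (r j)) (c i) * b i ∈ J) {i : β} (hi : i ∈ s) :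
    c i = 0 :=
  hreg.eq_zero_of_mem_sup hb N 0 (zero_add N) c
    (fun i hi ν hν j hj => ⟨Nat.zero_le _, hc i hi ν hν j hj⟩) (Ideal.mem_sup_left h) i hi

end Freeness

section BasisMonomials

open MvPolynomial

theorem restrictVars_toCoords {V k : Type*} [DecidableEq V] [Field k] (A : Finset V)
    (M : V → ℕ → k) (p : MvPolynomial V k) :
    restrictVars k (Finset.range A.card) (IsSquareInverse.toCoords A M p) =
      IsSquareInverse.toCoords A M p := by
  have : (restrictVars k (Finset.range A.card)).comp (IsSquareInverse.toCoords A M) =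
      IsSquareInverse.toCoords A M := by
    refine algHom_ext fun v => ?_
    rw [AlgHom.comp_apply, IsSquareInverse.toCoords, aeval_X]
    split_ifs
    · rw [map_sum]
      refine Finset.sum_congr rfl fun j hj => ?_
      rw [map_mul, restrictVars_X, if_pos hj, ← algebraMap_eq, AlgHom.commutes]
    · exact map_zero _
  exact DFunLike.congr_fun this p

theorem lt_card_of_coeff_toCoords_ne_zero {V k : Type*} [DecidableEq V] [Field k] {A : Finset V}
    {M : V → ℕ → k} {p : MvPolynomial V k} {ν : ℕ →₀ ℕ}
    (h : coeff ν (IsSquareInverse.toCoords A M p) ≠ 0) {j : ℕ} (hj : j ∈ ν.support) :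
    j < A.card := by
  rw [← restrictVars_toCoords, coeff_restrictVars] at h
  split_ifs at h with hν
  · exact Finset.mem_range.1 (hν hj)
  · exact absurd rfl h

variable {n : ℕ} {k : Type*} [Field k] {S : SimplicialFan n} {a : Fin n → (Fin n → ℝ) → k}
  {E : Finset (Fin n → ℝ)}

/-- The support of a monomial relative to `E`. -/
def monoSupp (E : Finset (Fin n → ℝ)) (μ : (Fin n → ℝ) →₀ ℕ) : Finset (Fin n) :=
  suppSet (μ.support ∪ E)

namespace SimplicialFan

theorem monomial_mem_starIdeal {μ : (Fin n → ℝ) →₀ ℕ} {U : Finset (Fin n)}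
    (h : ¬monoSupp E μ ⊆ U) (c : k) : monomial μ c ∈ S.starIdeal k E U := by
  rw [mem_starIdeal]
  intro ν _ h2
  rw [coeff_monomial, if_neg]
  rintro rfl
  exact h h2

open IsSystem in
theorem exists_basis (S : SimplicialFan n) (a : Fin n → (Fin n → ℝ) → k)
    (E : Finset (Fin n → ℝ)) (U : Finset (Fin n)) :
    ∃ B ⊆ {μ : (Fin n → ℝ) →₀ ℕ | μ.support ∪ E ∈ S.faces ∧ monoSupp E μ = U},
      (∀ μ : (Fin n → ℝ) →₀ ℕ, μ.support ∪ E ∈ S.faces → monoSupp E μ = U →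
        ∃ p ∈ Submodule.span k ((fun μ => monomial μ (1 : k)) '' B),
          monomial μ 1 - p ∈ S.starIdeal k E U ⊔ linearIdeal S a) ∧
      ∀ (s : Finset ((Fin n → ℝ) →₀ ℕ)) (t : ((Fin n → ℝ) →₀ ℕ) → k), ↑s ⊆ B →
        ∑ μ ∈ s, C (t μ) * monomial μ 1 ∈ S.starIdeal k E U ⊔ linearIdeal S a →
        ∀ μ ∈ s, t μ = 0 := by
  set I := (S.starIdeal k E U ⊔ linearIdeal S a).restrictScalars k with hI
  obtain ⟨B, hB, -, hspan, hli⟩ := exists_linearIndepOn_extension (K := k)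
    (v := fun μ : (Fin n → ℝ) →₀ ℕ => I.mkQ (monomial μ 1))
    (linearIndepOn_empty k _) (Set.empty_subset
      {μ : (Fin n → ℝ) →₀ ℕ | μ.support ∪ E ∈ S.faces ∧ monoSupp E μ = U})
  refine ⟨B, hB, fun μ h1 h2 => ?_, fun s t hs h => ?_⟩
  · have h := hspan (Set.mem_image_of_mem _ ⟨h1, h2⟩)
    rw [show (fun μ : (Fin n → ℝ) →₀ ℕ => I.mkQ (monomial μ 1)) '' B =
      I.mkQ '' ((fun μ => monomial μ (1 : k)) '' B) by rw [Set.image_image],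
      ← Submodule.map_span] at h
    obtain ⟨p, hp, e⟩ := h
    refine ⟨p, hp, ?_⟩
    rw [Submodule.mkQ_apply, Submodule.mkQ_apply, eq_comm, Submodule.Quotient.eq] at e
    exact e
  · refine linearIndepOn_iff'.1 hli s t hs ?_
    have : ∑ μ ∈ s, t μ • I.mkQ (monomial μ 1) = I.mkQ (∑ μ ∈ s, C (t μ) * monomial μ 1) := by
      rw [map_sum]
      refine Finset.sum_congr rfl fun μ _ => ?_
      rw [C_mul', map_smul]
    rw [this, Submodule.mkQ_apply, Submodule.Quotient.mk_eq_zero]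
    exact h

/-- Monomials which for each `U` form a basis of the interior part of the quotient by the
linear system. -/
def basisMonos (S : SimplicialFan n) (a : Fin n → (Fin n → ℝ) → k)
    (E : Finset (Fin n → ℝ)) : Set ((Fin n → ℝ) →₀ ℕ) :=
  {μ | μ ∈ (S.exists_basis a E (monoSupp E μ)).choose}

theorem choose_subset_basisMonos (U : Finset (Fin n)) {μ : (Fin n → ℝ) →₀ ℕ}
    (h : μ ∈ (S.exists_basis a E U).choose) : μ ∈ S.basisMonos a E ∧ monoSupp E μ = U := by
  have e := ((S.exists_basis a E U).choose_spec.1 h).2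
  refine ⟨?_, e⟩
  change μ ∈ (S.exists_basis a E (monoSupp E μ)).choose
  rwa [e]

open IsSystem in
theorem exists_sub_mem_of_monoSupp_eq {μ : (Fin n → ℝ) →₀ ℕ} {U : Finset (Fin n)}
    (h : μ.support ∪ E ∈ S.faces) (hU : monoSupp E μ = U) :
    ∃ p ∈ Submodule.span k ((fun μ => monomial μ (1 : k)) ''
      {μ | μ ∈ S.basisMonos a E ∧ monoSupp E μ = U}),
      monomial μ 1 - p ∈ S.starIdeal k E U ⊔ linearIdeal S a := by
  obtain ⟨p, hp, h⟩ := (S.exists_basis a E U).choose_spec.2.1 μ h hU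
  exact ⟨p, Submodule.span_mono (Set.image_mono fun ν hν => choose_subset_basisMonos U hν) hp, h⟩

open IsSystem in
theorem eq_zero_of_sum_mem_sup {U : Finset (Fin n)} {s : Finset ((Fin n → ℝ) →₀ ℕ)}
    {t : ((Fin n → ℝ) →₀ ℕ) → k} (hs : ∀ μ ∈ s, μ ∈ S.basisMonos a E ∧ monoSupp E μ ⊆ U)
    (h : ∑ μ ∈ s, C (t μ) * monomial μ 1 ∈ S.starIdeal k E U ⊔ linearIdeal S a) :
    ∀ μ ∈ s, t μ = 0 := by
  have key : ∀ d : ℕ, ∀ μ ∈ s, (monoSupp E μ).card = d → t μ = 0 := by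
    intro d
    induction d using Nat.strong_induction_on with
    | _ d ih =>
      intro μ hμ hd
      set U' := monoSupp E μ with hU'
      refine (S.exists_basis a E U').choose_spec.2.2 (s.filter fun ν => monoSupp E ν = U') t
        (fun ν hν => ?_) ?_ μ (Finset.mem_filter.2 ⟨hμ, rfl⟩)
      · obtain ⟨h1, h2⟩ := Finset.mem_filter.1 hν
        have := (hs ν h1).1
        change ν ∈ (S.exists_basis a E (monoSupp E ν)).choose at this
        rwa [h2] at this
      · have h' := sup_le_sup_right (starIdeal_mono subset_rfl (hs μ hμ).2) (linearIdeal S a) h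
        rw [← Finset.sum_filter_add_sum_filter_not s fun ν => monoSupp E ν = U'] at h'
        refine (Submodule.add_mem_iff_left _ (sum_mem fun ν hν => ?_)).1 h'
        obtain ⟨h1, h2⟩ := Finset.mem_filter.1 hν
        by_cases hsub : monoSupp E ν ⊆ U'
        · rw [ih _ (hd ▸ Finset.card_lt_card (hsub.ssubset_of_ne h2)) ν h1 rfl, C_0, zero_mul]
          exact zero_mem _
        · exact Ideal.mem_sup_left (Ideal.mul_mem_left _ _ (monomial_mem_starIdeal hsub 1))
  exact fun μ hμ => key _ μ hμ rfl

/-- Basis monomials are independent over the polynomial ring in a generic sequence. -/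
theorem IsSystem.eq_zero_of_sum_mem [CharP k 2] (ha : S.IsSystem a) {U : Finset (Fin n)}
    {y : ℕ → Fin n → k} {M : Fin n → ℕ → k} (hM : IsSquareInverse U y M)
    (hy : ∀ F ∈ S.faces, suppSet F ⊆ U →
      ∃ M, IsSquareInverse F (fun j v => ∑ i ∈ U, y j i * a i v) M)
    {s : Finset ((Fin n → ℝ) →₀ ℕ)} (hs : ∀ μ ∈ s, μ ∈ S.basisMonos a E ∧ monoSupp E μ ⊆ U)
    {c : ((Fin n → ℝ) →₀ ℕ) → MvPolynomial ℕ k}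
    (hc : ∀ μ ∈ s, ∀ ν, coeff ν (c μ) ≠ 0 → ∀ j ∈ ν.support, j < U.card)
    (h : ∑ μ ∈ s, aeval (fun j => linForm S.verts fun v => ∑ i ∈ U, y j i * a i v) (c μ) *
      monomial μ 1 ∈ S.starIdeal k E U) {μ : (Fin n → ℝ) →₀ ℕ} (hμ : μ ∈ s) : c μ = 0 :=
  (isWeaklyRegularMod E U hy).eq_zero (fun t ht => eq_zero_of_sum_mem_sup hs (by
    rwa [ha.sup_linIdeal_eq hM] at ht)) hc h hμ

/-- The product of a monomial in the linear system with a monomial in the vertices. -/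
def systemMono (S : SimplicialFan n) (a : Fin n → (Fin n → ℝ) → k)
    (x : (Fin n →₀ ℕ) × ((Fin n → ℝ) →₀ ℕ)) : MvPolynomial (Fin n → ℝ) k :=
  aeval (fun i => linForm S.verts (a i)) (monomial x.1 (1 : k)) * monomial x.2 1

/-- The support of a product of linear forms and vertices. -/
def systemSupp (E : Finset (Fin n → ℝ)) (x : (Fin n →₀ ℕ) × ((Fin n → ℝ) →₀ ℕ)) : Finset (Fin n) :=
  x.1.support ∪ monoSupp E x.2

theorem IsSystem.aeval_toCoords {U : Finset (Fin n)}
    {y : ℕ → Fin n → k} {M : Fin n → ℕ → k} (hM : IsSquareInverse U y M)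
    (p : MvPolynomial (Fin n) k) :
    aeval (fun j => linForm S.verts fun v => ∑ i ∈ U, y j i * a i v)
      (IsSquareInverse.toCoords U M p) =
      aeval (fun i => linForm S.verts (a i)) (restrictVars k U p) := by
  rw [← hM.aeval_toCoords p]
  have : aeval (fun j => linForm S.verts fun v => ∑ i ∈ U, y j i * a i v) =
      (aeval fun i => linForm S.verts (a i)).comp (aeval (R := k) fun j => linForm U (y j)) := by
    refine algHom_ext fun j => ?_
    rw [AlgHom.comp_apply, aeval_X, aeval_X, linForm_sum, linForm, map_sum]
    refine Finset.sum_congr rfl fun i _ => ?_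
    rw [map_mul, aeval_X, aeval_C]
    rfl
  rw [this]
  rfl

theorem IsSystem.eq_zero_of_linearCombination_mem [CharP k 2] [Infinite k] (ha : S.IsSystem a)
    {U : Finset (Fin n)} {lam : (Fin n →₀ ℕ) × ((Fin n → ℝ) →₀ ℕ) →₀ k}
    (hlam : ∀ x ∈ lam.support, x.2 ∈ S.basisMonos a E ∧ systemSupp E x ⊆ U)
    (h : Finsupp.linearCombination k (S.systemMono a) lam ∈ S.starIdeal k E U) : lam = 0 := by
  obtain ⟨y, ⟨M, hM⟩, hy⟩ := ha.exists_sequence U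
  set P : ((Fin n → ℝ) →₀ ℕ) → MvPolynomial (Fin n) k := fun μ =>
    ∑ x ∈ lam.support with x.2 = μ, monomial x.1 (lam x) with hP
  have hPU : ∀ μ, restrictVars k U (P μ) = P μ := by
    intro μ
    rw [hP]
    dsimp only
    rw [map_sum]
    refine Finset.sum_congr rfl fun x hx => ?_
    rw [restrictVars_monomial, if_pos (Finset.subset_union_left.trans
      (hlam x (Finset.mem_filter.1 hx).1).2)]
  have hsum : Finsupp.linearCombination k (S.systemMono a) lam =
      ∑ μ ∈ lam.support.image Prod.snd, aeval (fun j => linForm S.verts fun v =>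
        ∑ i ∈ U, y j i * a i v) (IsSquareInverse.toCoords U M (P μ)) * monomial μ 1 := by
    rw [Finsupp.linearCombination_apply, Finsupp.sum,
      ← Finset.sum_fiberwise_of_maps_to (t := lam.support.image Prod.snd) (g := Prod.snd)
        fun x hx => Finset.mem_image_of_mem _ hx]
    refine Finset.sum_congr rfl fun μ _ => ?_
    rw [IsSystem.aeval_toCoords hM, hPU, hP]
    dsimp only
    rw [map_sum, Finset.sum_mul]
    refine Finset.sum_congr rfl fun x hx => ?_
    obtain rfl := (Finset.mem_filter.1 hx).2
    rw [systemMono, ← smul_mul_assoc, ← map_smul, smul_monomial, smul_eq_mul, mul_one]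
  rw [hsum] at h
  ext x
  by_contra hx
  have hx' : x ∈ lam.support := Finsupp.mem_support_iff.2 hx
  have h0 := ha.eq_zero_of_sum_mem hM hy (fun μ hμ => by
    obtain ⟨x, hx, rfl⟩ := Finset.mem_image.1 hμ
    exact ⟨(hlam x hx).1, Finset.subset_union_right.trans (hlam x hx).2⟩)
    (fun μ _ ν hν j hj => lt_card_of_coeff_toCoords_ne_zero hν hj) h
    (Finset.mem_image_of_mem Prod.snd hx')
  rw [hM.ker_toCoords, hPU] at h0
  have := congrArg (coeff x.1) h0
  rw [hP] at this
  dsimp only at this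
  rw [coeff_sum, Finset.sum_eq_single x] at this
  · rw [coeff_monomial, if_pos rfl] at this
    exact hx this
  · intro z hz hzx
    rw [coeff_monomial, if_neg]
    exact fun h => hzx (Prod.ext h (Finset.mem_filter.1 hz).2)
  · exact fun h => (h (Finset.mem_filter.2 ⟨hx', rfl⟩)).elim

theorem IsSystem.systemMono_mem (ha : S.IsSystem a) {U : Finset (Fin n)}
    {x : (Fin n →₀ ℕ) × ((Fin n → ℝ) →₀ ℕ)} (h : ¬systemSupp E x ⊆ U) :
    S.systemMono a x ∈ S.starIdeal k E U := by
  rw [systemSupp, Finset.union_subset_iff, not_and_or] at h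
  rcases h with h | h
  · obtain ⟨i, hi, hiU⟩ := Finset.not_subset.1 h
    refine Ideal.mul_mem_right _ _ ?_
    rw [aeval_monomial, map_one, one_mul, Finsupp.prod]
    refine Ideal.mem_of_dvd _ (Finset.dvd_prod_of_mem _ hi) ?_
    exact Ideal.pow_mem_of_mem _ (ha.linForm_mem hiU) _
      (Nat.pos_of_ne_zero (Finsupp.mem_support_iff.1 hi))
  · exact Ideal.mul_mem_left _ _ (monomial_mem_starIdeal h 1)

end SimplicialFan

end BasisMonomials

section Spanning

open MvPolynomial

variable {n : ℕ} {k : Type*} [Field k] {S : SimplicialFan n} {a : Fin n → (Fin n → ℝ) → k}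
  {E : Finset (Fin n → ℝ)}

theorem linForm_isHomogeneous {V : Type*} (X₀ : Finset V) (r : V → k) :
    (linForm X₀ r).IsHomogeneous 1 :=
  IsHomogeneous.sum _ _ _ fun v _ => isHomogeneous_C_mul_X _ v

theorem homogeneousComponent_mul_of_isHomogeneous {V : Type*} {p q : MvPolynomial V k} {m : ℕ}
    (hq : q.IsHomogeneous m) (d : ℕ) :
    homogeneousComponent d (p * q) =
      ∑ e ∈ Finset.range (p.totalDegree + 1),
        if e + m = d then homogeneousComponent e p * q else 0 := by
  conv_lhs => rw [← sum_homogeneousComponent p, Finset.sum_mul, map_sum]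
  refine Finset.sum_congr rfl fun e _ => ?_
  rw [homogeneousComponent_of_mem (m := d) ((mem_homogeneousSubmodule _ _).2
    ((homogeneousComponent_isHomogeneous e p).mul hq))]
  simp only [eq_comm]

namespace SimplicialFan

theorem monomial_mem_starIdeal_of_notMem {μ : (Fin n → ℝ) →₀ ℕ} {U : Finset (Fin n)}
    (h : μ.support ∪ E ∉ S.faces) (c : k) : monomial μ c ∈ S.starIdeal k E U := by
  rw [mem_starIdeal]
  intro ν h1 _
  rw [coeff_monomial, if_neg]
  rintro rfl
  exact h h1

theorem homogeneousComponent_mem_starIdeal {U : Finset (Fin n)} {p : MvPolynomial (Fin n → ℝ) k}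
    (h : p ∈ S.starIdeal k E U) (d : ℕ) : homogeneousComponent d p ∈ S.starIdeal k E U := by
  rw [mem_starIdeal] at h ⊢
  intro μ h1 h2
  rw [coeff_homogeneousComponent, h μ h1 h2, ite_self]

theorem systemMono_isHomogeneous (x : (Fin n →₀ ℕ) × ((Fin n → ℝ) →₀ ℕ)) :
    (S.systemMono a x).IsHomogeneous (x.1.degree + x.2.degree) := by
  refine IsHomogeneous.mul ?_ (isHomogeneous_monomial _ rfl)
  have := (isHomogeneous_monomial (R := k) (1 : k) (rfl : x.1.degree = _)).aeval
    (fun i => linForm S.verts (a i)) (n := 1) fun i => linForm_isHomogeneous _ _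
  rwa [one_mul] at this

/-- Indices of products of linear forms and basis monomials with support in `U`. -/
def systemIndex (S : SimplicialFan n) (a : Fin n → (Fin n → ℝ) → k)
    (E : Finset (Fin n → ℝ)) (U : Finset (Fin n)) : Set ((Fin n →₀ ℕ) × ((Fin n → ℝ) →₀ ℕ)) :=
  {x | x.2 ∈ S.basisMonos a E ∧ systemSupp E x ⊆ U}

/-- The span of the products of linear forms and basis monomials, modulo the face ideal. -/
def systemSpan (S : SimplicialFan n) (a : Fin n → (Fin n → ℝ) → k)
    (E : Finset (Fin n → ℝ)) (U : Finset (Fin n)) : Submodule k (MvPolynomial (Fin n → ℝ) k) :=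
  Submodule.span k (S.systemMono a '' S.systemIndex a E U) ⊔
    (S.starIdeal k E U).restrictScalars k

theorem mem_systemSpan {U : Finset (Fin n)} {f : MvPolynomial (Fin n → ℝ) k} :
    f ∈ S.systemSpan a E U ↔ ∃ lam : (Fin n →₀ ℕ) × ((Fin n → ℝ) →₀ ℕ) →₀ k,
      (∀ x ∈ lam.support, x ∈ S.systemIndex a E U) ∧
      f - Finsupp.linearCombination k (S.systemMono a) lam ∈ S.starIdeal k E U := by
  rw [systemSpan, Submodule.mem_sup]
  constructor
  · rintro ⟨y, hy, z, hz, rfl⟩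
    obtain ⟨lam, h, rfl⟩ := (Finsupp.mem_span_image_iff_linearCombination k).1 hy
    exact ⟨lam, fun x hx => h hx, by rwa [add_sub_cancel_left]⟩
  · rintro ⟨lam, h1, h2⟩
    exact ⟨_, (Finsupp.mem_span_image_iff_linearCombination k).2 ⟨lam, fun x hx => h1 x hx, rfl⟩,
      _, h2, add_sub_cancel _ _⟩

theorem starIdeal_le_systemSpan {U : Finset (Fin n)} {f : MvPolynomial (Fin n → ℝ) k}
    (h : f ∈ S.starIdeal k E U) : f ∈ S.systemSpan a E U :=
  Submodule.mem_sup_right h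

theorem homogeneousComponent_mem_systemSpan {U : Finset (Fin n)}
    {f : MvPolynomial (Fin n → ℝ) k} (h : f ∈ S.systemSpan a E U) (d : ℕ) :
    homogeneousComponent d f ∈ S.systemSpan a E U := by
  obtain ⟨y, hy, z, hz, rfl⟩ := Submodule.mem_sup.1 h
  rw [map_add]
  refine add_mem ?_ (starIdeal_le_systemSpan (homogeneousComponent_mem_starIdeal hz d))
  clear h
  induction hy using Submodule.span_induction with
  | mem y hy =>
    obtain ⟨x, hx, rfl⟩ := hy
    rw [homogeneousComponent_of_mem (m := d) ((mem_homogeneousSubmodule _ _).2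
      (systemMono_isHomogeneous x))]
    split_ifs
    · exact Submodule.mem_sup_left (Submodule.subset_span ⟨x, hx, rfl⟩)
    · exact zero_mem _
  | zero => rw [map_zero]; exact zero_mem _
  | add y y' _ _ h h' => rw [map_add]; exact add_mem h h'
  | smul c y _ h => rw [map_smul]; exact Submodule.smul_mem _ _ h

namespace IsSystem

theorem mul_linForm_mem_systemSpan (ha : S.IsSystem a) {U : Finset (Fin n)}
    {f : MvPolynomial (Fin n → ℝ) k} (h : f ∈ S.systemSpan a E U) (i : Fin n) :
    f * linForm S.verts (a i) ∈ S.systemSpan a E U := by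
  by_cases hi : i ∈ U
  · obtain ⟨y, hy, z, hz, rfl⟩ := Submodule.mem_sup.1 h
    rw [add_mul]
    refine add_mem ?_ (starIdeal_le_systemSpan (Ideal.mul_mem_right _ _ hz))
    clear h
    induction hy using Submodule.span_induction with
    | mem y hy =>
      obtain ⟨x, hx, rfl⟩ := hy
      refine Submodule.mem_sup_left (Submodule.subset_span
        ⟨(x.1 + Finsupp.single i 1, x.2), ⟨hx.1, ?_⟩, ?_⟩)
      · refine Finset.union_subset (Finsupp.support_add.trans (Finset.union_subset
          (Finset.subset_union_left.trans hx.2) ?_)) (Finset.subset_union_right.trans hx.2)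
        exact Finsupp.support_single_subset.trans (Finset.singleton_subset_iff.2 hi)
      · rw [systemMono, systemMono, ← mul_one (1 : k), ← monomial_mul, map_mul, mul_one,
          show (monomial (Finsupp.single i 1)) (1 : k) = X i from rfl, aeval_X]
        ring
    | zero => rw [zero_mul]; exact zero_mem _
    | add y y' _ _ h h' => rw [add_mul]; exact add_mem h h'
    | smul c y _ h => rw [smul_mul_assoc]; exact Submodule.smul_mem _ _ h
  · exact starIdeal_le_systemSpan (Ideal.mul_mem_left _ _ (ha.linForm_mem hi))

theorem linearCombination_mem (ha : S.IsSystem a) {U : Finset (Fin n)}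
    {lam : (Fin n →₀ ℕ) × ((Fin n → ℝ) →₀ ℕ) →₀ k}
    (h : ∀ x ∈ lam.support, ¬systemSupp E x ⊆ U) :
    Finsupp.linearCombination k (S.systemMono a) lam ∈ S.starIdeal k E U := by
  rw [Finsupp.linearCombination_apply]
  refine Submodule.sum_mem _ fun x hx => ?_
  dsimp only
  rw [← C_mul']
  exact Ideal.mul_mem_left _ _ (ha.systemMono_mem (h x hx))

/-- The terms supported in `U` of a representation are determined modulo the face ideal. -/
theorem filter_eq [CharP k 2] [Infinite k] (ha : S.IsSystem a) {U : Finset (Fin n)}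
    {f : MvPolynomial (Fin n → ℝ) k} {lam lam' : (Fin n →₀ ℕ) × ((Fin n → ℝ) →₀ ℕ) →₀ k}
    (hlam : ∀ x ∈ lam.support, x.2 ∈ S.basisMonos a E)
    (hlam' : ∀ x ∈ lam'.support, x ∈ S.systemIndex a E U)
    (h : f - Finsupp.linearCombination k (S.systemMono a) lam ∈ S.starIdeal k E U)
    (h' : f - Finsupp.linearCombination k (S.systemMono a) lam' ∈ S.starIdeal k E U) :
    lam.filter (fun x => systemSupp E x ⊆ U) = lam' := by
  rw [← sub_eq_zero]
  refine ha.eq_zero_of_linearCombination_mem (E := E) (U := U) (fun x hx => ?_) ?_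
  · rcases Finset.mem_union.1 (Finsupp.support_sub hx) with hx | hx
    · rw [Finsupp.support_filter, Finset.mem_filter] at hx
      exact ⟨hlam x hx.1, hx.2⟩
    · exact hlam' x hx
  · have h0 := ha.linearCombination_mem (E := E) (U := U)
      (lam := lam.filter fun x => ¬systemSupp E x ⊆ U) fun x hx => by
        rw [Finsupp.support_filter, Finset.mem_filter] at hx
        exact hx.2
    rw [← Finsupp.filter_add_filter_not lam fun x => systemSupp E x ⊆ U, map_add] at h
    have := sub_mem (sub_mem h' h) h0
    rw [map_sub]
    convert this using 1
    ring

/-- Representations modulo the smaller face ideals glue. -/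
theorem exists_glue [CharP k 2] [Infinite k] (ha : S.IsSystem a) {U : Finset (Fin n)}
    {f : MvPolynomial (Fin n → ℝ) k} (hf : ∀ U₁ ⊂ U, f ∈ S.systemSpan a E U₁) :
    ∃ lam : (Fin n →₀ ℕ) × ((Fin n → ℝ) →₀ ℕ) →₀ k,
      (∀ x ∈ lam.support, x ∈ S.systemIndex a E U) ∧ ∀ U₁ ⊂ U,
        f - Finsupp.linearCombination k (S.systemMono a) lam ∈ S.starIdeal k E U₁ := by
  choose! L hL hfL using fun U₁ h => mem_systemSpan.1 (hf U₁ h)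
  set lam := ∑ U₁ ∈ U.ssubsets, (L U₁).filter fun x => systemSupp E x = U₁ with hlam
  have hval : ∀ x, lam x = if systemSupp E x ⊂ U then L (systemSupp E x) x else 0 := by
    intro x
    rw [hlam, Finsupp.finsetSum_apply]
    simp only [Finsupp.filter_apply]
    rw [Finset.sum_ite_eq]
    simp only [Finset.mem_ssubsets]
  have hsupp : ∀ x ∈ lam.support, systemSupp E x ⊂ U ∧ x.2 ∈ S.basisMonos a E := by
    intro x hx
    rw [Finsupp.mem_support_iff, hval] at hx
    split_ifs at hx with h
    · exact ⟨h, (hL _ h x (Finsupp.mem_support_iff.2 hx)).1⟩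
    · exact absurd rfl hx
  refine ⟨lam, fun x hx => ⟨(hsupp x hx).2, (hsupp x hx).1.1⟩, fun U₁ hU₁ => ?_⟩
  have hfilter : lam.filter (fun x => systemSupp E x ⊆ U₁) = L U₁ := by
    ext x
    rw [Finsupp.filter_apply]
    split_ifs with hx
    · have hxU := hx.trans_ssubset hU₁
      rw [hval, if_pos hxU]
      rw [← ha.filter_eq (fun x hx => (hL _ hU₁ x hx).1) (hL _ hxU)
        (starIdeal_mono subset_rfl hx (hfL _ hU₁)) (hfL _ hxU), Finsupp.filter_apply,
        if_pos subset_rfl]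
    · by_contra h
      exact hx (hL _ hU₁ x (Finsupp.mem_support_iff.2 (Ne.symm h))).2
  have h0 := ha.linearCombination_mem (E := E) (U := U₁)
    (lam := lam.filter fun x => ¬systemSupp E x ⊆ U₁) fun x hx => by
      rw [Finsupp.support_filter, Finset.mem_filter] at hx
      exact hx.2
  rw [← Finsupp.filter_add_filter_not lam fun x => systemSupp E x ⊆ U₁, map_add, hfilter,
    ← sub_sub]
  exact sub_mem (hfL U₁ hU₁) h0

theorem mem_systemSpan_sup [CharP k 2] [Infinite k] (ha : S.IsSystem a) {U : Finset (Fin n)}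
    (hU : ∀ U₁ ⊂ U, S.systemSpan a E U₁ = ⊤) (f : MvPolynomial (Fin n → ℝ) k) :
    f ∈ S.systemSpan a E U ⊔ (linearIdeal S a).restrictScalars k := by
  obtain ⟨lam, hlam, hg⟩ := ha.exists_glue (E := E) (U := U) (f := f)
    fun U₁ h => hU U₁ h ▸ Submodule.mem_top
  set g := f - Finsupp.linearCombination k (S.systemMono a) lam with hgdef
  rw [← sub_add_cancel f (Finsupp.linearCombination k (S.systemMono a) lam), ← hgdef]
  refine add_mem ?_ (Submodule.mem_sup_left (Submodule.mem_sup_left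
    ((Finsupp.mem_span_image_iff_linearCombination k).2 ⟨lam, fun x hx => hlam x hx, rfl⟩)))
  rw [g.as_sum]
  refine sum_mem fun ν hν => ?_
  by_cases hface : ν.support ∪ E ∈ S.faces
  swap
  · exact Submodule.mem_sup_left (starIdeal_le_systemSpan
      (monomial_mem_starIdeal_of_notMem hface _))
  by_cases hsub : monoSupp E ν ⊆ U
  swap
  · exact Submodule.mem_sup_left (starIdeal_le_systemSpan (monomial_mem_starIdeal hsub _))
  rcases eq_or_ne (monoSupp E ν) U with h | h
  · obtain ⟨p, hp, hpm⟩ := exists_sub_mem_of_monoSupp_eq (a := a) hface h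
    rw [← mul_one (coeff ν g), ← smul_eq_mul, ← smul_monomial]
    refine Submodule.smul_mem _ _ ?_
    rw [← sub_add_cancel (monomial ν (1 : k)) p]
    refine add_mem ?_ (Submodule.mem_sup_left (Submodule.mem_sup_left ?_))
    · obtain ⟨y, hy, z, hz, e⟩ := Submodule.mem_sup.1 hpm
      rw [← e]
      exact Submodule.add_mem_sup (starIdeal_le_systemSpan hy) hz
    · refine Submodule.span_le.2 ?_ hp
      rintro _ ⟨μ, ⟨h1, h2⟩, rfl⟩
      refine Submodule.subset_span ⟨(0, μ), ⟨h1, ?_⟩, ?_⟩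
      · simp [systemSupp, h2]
      · simp [systemMono]
  · rw [mem_support_iff] at hν
    exact absurd (mem_starIdeal.1 (hg _ (hsub.ssubset_of_ne h)) ν hface subset_rfl) hν

theorem systemSpan_eq_top [CharP k 2] [Infinite k] (ha : S.IsSystem a)
    (E : Finset (Fin n → ℝ)) (U : Finset (Fin n)) : S.systemSpan a E U = ⊤ := by
  induction U using Finset.strongInduction with
  | _ U hU =>
  have key : ∀ d : ℕ, ∀ f, homogeneousComponent d f ∈ S.systemSpan a E U := by
    intro d
    induction d using Nat.strong_induction_on with
    | _ d ih =>
    intro f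
    obtain ⟨t, ht, s, hs, rfl⟩ := Submodule.mem_sup.1 (ha.mem_systemSpan_sup hU f)
    obtain ⟨c, rfl⟩ := Ideal.mem_span_range_iff_exists_fun.1 hs
    rw [map_add, map_sum]
    refine add_mem (homogeneousComponent_mem_systemSpan ht d) (sum_mem fun i _ => ?_)
    rw [homogeneousComponent_mul_of_isHomogeneous (linForm_isHomogeneous _ _)]
    refine sum_mem fun e _ => ?_
    split_ifs with he
    · exact ha.mul_linForm_mem_systemSpan (ih e (by omega) _) i
    · exact zero_mem _
  rw [eq_top_iff]
  rintro f -
  rw [← sum_homogeneousComponent f]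
  exact sum_mem fun d _ => key d f

end IsSystem

end SimplicialFan

end Spanning

section Counting

open MvPolynomial

/-- Restriction to the first `N` variables. -/
def truncVars (k : Type*) [Field k] (N : ℕ) : MvPolynomial ℕ k →ₐ[k] MvPolynomial (Fin N) k :=
  aeval fun j => if h : j < N then X ⟨j, h⟩ else 0

theorem rename_truncVars {k : Type*} [Field k] (N : ℕ) (p : MvPolynomial ℕ k) :
    rename Fin.val (truncVars k N p) = restrictVars k (Finset.range N) p := by
  have : (rename Fin.val).comp (truncVars k N) = restrictVars k (Finset.range N) := by
    refine algHom_ext fun j => ?_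
    rw [AlgHom.comp_apply, truncVars, aeval_X, restrictVars_X]
    by_cases h : j < N
    · rw [dif_pos h, if_pos (Finset.mem_range.2 h), rename_X]
    · rw [dif_neg h, if_neg (by simpa using h), map_zero]
  exact DFunLike.congr_fun this p

section FaceCoords

variable {V k : Type*} [DecidableEq V] [Field k] {A : Finset V} {r : ℕ → V → k} {M : V → ℕ → k}

/-- The restriction of a polynomial to a face, in the coordinates given by linear forms. -/
def faceCoords (A : Finset V) (M : V → ℕ → k) (N : ℕ) :
    MvPolynomial V k →ₐ[k] MvPolynomial (Fin N) k :=
  (truncVars k N).comp (IsSquareInverse.toCoords A M)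

theorem rename_faceCoords (p : MvPolynomial V k) {N : ℕ} (hN : A.card = N) :
    rename Fin.val (faceCoords A M N p) = IsSquareInverse.toCoords A M p := by
  subst hN
  rw [faceCoords, AlgHom.comp_apply, rename_truncVars, restrictVars_toCoords]

namespace IsSquareInverse

theorem faceCoords_eq_zero_iff (h : IsSquareInverse A r M) {N : ℕ} (hN : A.card = N)
    {p : MvPolynomial V k} : faceCoords A M N p = 0 ↔ restrictVars k A p = 0 := by
  rw [← h.ker_toCoords, ← rename_faceCoords p hN, ← map_zero (rename (R := k) (Fin.val (n := N)))]
  exact (rename_injective _ Fin.val_injective).eq_iff.symm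

theorem toCoords_restrictVars (h : IsSquareInverse A r M) (p : MvPolynomial V k) :
    toCoords A M (restrictVars k A p) = toCoords A M p := by
  rw [← sub_eq_zero, ← map_sub, h.ker_toCoords, map_sub, restrictVars_restrictVars subset_rfl,
    sub_self]

theorem faceCoords_aeval (h : IsSquareInverse A r M) {X₀ : Finset V} (hA : A ⊆ X₀) {N : ℕ}
    (hN : A.card = N) (p : MvPolynomial (Fin N) k) :
    faceCoords A M N (aeval (fun j : Fin N => linForm X₀ (r j)) p) = p := by
  have : (faceCoords A M N).comp (aeval fun j : Fin N => linForm X₀ (r j)) =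
      AlgHom.id k _ := by
    refine algHom_ext fun j => ?_
    rw [AlgHom.comp_apply, aeval_X, faceCoords, AlgHom.comp_apply, ← h.toCoords_restrictVars,
      restrictVars_linForm hA, h.toCoords_linForm (hN ▸ j.2), truncVars, aeval_X, dif_pos j.2]
    rfl
  exact DFunLike.congr_fun this p

end IsSquareInverse

end FaceCoords

variable {n : ℕ} {k : Type*} [Field k] {S : SimplicialFan n} {a : Fin n → (Fin n → ℝ) → k}

namespace SimplicialFan

/-- The faces containing `E` of full dimension in the coordinate subspace `U`. -/
def facets (S : SimplicialFan n) (E : Finset (Fin n → ℝ)) (U : Finset (Fin n)) :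
    Finset (Finset (Fin n → ℝ)) :=
  S.faces.filter fun G => E ⊆ G ∧ suppSet G = U ∧ G.card = U.card

theorem mem_starIdeal_iff_facets [CharP k 2] {E : Finset (Fin n → ℝ)} {U : Finset (Fin n)}
    {p : MvPolynomial (Fin n → ℝ) k} :
    p ∈ S.starIdeal k E U ↔ ∀ G ∈ S.facets E U, restrictVars k G p = 0 := by
  rw [starIdeal_eq, mem_faceIdeal]
  refine forall_congr' fun G => ?_
  simp only [facets, Finset.mem_filter]
  exact ⟨fun h hG => h ⟨⟨⟨hG.1, hG.2.2.1.subset⟩, hG.2.1, hG.2.2.1⟩, hG.2.2.2⟩,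
    fun h hG => h ⟨hG.1.1.1, hG.1.2.1, hG.1.2.2, hG.2⟩⟩

/-- The basis monomials with support in `U` are equinumerous with the facets in `U`. -/
theorem IsSystem.card_basisMonos [CharP k 2] [Infinite k] (ha : S.IsSystem a)
    (E : Finset (Fin n → ℝ)) (U : Finset (Fin n)) :
    {μ | μ ∈ S.basisMonos a E ∧ monoSupp E μ ⊆ U}.Finite ∧
      {μ | μ ∈ S.basisMonos a E ∧ monoSupp E μ ⊆ U}.ncard = (S.facets E U).card := by
  obtain ⟨y, ⟨M, hM⟩, hy⟩ := ha.exists_sequence U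
  have hfac : ∀ G ∈ S.facets E U, G ∈ S.faces ∧ E ⊆ G ∧ suppSet G = U ∧ G.card = U.card :=
    fun G hG => Finset.mem_filter.1 hG
  choose! MG hMG using fun G (hG : G ∈ S.facets E U) => hy G (hfac G hG).1 (hfac G hG).2.2.1.subset
  set η : ℕ → MvPolynomial (Fin n → ℝ) k :=
    fun j => linForm S.verts fun v => ∑ i ∈ U, y j i * a i v with hη
  let R := MvPolynomial (Fin U.card) k
  let Ψ : MvPolynomial (Fin n → ℝ) k →ₐ[k] (S.facets E U → R) :=
    AlgHom.pi fun G => faceCoords G.1 (MG G.1) U.card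
  have hΨ : ∀ p, Ψ p = 0 ↔ p ∈ S.starIdeal k E U := by
    intro p
    rw [mem_starIdeal_iff_facets, funext_iff, Subtype.forall]
    exact forall₂_congr fun G hG => (hMG G hG).faceCoords_eq_zero_iff (hfac G hG).2.2.2
  have hΨη : ∀ (c : R) (p : MvPolynomial (Fin n → ℝ) k),
      Ψ (aeval (fun j : Fin U.card => η j) c * p) = c • Ψ p := by
    intro c p
    rw [map_mul]
    funext G
    change faceCoords G.1 (MG G.1) U.card (aeval (fun j : Fin U.card => η j) c) * _ = c * _
    rw [(hMG G G.2).faceCoords_aeval (S.faces_subset_verts _ (hfac _ G.2).1) (hfac _ G.2).2.2.2]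
  set Bs : Set ((Fin n → ℝ) →₀ ℕ) := {μ | μ ∈ S.basisMonos a E ∧ monoSupp E μ ⊆ U} with hBs
  have hli : LinearIndependent R fun μ : Bs => Ψ (monomial μ.1 1) := by
    change LinearIndepOn R (fun μ => Ψ (monomial μ 1)) Bs
    rw [linearIndepOn_iff']
    intro s c hs hc μ hμ
    have h0 : ∑ μ ∈ s, aeval η (rename Fin.val (c μ)) * monomial μ 1 ∈ S.starIdeal k E U := by
      rw [← hΨ, map_sum, ← hc]
      refine Finset.sum_congr rfl fun μ _ => ?_
      rw [← hΨη, aeval_rename]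
      rfl
    have := ha.eq_zero_of_sum_mem hM hy (fun μ hμ => hs hμ) (fun μ _ ν hν j hj => by
      obtain ⟨u, rfl, -⟩ := coeff_rename_ne_zero _ _ _ hν
      obtain ⟨i, -, rfl⟩ := Finset.mem_image.1 (Finsupp.mapDomain_support hj)
      exact i.2) h0 hμ
    exact rename_injective _ Fin.val_injective (this.trans (map_zero _).symm)
  have hfin : Finite Bs := hli.finite
  have hcard : Nat.card Bs ≤ (S.facets E U).card := by
    have := Fintype.ofFinite Bs
    have h := hli.fintype_card_le_finrank
    rwa [Module.finrank_fintype_fun_eq_card, Fintype.card_coe, ← Nat.card_eq_fintype_card] at h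
  refine ⟨Set.toFinite _, le_antisymm hcard ?_⟩
  have := Fintype.ofFinite Bs
  have hli' : LinearIndependent R fun G : S.facets E U =>
      Ψ (monomial (Finsupp.indicator G.1 fun _ _ => 1) 1) := by
    rw [Fintype.linearIndependent_iff]
    intro c hc G
    have hG := congrFun hc G
    rw [Finset.sum_apply, Finset.sum_eq_single G] at hG
    · refine (mul_eq_zero.1 hG).resolve_right fun h => ?_
      have h' := ((hMG G G.2).faceCoords_eq_zero_iff (hfac _ G.2).2.2.2).1 h
      rw [restrictVars_monomial, if_pos (Finsupp.support_indicator_subset _ _),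
        monomial_eq_zero] at h'
      exact one_ne_zero h'
    · intro H _ hHG
      refine mul_eq_zero_of_right _ (((hMG G G.2).faceCoords_eq_zero_iff (hfac _ G.2).2.2.2).2 ?_)
      rw [restrictVars_monomial, if_neg]
      intro hsub
      have hHsub : H.1 ⊆ G.1 := fun v hv => hsub (Finsupp.mem_support_iff.2 (by
        rw [Finsupp.indicator_of_mem hv]; exact one_ne_zero))
      exact hHG (Subtype.ext (Finset.eq_of_subset_of_card_le hHsub
        ((hfac _ G.2).2.2.2.trans (hfac _ H.2).2.2.2.symm).le))
    · exact fun h => absurd (Finset.mem_univ _) h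
  have hspan : ∀ p, Ψ p ∈ Submodule.span R (Set.range fun μ : Bs => Ψ (monomial μ.1 1)) := by
    intro p
    obtain ⟨lam, hlam, hp⟩ := mem_systemSpan.1
      (ha.systemSpan_eq_top E U ▸ Submodule.mem_top : p ∈ S.systemSpan a E U)
    rw [← sub_add_cancel p (Finsupp.linearCombination k (S.systemMono a) lam), map_add,
      (hΨ _).2 hp, zero_add, Finsupp.linearCombination_apply, Finsupp.sum, map_sum]
    refine sum_mem fun x hx => ?_
    have hx' := hlam x hx
    have e : S.systemMono a x = aeval (fun j : Fin U.card => η j)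
        (faceCoords U M U.card (monomial x.1 1)) * monomial x.2 1 := by
      have h1 := aeval_toCoords (a := a) (S := S) hM (monomial x.1 1)
      rw [restrictVars_monomial, if_pos (Finset.subset_union_left.trans hx'.2),
        ← rename_faceCoords _ rfl, aeval_rename] at h1
      rw [systemMono, ← h1]
      rfl
    rw [map_smul, e, hΨη, ← algebraMap_smul R]
    exact Submodule.smul_mem _ _ (Submodule.smul_mem _ _
      (Submodule.subset_span ⟨⟨x.2, hx'.1, Finset.subset_union_right.trans hx'.2⟩, rfl⟩))
  have := linearIndependent_le_span' _ hli'
    (Set.range fun μ : Bs => Ψ (monomial μ.1 1)) (by rintro _ ⟨G, rfl⟩; exact hspan _)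
  rw [Cardinal.mk_coe_finset, Nat.cast_le] at this
  refine this.trans ((Fintype.card_range_le _).trans ?_)
  rw [← Nat.card_eq_fintype_card]
  exact le_rfl

end SimplicialFan

end Counting

section LocalH

variable {n : ℕ} {k : Type*} [Field k] {S : SimplicialFan n} {a : Fin n → (Fin n → ℝ) → k}
  {E : Finset (Fin n → ℝ)}

theorem sum_superset_neg_one_pow_card {ι : Type*} [Fintype ι] [DecidableEq ι] (W : Finset ι) :
    ∑ U : Finset ι with W ⊆ U, (-1 : ℤ) ^ (Fintype.card ι - U.card) =
      if W = Finset.univ then 1 else 0 := by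
  have : (if W = Finset.univ then 1 else 0 : ℤ) = if Wᶜ = ∅ then 1 else 0 := by
    simp only [Finset.compl_eq_empty_iff]
  rw [this, ← Finset.sum_powerset_neg_one_pow_card]
  refine Finset.sum_nbij' compl compl (fun U hU => ?_) (fun T hT => ?_) (fun U _ => compl_compl U)
    (fun T _ => compl_compl T) fun U _ => ?_
  · rw [Finset.mem_powerset]
    exact Finset.compl_subset_compl.2 (Finset.mem_filter.1 hU).2
  · rw [Finset.mem_filter]
    exact ⟨Finset.mem_univ _, Finset.subset_compl_comm.1 (Finset.mem_powerset.1 hT)⟩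
  · rw [Finset.card_compl]

namespace SimplicialFan

theorem localH_eval_one (S : SimplicialFan n) (E : Finset (Fin n → ℝ)) :
    (localH S E).eval 1 =
      ∑ U : Finset (Fin n), (-1 : ℤ) ^ (n - U.card) * (S.facets E U).card := by
  rw [localH, Polynomial.eval_finsetSum,
    ← Finset.sum_fiberwise_of_maps_to (t := Finset.univ) (g := suppSet)
      fun F _ => Finset.mem_univ (suppSet F)]
  refine Finset.sum_congr rfl fun U _ => ?_
  have hsub : S.facets E U ⊆ (S.faces.filter fun F => E ⊆ F).filter fun F => suppSet F = U := by
    intro G hG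
    obtain ⟨h1, h2, h3, -⟩ := Finset.mem_filter.1 hG
    exact Finset.mem_filter.2 ⟨Finset.mem_filter.2 ⟨h1, h2⟩, h3⟩
  rw [← Finset.sum_subset hsub, mul_comm, ← nsmul_eq_mul, ← Finset.sum_const]
  · refine Finset.sum_congr rfl fun G hG => ?_
    obtain ⟨-, -, h3, h4⟩ := Finset.mem_filter.1 hG
    have h0 : excess G = 0 := by rw [excess, h3, h4, Nat.sub_self]
    simp [h0, h4]
  · intro F hF hFU
    obtain ⟨hF, hU⟩ := Finset.mem_filter.1 hF
    obtain ⟨hF, hE⟩ := Finset.mem_filter.1 hF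
    have h0 : excess F ≠ 0 := by
      have h1 := S.card_le_of_suppSet_subset hF hU.subset
      have h2 : F.card ≠ U.card := fun h => hFU (Finset.mem_filter.2 ⟨hF, hE, hU, h⟩)
      rw [excess, hU]
      omega
    simp [h0]

theorem IsSystem.monoSupp_ne_univ [CharP k 2] [Infinite k] (ha : S.IsSystem a)
    (h : localH S E = 0) {μ : (Fin n → ℝ) →₀ ℕ} (hμ : μ ∈ S.basisMonos a E) :
    monoSupp E μ ≠ Finset.univ := by
  have hfin := (ha.card_basisMonos E Finset.univ).1
  set B := hfin.toFinset with hB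
  have hcard : ∀ U, ((S.facets E U).card : ℤ) = ∑ μ ∈ B, if monoSupp E μ ⊆ U then 1 else 0 := by
    intro U
    rw [← (ha.card_basisMonos E U).2, Finset.sum_boole, ← Set.ncard_coe_finset]
    congr 2
    ext μ
    simp [hB]
  have h1 := S.localH_eval_one E
  simp only [h, Polynomial.eval_zero, hcard, Finset.mul_sum, mul_ite, mul_one, mul_zero] at h1
  rw [Finset.sum_comm] at h1
  simp only [← Finset.sum_filter] at h1
  have h2 := fun W : Finset (Fin n) => sum_superset_neg_one_pow_card W
  simp only [Fintype.card_fin] at h2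
  simp only [h2, Finset.sum_boole] at h1
  have h3 := Finset.card_eq_zero.1 (Nat.cast_eq_zero.1 h1.symm)
  exact fun hu => Finset.notMem_empty μ (h3 ▸ Finset.mem_filter.2
    ⟨hfin.mem_toFinset.2 ⟨hμ, Finset.subset_univ _⟩, hu⟩)

open MvPolynomial IsSystem in
theorem IsSystem.monomial_mem_of_localH_eq_zero [CharP k 2] [Infinite k] (ha : S.IsSystem a)
    (h : localH S E = 0) {μ : (Fin n → ℝ) →₀ ℕ} (hμ : μ.support ∪ E ∈ S.faces)
    (hint : monoSupp E μ = Finset.univ) :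
    monomial μ (1 : k) ∈ S.starIdeal k E Finset.univ ⊔ linearIdeal S a := by
  obtain ⟨p, hp, hmem⟩ := exists_sub_mem_of_monoSupp_eq (a := a) hμ hint
  have : {μ | μ ∈ S.basisMonos a E ∧ monoSupp E μ = Finset.univ} = ∅ :=
    Set.eq_empty_iff_forall_notMem.2 fun ν hν => ha.monoSupp_ne_univ h hν.1 hν.2
  rw [this, Set.image_empty, Submodule.span_empty, Submodule.mem_bot] at hp
  rwa [hp, sub_zero] at hmem

end SimplicialFan

end LocalH

section GenericSystem

namespace SimplicialFan

variable {n : ℕ} {S : SimplicialFan n}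

/-- The vertices of a face can be matched with distinct coordinates in their supports. -/
theorem exists_matching {F : Finset (Fin n → ℝ)} (hF : F ∈ S.faces) :
    ∃ φ : F → Fin n, Function.Injective φ ∧ ∀ v : F, v.1 (φ v) ≠ 0 := by
  obtain ⟨φ, hφ, h⟩ := (Finset.all_card_le_biUnion_card_iff_exists_injective
    fun v : F => Finset.univ.filter fun i => v.1 i ≠ 0).1 fun s => by
      rw [← Finset.card_map (Function.Embedding.subtype _)]
      refine S.card_le_of_suppSet_subset (S.down_closed F hF _ fun v hv => ?_) fun i hi => ?_
      · obtain ⟨w, -, rfl⟩ := Finset.mem_map.1 hv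
        exact w.2
      · obtain ⟨v, hv, hi⟩ := mem_suppSet.1 hi
        obtain ⟨w, hw, rfl⟩ := Finset.mem_map.1 hv
        exact Finset.mem_biUnion.2 ⟨w, hw, Finset.mem_filter.2 ⟨Finset.mem_univ _, hi⟩⟩
  exact ⟨φ, hφ, fun v => (Finset.mem_filter.1 (h v)).2⟩

theorem isSystem_of_det_ne_zero {k : Type*} [Field k] {a : Fin n → (Fin n → ℝ) → k}
    (hsupp : ∀ i v, v i = 0 → a i v = 0)
    (hdet : ∀ F ∈ S.faces, ∃ φ : F → Fin n, (Matrix.of fun u v : F => a (φ u) v).det ≠ 0) :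
    S.IsSystem a := by
  refine ⟨hsupp, fun F hF b => ?_⟩
  obtain ⟨φ, hφ⟩ := hdet F hF
  set A := Matrix.of fun u v : F => a (φ u) v with hA
  set c := Matrix.vecMul (fun v : F => b v) A⁻¹ with hc
  have hcA : Matrix.vecMul c A = fun v : F => b v := by
    rw [hc, Matrix.vecMul_vecMul, Matrix.nonsing_inv_mul _ (isUnit_iff_ne_zero.2 hφ),
      Matrix.vecMul_one]
  refine ⟨fun i => ∑ u with φ u = i, c u, fun v hv => ?_⟩
  have := congrFun hcA ⟨v, hv⟩
  rw [Matrix.vecMul, dotProduct, ← Finset.sum_fiberwise_of_maps_to (t := Finset.univ) (g := φ)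
    fun u _ => Finset.mem_univ _] at this
  rw [← this]
  refine Finset.sum_congr rfl fun i _ => ?_
  rw [Finset.sum_mul]
  refine Finset.sum_congr rfl fun u hu => ?_
  rw [← (Finset.mem_filter.1 hu).2]
  rfl

open MvPolynomial in
/-- A generic matrix supported on the nonzero coordinates is a system in characteristic two. -/
theorem exists_isSystem (S : SimplicialFan n) :
    ∃ (k : Type) (_ : Field k) (_ : CharP k 2) (_ : Infinite k) (a : Fin n → (Fin n → ℝ) → k),
      S.IsSystem a := by
  let R := MvPolynomial (Option (Fin n × (Fin n → ℝ))) (ZMod 2)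
  let P : Fin n → (Fin n → ℝ) → R := fun i v => if v i = 0 then 0 else X (some (i, v))
  have hinj : Function.Injective (algebraMap R (FractionRing R)) := IsFractionRing.injective _ _
  refine ⟨FractionRing R, inferInstance, charP_of_injective_algebraMap hinj 2,
    Infinite.of_injective _ hinj, fun i v => algebraMap R _ (P i v),
    isSystem_of_det_ne_zero (fun i v h => ?_) fun F hF => ?_⟩
  · simp [P, h]
  · obtain ⟨φ, hφ, hne⟩ := exists_matching hF
    refine ⟨φ, ?_⟩
    have e : (Matrix.of fun u v : F => algebraMap R (FractionRing R) (P (φ u) v)) =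
        (algebraMap R (FractionRing R)).mapMatrix (Matrix.of fun u v : F => P (φ u) v) := rfl
    rw [e, ← RingHom.map_det, map_ne_zero_iff _ hinj]
    intro h0
    let ev : R →+* ZMod 2 := eval fun x => x.elim 0 fun p =>
      if h : p.2 ∈ F then if p.1 = φ ⟨p.2, h⟩ then 1 else 0 else 0
    have h1 : ev.mapMatrix (Matrix.of fun u v : F => P (φ u) v) = 1 := by
      ext u v
      rw [RingHom.mapMatrix_apply, Matrix.map_apply, Matrix.of_apply, Matrix.one_apply]
      have hX : ev (X (some (φ u, v.1))) = if u = v then 1 else 0 := by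
        refine (eval_X _).trans ?_
        simp [hφ.eq_iff]
      by_cases hv : v.1 (φ u) = 0
      · rw [show P (φ u) v = 0 from if_pos hv, map_zero, if_neg]
        rintro rfl
        exact hne u hv
      · rw [show P (φ u) v = X (some (φ u, v.1)) from if_neg hv, hX]
    have h2 := congrArg ev h0
    rw [RingHom.map_det, h1, Matrix.det_one, map_zero] at h2
    exact one_ne_zero h2

end SimplicialFan

end GenericSystem

section Conclusion

open MvPolynomial

theorem prod_X_eq_monomial {V k : Type*} [Field k] (A : Finset V) :
    ∏ v ∈ A, (X v : MvPolynomial V k) = monomial (Finsupp.indicator A fun _ _ => 1) 1 := by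
  rw [monomial_eq, C_1, one_mul, Finsupp.prod_of_support_subset _
    (Finsupp.support_indicator_subset A _) _ fun _ _ => pow_zero _]
  refine Finset.prod_congr rfl fun v hv => ?_
  rw [Finsupp.indicator_of_mem hv, pow_one]

theorem support_indicator_one {V : Type*} (A : Finset V) :
    (Finsupp.indicator A fun _ _ => 1 : V →₀ ℕ).support = A := by
  ext v
  by_cases hv : v ∈ A <;> simp [hv]

variable {n : ℕ} {k : Type*} [Field k] {S : SimplicialFan n} {a : Fin n → (Fin n → ℝ) → k}
  {E : Finset (Fin n → ℝ)}

namespace SimplicialFan.IsSystem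

theorem mem_of_prod_X_mul [CharP k 2] [Infinite k] (ha : S.IsSystem a) {W : Finset (Fin n → ℝ)}
    {U : Finset (Fin n)} (hW : Disjoint W E) (hσ : suppSet W ⊆ suppSet E)
    {f : MvPolynomial (Fin n → ℝ) k}
    (h : (∏ v ∈ W, X v) * f ∈ S.starIdeal k E U ⊔ linearIdeal S a) :
    f ∈ S.starIdeal k (W ∪ E) U ⊔ linearIdeal S a := by
  induction W using Finset.induction_on generalizing E with
  | empty => rwa [Finset.prod_empty, one_mul, ← Finset.empty_union E] at h
  | insert v W hv ih =>
    rw [Finset.prod_insert hv, mul_assoc] at h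
    rw [Finset.disjoint_insert_left] at hW
    rw [suppSet_insert, Finset.union_subset_iff] at hσ
    have := ih (Finset.disjoint_insert_right.2 ⟨hv, hW.2⟩)
      (hσ.2.trans (suppSet_mono (Finset.subset_insert v E))) (ha.mem_of_X_mul hW.1 hσ.1 h)
    rwa [Finset.union_insert, ← Finset.insert_union] at this

theorem exists_subset_of_coeff_ne_zero (ha : S.IsSystem a) {m : (Fin n → ℝ) →₀ ℕ}
    (hm : m.support ∪ E ∈ S.faces) {x : (Fin n →₀ ℕ) × ((Fin n → ℝ) →₀ ℕ)} {j : Fin n}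
    (hj : j ∈ x.1.support) (h : coeff m (S.systemMono a x) ≠ 0) :
    ∃ v ∈ m.support, systemSupp E x ⊆ insert j (monoSupp E (m - Finsupp.single v 1)) := by
  obtain ⟨α, μ⟩ := x
  have hα : α = Finsupp.single j 1 + (α - Finsupp.single j 1) := by
    rw [add_tsub_cancel_of_le]
    rw [Finsupp.single_le_iff]
    exact Nat.one_le_iff_ne_zero.2 (Finsupp.mem_support_iff.1 hj)
  set β := α - Finsupp.single j 1
  have e : S.systemMono a (α, μ) = linForm S.verts (a j) * S.systemMono a (β, μ) := by
    rw [systemMono, systemMono, hα, ← mul_one (1 : k), ← monomial_mul, map_mul, mul_one,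
      show (monomial (Finsupp.single j 1)) (1 : k) = X j from rfl, aeval_X, mul_assoc]
  rw [e, linForm, Finset.sum_mul, coeff_sum] at h
  obtain ⟨v, -, hv⟩ := Finset.exists_ne_zero_of_sum_ne_zero h
  rw [mul_assoc, coeff_C_mul, coeff_X_mul'] at hv
  split_ifs at hv with hvm
  swap
  · exact absurd (mul_zero _) hv
  refine ⟨v, hvm, ?_⟩
  have hsub : systemSupp E (β, μ) ⊆ monoSupp E (m - Finsupp.single v 1) := by
    by_contra hn
    refine hv (mul_eq_zero_of_right _ (mem_starIdeal.1 (ha.systemMono_mem hn) _ ?_ subset_rfl))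
    exact S.down_closed _ hm _ (Finset.union_subset_union_left (Finsupp.support_tsub))
  refine Finset.union_subset ?_ (Finset.subset_union_right.trans
    (hsub.trans (Finset.subset_insert _ _)))
  intro i hi
  change i ∈ α.support at hi
  rw [hα] at hi
  rcases Finset.mem_union.1 (Finsupp.support_add hi) with hi | hi
  · rw [Finset.mem_singleton.1 (Finsupp.support_single_subset hi)]
    exact Finset.mem_insert_self _ _
  · exact Finset.mem_insert_of_mem (hsub (Finset.mem_union_left _ hi))

/-- An interior monomial which cannot be covered after trading a vertex for a single coordinate
is nonzero modulo the linear system. -/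
theorem exists_eq_univ_of_monomial_mem [CharP k 2] [Infinite k] (ha : S.IsSystem a)
    {m : (Fin n → ℝ) →₀ ℕ} (hm : m.support ∪ E ∈ S.faces) (hint : monoSupp E m = Finset.univ)
    (h : monomial m (1 : k) ∈ S.starIdeal k E Finset.univ ⊔ linearIdeal S a) :
    ∃ v ∈ m.support, ∃ j, insert j (monoSupp E (m - Finsupp.single v 1)) = Finset.univ := by
  obtain ⟨lam, hlam, hmem⟩ := mem_systemSpan.1
    (ha.systemSpan_eq_top E Finset.univ ▸ Submodule.mem_top :
      monomial m (1 : k) ∈ S.systemSpan a E Finset.univ)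
  have huniv : ∀ x ∈ lam.support, systemSupp E x = Finset.univ := by
    intro x hx
    by_contra hne
    have := ha.filter_eq (lam' := 0) (fun x hx => (hlam x hx).1) (by simp)
      (starIdeal_mono subset_rfl (Finset.subset_univ (systemSupp E x)) hmem) (by
        rw [map_zero, sub_zero]
        refine monomial_mem_starIdeal (fun hsub => hne ?_) 1
        rwa [hint, Finset.univ_subset_iff] at hsub)
    have h0 := DFunLike.congr_fun this x
    rw [Finsupp.filter_apply, if_pos subset_rfl] at h0
    exact Finsupp.mem_support_iff.1 hx h0
  have hpos : ∀ x ∈ lam.support, x.1 ≠ 0 := by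
    have hlc : Finsupp.linearCombination k (S.systemMono a) lam ∈
        S.starIdeal k E Finset.univ ⊔ linearIdeal S a := by
      rw [← sub_sub_cancel (monomial m (1 : k)) (Finsupp.linearCombination k (S.systemMono a) lam)]
      exact sub_mem h (Ideal.mem_sup_left hmem)
    rw [Finsupp.linearCombination_apply, Finsupp.sum,
      ← Finset.sum_filter_add_sum_filter_not lam.support fun x => x.1 = 0] at hlc
    have hlc' := (Submodule.add_mem_iff_left _ (sum_mem fun x hx => ?_)).1 hlc
    · have hinj : Set.InjOn Prod.snd (lam.support.filter fun x => x.1 = 0 :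
          Set ((Fin n →₀ ℕ) × ((Fin n → ℝ) →₀ ℕ))) := fun x hx y hy hxy =>
        Prod.ext ((Finset.mem_filter.1 hx).2.trans (Finset.mem_filter.1 hy).2.symm) hxy
      have hsum : ∑ μ ∈ (lam.support.filter fun x => x.1 = 0).image Prod.snd,
          C (lam (0, μ)) * monomial μ (1 : k) ∈ S.starIdeal k E Finset.univ ⊔ linearIdeal S a := by
        rw [Finset.sum_image hinj]
        convert hlc' using 1
        refine Finset.sum_congr rfl fun x hx => ?_
        obtain ⟨α, μ⟩ := x
        obtain rfl : α = 0 := (Finset.mem_filter.1 hx).2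
        have e : S.systemMono a (0, μ) = monomial μ 1 := by simp [systemMono]
        rw [C_mul', e]
      have hz := eq_zero_of_sum_mem_sup (fun μ hμ => by
        obtain ⟨x, hx, rfl⟩ := Finset.mem_image.1 hμ
        exact ⟨(hlam x (Finset.mem_filter.1 hx).1).1, Finset.subset_univ _⟩) hsum
      rintro ⟨α, μ⟩ hx rfl
      exact Finsupp.mem_support_iff.1 hx
        (hz μ (Finset.mem_image.2 ⟨(0, μ), Finset.mem_filter.2 ⟨hx, rfl⟩, rfl⟩))
    · obtain ⟨-, hx⟩ := Finset.mem_filter.1 hx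
      obtain ⟨i, hi⟩ := Finsupp.support_nonempty_iff.2 hx
      rw [← C_mul']
      refine Ideal.mul_mem_left _ _ (Ideal.mul_mem_right _ _ (Ideal.mem_sup_right ?_))
      rw [aeval_monomial, map_one, one_mul, Finsupp.prod]
      refine Ideal.mem_of_dvd _ (Finset.dvd_prod_of_mem _ hi) ?_
      exact Ideal.pow_mem_of_mem _ (Ideal.subset_span (Set.mem_range_self i)) _
        (Nat.pos_of_ne_zero (Finsupp.mem_support_iff.1 hi))
  have hcoeff := mem_starIdeal.1 hmem m hm (Finset.subset_univ _)
  rw [coeff_sub, coeff_monomial, if_pos rfl, sub_eq_zero, Finsupp.linearCombination_apply,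
    Finsupp.sum, coeff_sum] at hcoeff
  obtain ⟨x, hx, hne⟩ := Finset.exists_ne_zero_of_sum_ne_zero (hcoeff ▸ one_ne_zero)
  rw [coeff_smul, smul_eq_mul] at hne
  obtain ⟨j, hj⟩ := Finsupp.support_nonempty_iff.2 (hpos x hx)
  obtain ⟨v, hv, hsub⟩ := ha.exists_subset_of_coeff_ne_zero hm hj (right_ne_zero_of_mul hne)
  refine ⟨v, hv, j, ?_⟩
  rwa [huniv x hx, Finset.univ_subset_iff] at hsub

end SimplicialFan.IsSystem

theorem IsFullPartition.suppSet_subset {C F₁ F₂ : Finset (Fin n → ℝ)}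
    (h : IsFullPartition E C F₁ F₂) : suppSet F₁ ⊆ suppSet (F₂ ∪ E) := by
  obtain ⟨hC, -, h1, -, -, h2⟩ := h
  rw [h2]
  intro i hi
  obtain ⟨v, hv, hvi⟩ := mem_suppSet.1 hi
  refine Finset.mem_sdiff.2 ⟨Finset.mem_univ _, fun hn => ?_⟩
  obtain ⟨A, hA, hiA⟩ := Finset.mem_biUnion.1 hn
  refine (Finset.mem_sdiff.1 hiA).2 (mem_suppSet.2 ⟨v, Finset.mem_erase.2 ⟨?_, ?_⟩, hvi⟩)
  · rintro rfl
    exact Finset.disjoint_left.1 h1 hv hA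
  · rw [hC]
    exact Finset.mem_union_left _ (Finset.mem_union_left _ (Finset.mem_union_left _ hv))

end Conclusion

/-- **Theorem 1.8.** Let `(V, 𝒮)` be a simplicial fan supported on `ℝⁿ_{≥0}`, let
`E ∈ 𝒮`, and let `C ∈ lk(E)` be a face that admits a full partition. If the local
`h`-polynomial `ℓ(𝒮, E; t)` is the zero polynomial, then `C` is a U-pyramid. -/
theorem localH_eq_zero_imp_isUPyramid {n : ℕ} (S : SimplicialFan n)
    (E : Finset (Fin n → ℝ)) (hE : E ∈ S.faces)
    (C : Finset (Fin n → ℝ)) (hC : C ∈ link S E)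
    (F₁ F₂ : Finset (Fin n → ℝ)) (hfull : IsFullPartition E C F₁ F₂)
    (hzero : localH S E = 0) :
    IsUPyramid E C := by
  obtain ⟨k, _, _, _, a, ha⟩ := S.exists_isSystem
  obtain ⟨-, hdisj, hCE⟩ := Finset.mem_filter.1 hC
  have hσ := hfull.suppSet_subset
  obtain ⟨hpart, h12, h1A, h2A, hint, -⟩ := hfull
  set 𝒜 := apices E C with h𝒜
  have hsub : ∀ v, v ∈ F₁ ∨ v ∈ F₂ ∨ v ∈ 𝒜 → v ∈ C := by
    intro v hv
    rw [hpart, Finset.mem_union, Finset.mem_union]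
    tauto
  have hnotE : ∀ v ∈ C, v ∉ E := fun v hv hvE =>
    Finset.notMem_empty v (hdisj ▸ Finset.mem_inter.2 ⟨hv, hvE⟩)
  have hmem := ha.monomial_mem_of_localH_eq_zero hzero
    (μ := Finsupp.indicator (F₁ ∪ 𝒜) fun _ _ => 1) (by
      rw [support_indicator_one]
      refine S.down_closed _ hCE _ (Finset.union_subset_union_left fun v hv => hsub v ?_)
      exact (Finset.mem_union.1 hv).imp_right Or.inr) (by
      rw [monoSupp, support_indicator_one]
      exact hint)
  rw [← prod_X_eq_monomial, Finset.prod_union h1A] at hmem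
  have hmem' := ha.mem_of_prod_X_mul (E := F₂ ∪ E) (Finset.disjoint_union_right.2
    ⟨h12, Finset.disjoint_left.2 fun v hv => hnotE v (hsub v (Or.inl hv))⟩) hσ
    (sup_le_sup_right (SimplicialFan.starIdeal_mono Finset.subset_union_right subset_rfl) _ hmem)
  rw [prod_X_eq_monomial] at hmem'
  obtain ⟨A, hA, j, hj⟩ := ha.exists_eq_univ_of_monomial_mem (by
      rw [support_indicator_one]
      refine S.down_closed _ hCE _ fun v hv => ?_
      have := hsub v
      simp only [Finset.mem_union] at hv ⊢
      tauto) (by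
      rw [monoSupp, support_indicator_one, ← Finset.univ_subset_iff, ← hint]
      refine suppSet_mono fun v hv => ?_
      simp only [Finset.mem_union] at hv ⊢
      tauto) hmem'
  rw [support_indicator_one] at hA
  refine ⟨A, hA, le_antisymm ?_ (Finset.card_pos.2 ?_)⟩
  · rw [← Finset.card_singleton j]
    refine Finset.card_le_card fun i hi => ?_
    have hij : i ∈ insert j _ := hj ▸ Finset.mem_univ i
    refine Finset.mem_singleton.2 ((Finset.mem_insert.1 hij).resolve_right fun h => ?_)
    refine (Finset.mem_sdiff.1 hi).2 (suppSet_mono (fun v hv => ?_) h)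
    have hv' : (v ∈ 𝒜 ∧ v ≠ A) ∨ v ∈ F₁ ∨ v ∈ F₂ ∨ v ∈ E := by
      rcases Finset.mem_union.1 hv with hv | hv
      · left
        rw [Finsupp.mem_support_iff, Finsupp.tsub_apply] at hv
        by_cases hvA : v ∈ 𝒜
        · refine ⟨hvA, ?_⟩
          rintro rfl
          simp [hvA] at hv
        · simp [hvA] at hv
      · simp only [Finset.mem_union] at hv
        tauto
    have hvC := hsub v
    refine Finset.mem_erase.2 ⟨?_, Finset.mem_union.2 (by tauto)⟩
    rintro rfl
    rcases hv' with h | h | h | h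
    · exact h.2 rfl
    · exact Finset.disjoint_left.1 h1A h hA
    · exact Finset.disjoint_left.1 h2A h hA
    · exact hnotE v (hsub v (Or.inr (Or.inr hA))) h
  · obtain ⟨-, -, -, hnot⟩ := Finset.mem_filter.1 hA
    rw [baseDirs, Finset.sdiff_nonempty, Finset.univ_subset_iff]
    exact hnot

end
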